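/- Let H be a Tonelli Hamiltonian on the flat torus 𝕋ⁿ and B a magnetic field on 𝕋ⁿ. Set e₀(H) := sup_{q∈ℝⁿ} inf_{p∈ℝⁿ} H(q,p) and define the Mañé critical value c(H,B) := inf{ sup_{q∈ℝⁿ} H(q, −θ(q)) : θ : ℝⁿ → ℝⁿ smooth with ⟨Dθ(q)u, v⟩ − ⟨Dθ(q)v, u⟩ = ⟨B(q)u, v⟩ for all q, u, v ∈ ℝⁿ } ∈ ℝ ∪ {+∞}. Then for Lebesgue-almost every k with e₀(H) < k < c(H,B) there exist T > 0 and a nonconstant smooth T-periodic curve (q,p) : ℝ → ℝⁿ × ℝⁿ solving q̇ = ∇_p H(q,p), ṗ = −∇_q H(q,p) − B(q)∇_p H(q,p), and satisfying H(q(t),p(t)) = k for all t. -/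

import Mathlib

open MeasureTheory
open scoped RealInnerProductSpace

section ModuleA
open Filter Topology Set MeasureTheory
open scoped RealInnerProductSpace

set_option linter.unusedSectionVars false
set_option linter.unusedVariables false
namespace MT

variable {E : Type*} [NormedAddCommGroup E] [InnerProductSpace ℝ E]

/-- The covector `(u, w) ↦ ⟪a, u⟫ + ⟪b, w⟫`. -/
noncomputable def pairL (a b : E) : E × E →L[ℝ] ℝ :=
  (innerSL ℝ a).comp (ContinuousLinearMap.fst ℝ E E) +
    (innerSL ℝ b).comp (ContinuousLinearMap.snd ℝ E E)

@[simp] lemma pairL_apply (a b : E) (z : E × E) : pairL a b z = ⟪a, z.1⟫ + ⟪b, z.2⟫ := by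
  simp [pairL]

lemma pairL_continuous : Continuous (fun z : E × E => pairL z.1 z.2) := by
  unfold pairL
  have h1 : Continuous (fun z : E × E => (innerSL ℝ z.1).comp (ContinuousLinearMap.fst ℝ E E)) :=
    (((innerSL ℝ).continuous.comp continuous_fst).clm_comp continuous_const)
  have h2 : Continuous (fun z : E × E => (innerSL ℝ z.2).comp (ContinuousLinearMap.snd ℝ E E)) :=
    (((innerSL ℝ).continuous.comp continuous_snd).clm_comp continuous_const)
  exact h1.add h2

/-- A tame Hamiltonian: `C¹`, periodic, strictly convex and superlinear in `p`, with growth bounds. -/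
structure Tame (Λ : AddSubgroup E) (h : E × E → ℝ) (hq hp : E × E → E) (C : ℝ) : Prop where
  hasD : ∀ z, HasFDerivAt h (pairL (hq z) (hp z)) z
  cq : Continuous hq
  cp : Continuous hp
  per : ∀ m ∈ Λ, ∀ q p, h (q + m, p) = h (q, p)
  perq : ∀ m ∈ Λ, ∀ q p, hq (q + m, p) = hq (q, p)
  conv : ∀ q, StrictConvexOn ℝ univ (fun p => h (q, p))
  super : ∀ A : ℝ, ∃ c : ℝ, ∀ q p, A * ‖p‖ - c ≤ h (q, p)
  Cpos : 1 ≤ C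
  qb : ∀ z, ‖hq z‖ ≤ C
  growth : ∀ q p, (1 + ‖p‖) * (1 + ‖hp (q, p)‖) ≤ C * (h (q, p) + C)

/-- `p` realizes the Legendre supremum at `z = (q, v)`. -/
def IsLeg (h : E × E → ℝ) (z : E × E) (p : E) : Prop :=
  ∀ p', ⟪p', z.2⟫ - h (z.1, p') ≤ ⟪p, z.2⟫ - h (z.1, p)

/-- The Legendre momentum. -/
noncomputable def pst (h : E × E → ℝ) (z : E × E) : E := by
  classical exact if hz : ∃ p, IsLeg h z p then hz.choose else 0

/-- The Lagrangian. -/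
noncomputable def Lag (h : E × E → ℝ) (z : E × E) : ℝ := ⟪pst h z, z.2⟫ - h (z.1, pst h z)

namespace Tame

variable {Λ : AddSubgroup E} {h : E × E → ℝ} {hq hp : E × E → E} {C : ℝ}

lemma cont (H : Tame Λ h hq hp C) : Continuous h :=
  continuous_iff_continuousAt.2 fun z => (H.hasD z).continuousAt

lemma exists_leg [FiniteDimensional ℝ E] (H : Tame Λ h hq hp C) (z : E × E) : ∃ p, IsLeg h z p := by
  obtain ⟨c, hc⟩ := H.super (‖z.2‖ + 1)
  have hcont : Continuous (fun p => h (z.1, p) - ⟪p, z.2⟫) := by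
    have := H.cont
    fun_prop
  have hlim : Tendsto (fun p => h (z.1, p) - ⟪p, z.2⟫) (cocompact E) atTop := by
    have h1 : Tendsto (fun p : E => ‖p‖ - c) (cocompact E) atTop :=
      tendsto_atTop_add_const_right _ _ (tendsto_norm_cocompact_atTop)
    refine tendsto_atTop_mono (fun p => ?_) h1
    have := hc z.1 p
    have h2 := real_inner_le_norm p z.2
    nlinarith
  obtain ⟨p, hp⟩ := hcont.exists_forall_le hlim
  refine ⟨p, fun p' => ?_⟩
  have := hp p'
  linarith

lemma leg_unique (H : Tame Λ h hq hp C) {z : E × E} {p p' : E} (h1 : IsLeg h z p)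
    (h2 : IsLeg h z p') : p = p' := by
  by_contra hne
  have hs := (H.conv z.1).2 (mem_univ p) (mem_univ p') hne (show (0:ℝ) < 1/2 by norm_num)
    (show (0:ℝ) < 1/2 by norm_num) (by norm_num)
  have h3 := h1 p'
  have h4 := h2 p
  have h5 := h1 ((1/2 : ℝ) • p + (1/2 : ℝ) • p')
  simp only [inner_add_left, inner_smul_left, smul_eq_mul, RCLike.conj_to_real] at h5 hs
  linarith

lemma pst_leg [FiniteDimensional ℝ E] (H : Tame Λ h hq hp C) (z : E × E) : IsLeg h z (pst h z) := by
  have := H.exists_leg z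
  rw [pst, dif_pos this]
  exact this.choose_spec

lemma pst_eq [FiniteDimensional ℝ E] (H : Tame Λ h hq hp C) {z : E × E} {p : E} (hz : IsLeg h z p) :
    pst h z = p := H.leg_unique (H.pst_leg z) hz

lemma hasD_p (H : Tame Λ h hq hp C) (q p : E) :
    HasFDerivAt (fun p => h (q, p)) (innerSL ℝ (hp (q, p))) p := by
  have h1 : HasFDerivAt (fun p : E => (q, p)) (ContinuousLinearMap.inr ℝ E E) p :=
    hasFDerivAt_prodMk_right q p
  have := (H.hasD (q, p)).comp p h1
  exact this.congr_fderiv (by ext w; simp)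

lemma hasD_q (H : Tame Λ h hq hp C) (q p : E) :
    HasFDerivAt (fun q => h (q, p)) (innerSL ℝ (hq (q, p))) q := by
  have h1 : HasFDerivAt (fun q : E => (q, p)) (ContinuousLinearMap.inl ℝ E E) q :=
    hasFDerivAt_prodMk_left q p
  have := (H.hasD (q, p)).comp q h1
  exact this.congr_fderiv (by ext w; simp)

lemma hp_of_leg (H : Tame Λ h hq hp C) {z : E × E} {p : E} (hz : IsLeg h z p) :
    hp (z.1, p) = z.2 := by
  have h1 : IsLocalMax (fun p' => ⟪p', z.2⟫ - h (z.1, p')) p :=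
    Eventually.of_forall hz
  have h2 : HasFDerivAt (fun p' => ⟪p', z.2⟫ - h (z.1, p'))
      (innerSL ℝ z.2 - innerSL ℝ (hp (z.1, p))) p := by
    have h3 : HasFDerivAt (fun p' : E => ⟪p', z.2⟫) (innerSL ℝ z.2) p := by
      have := (innerSL ℝ z.2).hasFDerivAt (x := p)
      refine this.congr_of_eventuallyEq (Eventually.of_forall fun p' => ?_)
      simp [real_inner_comm]
    exact h3.sub (H.hasD_p z.1 p)
  have h4 := h1.hasFDerivAt_eq_zero h2
  have h5 : innerSL ℝ z.2 = innerSL ℝ (hp (z.1, p)) := sub_eq_zero.1 h4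
  have h6 : ⟪z.2 - hp (z.1, p), z.2 - hp (z.1, p)⟫ = 0 := by
    have := congrArg (fun l => l (z.2 - hp (z.1, p))) h5
    simp only [innerSL_apply_apply] at this
    rw [inner_sub_left, this, sub_self]
  exact (sub_eq_zero.1 (inner_self_eq_zero.1 h6)).symm

lemma hp_pst [FiniteDimensional ℝ E] (H : Tame Λ h hq hp C) (z : E × E) : hp (z.1, pst h z) = z.2 :=
  H.hp_of_leg (H.pst_leg z)

/-- A convexity inequality: the graph lies above the tangent. -/
lemma tangent (H : Tame Λ h hq hp C) (q p p' : E) :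
    h (q, p) + ⟪hp (q, p), p' - p⟫ ≤ h (q, p') := by
  have hc := (H.conv q).convexOn
  let g : ℝ → ℝ := fun t => h (q, p + t • (p' - p))
  have hg : ConvexOn ℝ univ g := by
    have := hc.comp_affineMap (AffineMap.lineMap p p' : ℝ →ᵃ[ℝ] E)
    have h2 : g = (fun p => h (q, p)) ∘ (AffineMap.lineMap p p' : ℝ →ᵃ[ℝ] E) := by
      funext t
      simp [g, AffineMap.lineMap_apply, add_comm]
    rw [h2]
    simpa using this
  have hd : HasDerivAt g ⟪hp (q, p), p' - p⟫ 0 := by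
    have h1 : HasDerivAt (fun t : ℝ => p + t • (p' - p)) (p' - p) 0 := by
      simpa using ((hasDerivAt_id (0 : ℝ)).smul_const (p' - p)).const_add p
    have h2 : HasFDerivAt (fun p => h (q, p)) (innerSL ℝ (hp (q, p))) (p + (0:ℝ) • (p' - p)) := by
      simpa using H.hasD_p q p
    have h3 := h2.comp_hasDerivAt (0:ℝ) h1
    exact h3.congr_deriv (by simp)
  have := hg.le_slope_of_hasDerivAt (mem_univ 0) (mem_univ 1) zero_lt_one hd
  simp only [slope, g, vsub_eq_sub] at this
  simp at this
  linarith

lemma leg_of_hp (H : Tame Λ h hq hp C) {q v p : E} (hz : hp (q, p) = v) : IsLeg h (q, v) p := by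
  intro p'
  have := H.tangent q p p'
  rw [hz, inner_sub_right] at this
  simp only
  rw [real_inner_comm, real_inner_comm v p]
  linarith

lemma pst_continuous [FiniteDimensional ℝ E] (H : Tame Λ h hq hp C) : Continuous (pst h) := by
  rw [continuous_iff_continuousAt]
  intro z0
  rw [ContinuousAt, tendsto_iff_ultrafilter]
  intro U hU
  obtain ⟨c, hc⟩ := H.super (‖z0.2‖ + 2)
  have hb : ∀ᶠ z in 𝓝 z0, pst h z ∈ Metric.closedBall (0 : E) (c + (h (z0.1, 0) + 1)) := by
    have h1 : ∀ᶠ z : E × E in 𝓝 z0, ‖z.2‖ < ‖z0.2‖ + 1 := by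
      have : ContinuousAt (fun z : E × E => ‖z.2‖) z0 := by fun_prop
      exact this.eventually_lt_const (by linarith)
    have h2 : ∀ᶠ z : E × E in 𝓝 z0, h (z.1, 0) < h (z0.1, 0) + 1 := by
      have : ContinuousAt (fun z : E × E => h (z.1, 0)) z0 := by
        have := H.cont
        fun_prop
      exact this.eventually_lt_const (by linarith)
    filter_upwards [h1, h2] with z hz1 hz2
    have h3 := H.pst_leg z 0
    have h4 := hc z.1 (pst h z)
    have h5 := real_inner_le_norm (pst h z) z.2
    simp only [inner_zero_left, mem_closedBall_zero_iff] at h3 ⊢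
    nlinarith [norm_nonneg (pst h z)]
  have hb' : (U.map (pst h) : Filter E) ≤ 𝓟 (Metric.closedBall (0 : E) (c + (h (z0.1, 0) + 1))) := by
    rw [le_principal_iff]
    exact hU hb
  obtain ⟨p, -, hp'⟩ := (isCompact_closedBall (0 : E) _).ultrafilter_le_nhds _ hb'
  have ht : Tendsto (pst h) U (𝓝 p) := hp'
  have hz : Tendsto id (U : Filter (E × E)) (𝓝 z0) := hU
  have hz1 : Tendsto (fun z : E × E => z.1) (U : Filter (E × E)) (𝓝 z0.1) :=
    (continuous_fst.tendsto z0).comp hz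
  have hz2 : Tendsto (fun z : E × E => z.2) (U : Filter (E × E)) (𝓝 z0.2) :=
    (continuous_snd.tendsto z0).comp hz
  have hl : IsLeg h z0 p := by
    intro p'
    have t1 : Tendsto (fun z : E × E => ⟪p', z.2⟫ - h (z.1, p')) U (𝓝 (⟪p', z0.2⟫ - h (z0.1, p'))) :=
      (tendsto_const_nhds.inner hz2).sub ((H.cont.tendsto _).comp (hz1.prodMk_nhds tendsto_const_nhds))
    have t2 : Tendsto (fun z : E × E => ⟪pst h z, z.2⟫ - h (z.1, pst h z)) U
        (𝓝 (⟪p, z0.2⟫ - h (z0.1, p))) :=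
      (ht.inner hz2).sub ((H.cont.tendsto _).comp (hz1.prodMk_nhds ht))
    exact le_of_tendsto_of_tendsto' t1 t2 fun z => H.pst_leg z p'
  rw [H.pst_eq hl]
  exact ht

lemma lag_ge [FiniteDimensional ℝ E] (H : Tame Λ h hq hp C) (z : E × E) (p : E) :
    ⟪p, z.2⟫ - h (z.1, p) ≤ Lag h z := H.pst_leg z p

lemma lag_continuous [FiniteDimensional ℝ E] (H : Tame Λ h hq hp C) : Continuous (Lag h) := by
  have h1 := H.pst_continuous
  have h2 := H.cont
  unfold Lag
  fun_prop

lemma lag_hasD [FiniteDimensional ℝ E] (H : Tame Λ h hq hp C) (z : E × E) :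
    HasFDerivAt (Lag h) (pairL (-hq (z.1, pst h z)) (pst h z)) z := by
  set p0 := pst h z with hp0
  have hstrict : HasStrictFDerivAt h (pairL (hq (z.1, p0)) (hp (z.1, p0))) (z.1, p0) := by
    refine hasStrictFDerivAt_of_hasFDerivAt_of_continuousAt
      (Eventually.of_forall fun y => H.hasD y) ?_
    exact (pairL_continuous.comp (H.cq.prodMk H.cp)).continuousAt
  have hlo := hstrict.isLittleO
  rw [hasFDerivAt_iff_isLittleO, Asymptotics.isLittleO_iff]
  intro ε hε
  have hε2 : 0 < ε / 2 := by linarith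
  have hev := (Asymptotics.isLittleO_iff.1 hlo) hε2
  have hpc : Tendsto (pst h) (𝓝 z) (𝓝 p0) := H.pst_continuous.tendsto z
  have t1 : Tendsto (fun y : E × E => (((y.1, pst h y), (z.1, pst h y)) : (E × E) × (E × E))) (𝓝 z)
      (𝓝 ((z.1, p0), (z.1, p0))) :=
    (((continuous_fst.tendsto z).prodMk_nhds hpc)).prodMk_nhds (tendsto_const_nhds.prodMk_nhds hpc)
  have t2 : Tendsto (fun y : E × E => (((y.1, p0), (z.1, p0)) : (E × E) × (E × E))) (𝓝 z)
      (𝓝 ((z.1, p0), (z.1, p0))) :=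
    (((continuous_fst.tendsto z).prodMk_nhds tendsto_const_nhds)).prodMk_nhds tendsto_const_nhds
  have hclose : ∀ᶠ y in 𝓝 z, ‖pst h y - p0‖ ≤ ε / 2 := by
    have := (Metric.tendsto_nhds.1 hpc) (ε / 2) hε2
    filter_upwards [this] with y hy
    rw [← dist_eq_norm]; exact hy.le
  filter_upwards [t1.eventually hev, t2.eventually hev, hclose] with y h1 h2 h3
  simp only [Prod.mk_sub_mk, sub_self, pairL_apply, inner_zero_right, add_zero, Prod.norm_mk,
    norm_zero] at h1 h2
  have hn : max ‖y.1 - z.1‖ 0 = ‖y.1 - z.1‖ := max_eq_left (norm_nonneg _)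
  rw [hn] at h1 h2
  rw [Real.norm_eq_abs, abs_le] at h1 h2 ⊢
  have hA := H.pst_leg y p0
  have hB := H.pst_leg z (pst h y)
  have n1 : ‖y.1 - z.1‖ ≤ ‖y - z‖ := norm_fst_le (y - z)
  have n2 : ‖y.2 - z.2‖ ≤ ‖y - z‖ := norm_snd_le (y - z)
  have n3 : |⟪pst h y - p0, y.2 - z.2⟫| ≤ (ε / 2) * ‖y - z‖ :=
    (abs_real_inner_le_norm _ _).trans (mul_le_mul h3 n2 (norm_nonneg _) hε2.le)
  have n4 : (ε / 2) * ‖y.1 - z.1‖ ≤ (ε / 2) * ‖y - z‖ := mul_le_mul_of_nonneg_left n1 hε2.le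
  rw [abs_le] at n3
  simp only [Lag, pairL_apply, Prod.fst_sub, Prod.snd_sub, inner_neg_left]
  rw [← hp0] at hB ⊢
  simp only [inner_sub_left, inner_sub_right] at *
  constructor <;> linarith [n3.1, n3.2, h1.1, h1.2, h2.1, h2.2]

lemma lag_per [FiniteDimensional ℝ E] (H : Tame Λ h hq hp C) {m : E} (hm : m ∈ Λ) (q v : E) :
    pst h (q + m, v) = pst h (q, v) := by
  apply H.pst_eq
  intro p'
  have := H.pst_leg (q, v) p'
  simp only [H.per m hm] at this ⊢
  exact this

lemma h_lip (H : Tame Λ h hq hp C) (q q' p : E) : |h (q, p) - h (q', p)| ≤ C * ‖q - q'‖ := by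
  have := convex_univ.norm_image_sub_le_of_norm_hasFDerivWithin_le (f := fun q => h (q, p))
    (f' := fun q => innerSL ℝ (hq (q, p))) (C := C)
    (fun x _ => (H.hasD_q x p).hasFDerivWithinAt)
    (fun x _ => by rw [innerSL_apply_norm]; exact H.qb _) (mem_univ q') (mem_univ q)
  simpa using this

lemma lag_lip [FiniteDimensional ℝ E] (H : Tame Λ h hq hp C) (q q' v : E) :
    Lag h (q, v) ≤ Lag h (q', v) + C * ‖q - q'‖ := by
  have h1 := H.pst_leg (q', v) (pst h (q, v))
  have h2 := (abs_le.1 (H.h_lip q q' (pst h (q, v)))).1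
  simp only [Lag] at h1 ⊢
  linarith

lemma lag_eq (h : E × E → ℝ) (z : E × E) : Lag h z = ⟪pst h z, z.2⟫ - h (z.1, pst h z) := rfl

lemma hC (H : Tame Λ h hq hp C) (q p : E) : 1 + ‖p‖ ≤ C * (h (q, p) + C) := by
  refine le_trans ?_ (H.growth q p)
  nlinarith [norm_nonneg p, norm_nonneg (hp (q, p))]

lemma hC2 (H : Tame Λ h hq hp C) (q p : E) : ‖hp (q, p)‖ ≤ C * (h (q, p) + C) := by
  refine le_trans ?_ (H.growth q p)
  nlinarith [norm_nonneg p, norm_nonneg (hp (q, p))]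

lemma hC3 (H : Tame Λ h hq hp C) (q p : E) : ⟪p, hp (q, p)⟫ ≤ C * (h (q, p) + C) := by
  refine le_trans ?_ (H.growth q p)
  have := real_inner_le_norm p (hp (q, p))
  nlinarith [norm_nonneg p, norm_nonneg (hp (q, p))]

lemma hC4 (H : Tame Λ h hq hp C) (q p : E) : - C ≤ h (q, p) := by
  have := H.hC q p
  have h1 := H.Cpos
  by_contra hcon
  push Not at hcon
  nlinarith [norm_nonneg p]

end Tame
end MT

end ModuleA

section ModuleB
open Filter Topology Set MeasureTheory
open scoped RealInnerProductSpace

set_option linter.unusedSectionVars false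
set_option linter.unusedVariables false
namespace MT

variable {E : Type*} [NormedAddCommGroup E] [InnerProductSpace ℝ E]

/-- A gauge potential: quasi-periodic with bounded continuous derivative. -/
structure Gauge (Λ : AddSubgroup E) (θ : E → E) (θ' : E → E →L[ℝ] E) (K : ℝ) : Prop where
  hasD : ∀ q, HasFDerivAt θ (θ' q) q
  cont' : Continuous θ'
  per : ∀ m ∈ Λ, ∃ c, ∀ q, θ (q + m) = θ q + c
  per' : ∀ m ∈ Λ, ∀ q, θ' (q + m) = θ' q
  bd : ∀ q, ‖θ' q‖ ≤ K

section disc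
variable {N : ℕ} [NeZero N]

/-- Discrete increment. -/
def dx (x : ZMod N → E) (i : ZMod N) : E := x (i + 1) - x i

/-- Length of a discrete loop. -/
noncomputable def len (x : ZMod N → E) : ℝ := ∑ i, ‖dx x i‖

/-- Discrete velocity. -/
noncomputable def vel (x : ZMod N → E) (T : ℝ) (i : ZMod N) : E := ((N : ℝ) / T) • dx x i

/-- Discrete momentum. -/
noncomputable def mom (h : E × E → ℝ) (x : ZMod N → E) (T : ℝ) (i : ZMod N) : E :=
  pst h (x i, vel x T i)

/-- Magnetic term. -/
noncomputable def mag (θ : E → E) (x : ZMod N → E) : ℝ := ∑ i, ⟪θ (x i), dx x i⟫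

/-- Discrete free-time action. -/
noncomputable def act (h : E × E → ℝ) (θ : E → E) (k : ℝ) (x : ZMod N → E) (T : ℝ) : ℝ :=
  ∑ i, (T / N) * Lag h (x i, vel x T i) + mag θ x + k * T

/-- Time derivative of the action. -/
noncomputable def gT (h : E × E → ℝ) (k : ℝ) (x : ZMod N → E) (T : ℝ) : ℝ :=
  k - (1 / N) * ∑ i, h (x i, mom h x T i)

/-- Space derivative of the action. -/
noncomputable def gX [CompleteSpace E] (h : E × E → ℝ) (hq : E × E → E) (θ : E → E)
    (θ' : E → E →L[ℝ] E) (x : ZMod N → E) (T : ℝ) (i : ZMod N) : E :=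
  -((T / N) • hq (x i, mom h x T i)) - mom h x T i + mom h x T (i - 1)
    + ContinuousLinearMap.adjoint (θ' (x i)) (dx x i) - θ (x i) + θ (x (i - 1))

lemma Npos : (0 : ℝ) < N := Nat.cast_pos.2 (Nat.pos_of_ne_zero (NeZero.ne N))

lemma sum_range_zmod (F : ZMod N → ℝ) : ∑ l ∈ Finset.range N, F (l : ZMod N) = ∑ i, F i := by
  refine Finset.sum_nbij' (fun l => (l : ZMod N)) ZMod.val ?_ ?_ ?_ ?_ ?_
  · intro a _; exact Finset.mem_univ _
  · intro a _; exact Finset.mem_range.2 (ZMod.val_lt a)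
  · intro a ha; exact ZMod.val_cast_of_lt (Finset.mem_range.1 ha)
  · intro a _; exact ZMod.natCast_zmod_val a
  · intro a _; rfl

lemma len_nonneg (x : ZMod N → E) : 0 ≤ len x := Finset.sum_nonneg fun _ _ => norm_nonneg _

lemma dist_le_len (x : ZMod N → E) (i j : ZMod N) : ‖x i - x j‖ ≤ len x := by
  have key : ∀ n : ℕ, ‖x (j + n) - x j‖ ≤ ∑ l ∈ Finset.range n, ‖dx x (j + l)‖ := by
    intro n
    induction n with
    | zero => simp
    | succ n ih =>
      rw [Finset.sum_range_succ]
      have : x (j + (n + 1 : ℕ)) - x j = dx x (j + n) + (x (j + n) - x j) := by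
        simp [dx, add_assoc]
      rw [this]
      exact (norm_add_le _ _).trans (by linarith)
  have h1 := key (i - j).val
  rw [ZMod.natCast_zmod_val, add_sub_cancel] at h1
  refine h1.trans ?_
  have h2 : ∑ l ∈ Finset.range (i - j).val, ‖dx x (j + l)‖ ≤
      ∑ l ∈ Finset.range N, ‖dx x (j + l)‖ := by
    refine Finset.sum_le_sum_of_subset_of_nonneg ?_ (fun _ _ _ => norm_nonneg _)
    exact Finset.range_mono (ZMod.val_lt _).le
  refine h2.trans ?_
  rw [sum_range_zmod (fun l => ‖dx x (j + l)‖)]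
  exact le_of_eq (Equiv.sum_comp (Equiv.addLeft j) (fun i => ‖dx x i‖))

lemma sum_dx (x : ZMod N → E) : ∑ i, dx x i = 0 := by
  simp only [dx, Finset.sum_sub_distrib]
  have := Equiv.sum_comp (Equiv.addRight (1 : ZMod N)) x
  simp only [Equiv.coe_addRight] at this
  rw [this, sub_self]

lemma Gauge.lip {Λ : AddSubgroup E} {θ : E → E} {θ' : E → E →L[ℝ] E} {K : ℝ}
    (G : Gauge Λ θ θ' K) (q q' : E) : ‖θ q - θ q'‖ ≤ K * ‖q - q'‖ :=
  convex_univ.norm_image_sub_le_of_norm_hasFDerivWithin_le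
    (fun x _ => (G.hasD x).hasFDerivWithinAt) (fun x _ => G.bd x) (mem_univ q') (mem_univ q)

lemma Gauge.cont {Λ : AddSubgroup E} {θ : E → E} {θ' : E → E →L[ℝ] E} {K : ℝ}
    (G : Gauge Λ θ θ' K) : Continuous θ :=
  continuous_iff_continuousAt.2 fun q => (G.hasD q).continuousAt

lemma Gauge.nonneg {Λ : AddSubgroup E} {θ : E → E} {θ' : E → E →L[ℝ] E} {K : ℝ}
    (G : Gauge Λ θ θ' K) : 0 ≤ K := (norm_nonneg _).trans (G.bd 0)

lemma mag_bound {Λ : AddSubgroup E} {θ : E → E} {θ' : E → E →L[ℝ] E} {K : ℝ}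
    (G : Gauge Λ θ θ' K) (x : ZMod N → E) : |mag θ x| ≤ K * len x ^ 2 := by
  have h1 : mag θ x = ∑ i, ⟪θ (x i) - θ (x 0), dx x i⟫ := by
    simp only [inner_sub_left, Finset.sum_sub_distrib, mag]
    rw [← inner_sum, sum_dx]
    simp
  rw [h1]
  refine (Finset.abs_sum_le_sum_abs _ _).trans ?_
  have h2 : ∀ i, |⟪θ (x i) - θ (x 0), dx x i⟫| ≤ K * len x * ‖dx x i‖ := by
    intro i
    refine (abs_real_inner_le_norm _ _).trans ?_
    refine mul_le_mul_of_nonneg_right ?_ (norm_nonneg _)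
    exact (G.lip _ _).trans (mul_le_mul_of_nonneg_left (dist_le_len x i 0) G.nonneg)
  refine (Finset.sum_le_sum fun i _ => h2 i).trans ?_
  rw [← Finset.mul_sum, ← len]
  exact le_of_eq (by ring)

lemma len_smul (x : ZMod N → E) {s : ℝ} (hs : 0 ≤ s) : len (s • x) = s * len x := by
  simp only [len, dx, Pi.smul_apply, ← smul_sub, norm_smul, Real.norm_of_nonneg hs, Finset.mul_sum]

lemma len_continuous : Continuous (len : (ZMod N → E) → ℝ) := by
  unfold len dx
  fun_prop

lemma vel_sum {x : ZMod N → E} {T : ℝ} (hT : 0 < T) : ∑ i, ‖vel x T i‖ = N / T * len x := by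
  simp only [vel, norm_smul, len, Finset.mul_sum]
  rw [Real.norm_of_nonneg (div_pos Npos hT).le]

variable [FiniteDimensional ℝ E]
variable {Λ : AddSubgroup E} {h : E × E → ℝ} {hq hp : E × E → E} {C : ℝ}
variable {θ : E → E} {θ' : E → E →L[ℝ] E} {K : ℝ}

/-- Lagrangian term in terms of momenta. -/
lemma act_eq {k T : ℝ} (hT : 0 < T) (x : ZMod N → E) :
    act h θ k x T = ∑ i, ⟪mom h x T i, dx x i⟫ + mag θ x + T * gT h k x T := by
  have hN : (N : ℝ) ≠ 0 := Npos.ne'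
  have h1 : ∀ i, (T / N) * Lag h (x i, vel x T i) =
      ⟪mom h x T i, dx x i⟫ - (T / N) * h (x i, mom h x T i) := by
    intro i
    rw [Tame.lag_eq]
    simp only [mom]
    rw [mul_sub]
    congr 1
    conv_lhs => rw [vel, inner_smul_right]
    field_simp
    rfl
  simp only [act, h1, Finset.sum_sub_distrib, gT, ← Finset.mul_sum]
  ring

/-- Convexity of the action in the period. -/
lemma act_conv (H : Tame Λ h hq hp C) {k T T' : ℝ} (hT : 0 < T) (hT' : 0 < T') (x : ZMod N → E) :
    act h θ k x T' + (T - T') * gT h k x T' ≤ act h θ k x T := by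
  rw [act_eq hT']
  have h1 : ∀ i, ⟪mom h x T' i, dx x i⟫ - (T / N) * h (x i, mom h x T' i) ≤
      (T / N) * Lag h (x i, vel x T i) := by
    intro i
    have h2 := H.lag_ge (x i, vel x T i) (mom h x T' i)
    have h3 : 0 < T / N := div_pos hT Npos
    have h4 := mul_le_mul_of_nonneg_left h2 h3.le
    refine le_trans (le_of_eq ?_) h4
    simp only [vel, inner_smul_right]
    have hN : (N : ℝ) ≠ 0 := Npos.ne'
    field_simp
  have h5 := Finset.sum_le_sum fun i (_ : i ∈ Finset.univ) => h1 i
  rw [Finset.sum_sub_distrib, ← Finset.mul_sum] at h5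
  simp only [act, gT]
  have : (T / N) * ∑ i, h (x i, mom h x T' i) = T * (1 / N * ∑ i, h (x i, mom h x T' i)) := by ring
  rw [this] at h5
  nlinarith

lemma hp_mom (H : Tame Λ h hq hp C) (x : ZMod N → E) (T : ℝ) (i : ZMod N) :
    hp (x i, mom h x T i) = vel x T i := H.hp_pst (x i, vel x T i)

/-- mean velocity is controlled by mean energy. -/
lemma len_le (H : Tame Λ h hq hp C) {k T : ℝ} (hT : 0 < T) (x : ZMod N → E) :
    len x ≤ T * (C * (k - gT h k x T + C)) := by
  have h1 : ∑ i, ‖vel x T i‖ ≤ ∑ i, C * (h (x i, mom h x T i) + C) := by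
    refine Finset.sum_le_sum fun i _ => ?_
    rw [← hp_mom H]
    exact H.hC2 _ _
  rw [vel_sum hT, ← Finset.mul_sum, Finset.sum_add_distrib] at h1
  simp only [Finset.sum_const, Finset.card_univ, ZMod.card, nsmul_eq_mul] at h1
  have hN : (0 : ℝ) < N := Npos
  have h2 : k - gT h k x T = (1 / N) * ∑ i, h (x i, mom h x T i) := by simp [gT]
  rw [h2]
  have h3 := mul_le_mul_of_nonneg_left h1 (div_pos hT hN).le
  have h4 : T / N * (N / T * len x) = len x := by field_simp
  rw [h4] at h3
  refine h3.trans (le_of_eq ?_)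
  field_simp

lemma inner_sum_le (H : Tame Λ h hq hp C) {k T : ℝ} (hT : 0 < T) (x : ZMod N → E) :
    ∑ i, ⟪mom h x T i, dx x i⟫ ≤ T * (C * (k - gT h k x T + C)) := by
  have hN : (0 : ℝ) < N := Npos
  have h1 : ∀ i, ⟪mom h x T i, dx x i⟫ ≤ (T / N) * (C * (h (x i, mom h x T i) + C)) := by
    intro i
    have h2 := mul_le_mul_of_nonneg_left (H.hC3 (x i) (mom h x T i)) (div_pos hT hN).le
    refine le_trans (le_of_eq ?_) h2
    rw [hp_mom H, vel, inner_smul_right]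
    field_simp
  refine (Finset.sum_le_sum fun i _ => h1 i).trans (le_of_eq ?_)
  have h2 : k - gT h k x T = (1 / N) * ∑ i, h (x i, mom h x T i) := by simp [gT]
  rw [h2, ← Finset.mul_sum, ← Finset.mul_sum, Finset.sum_add_distrib]
  simp only [Finset.sum_const, Finset.card_univ, ZMod.card, nsmul_eq_mul]
  field_simp

/-- Retraction lemma. -/
lemma act_retract (H : Tame Λ h hq hp C) (G : Gauge Λ θ θ' K) {b T1 κ β : ℝ} (hT1 : 0 < T1)
    (hκ : κ * (C * (b + C)) < 1) (hκ0 : 0 < κ)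
    (hβ : T1 * (C * (b + C)) + K * (T1 * (C * (b + C))) ^ 2 + T1 * (b + C) ≤ β)
    {k : ℝ} (hk : k ≤ b) (hkC : 0 ≤ k + C)
    (x : ZMod N → E) {T : ℝ} (hT : 0 < T) :
    act h θ k x (max T (max T1 (κ * len x))) ≤ max (act h θ k x T) β := by
  set T' := max T1 (κ * len x) with hT'
  have hT'0 : 0 < T' := lt_of_lt_of_le hT1 (le_max_left _ _)
  by_cases hc : T' ≤ T
  · rw [max_eq_left hc]; exact le_max_left _ _
  push Not at hc
  rw [max_eq_right hc.le]
  by_cases hg : gT h k x T' ≤ 0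
  · have := act_conv (θ := θ) H (k := k) hT hT'0 x
    have h2 : 0 ≤ (T - T') * gT h k x T' := mul_nonneg_of_nonpos_of_nonpos (by linarith) hg
    exact le_max_of_le_left (by linarith)
  · push Not at hg
    apply le_max_of_le_right
    have hl := len_le H (k := k) hT'0 x
    have hCp := H.Cpos
    have hm : C * (k - gT h k x T' + C) ≤ C * (b + C) :=
      mul_le_mul_of_nonneg_left (by linarith) (by linarith)
    have hl2 : len x ≤ T' * (C * (b + C)) := hl.trans (mul_le_mul_of_nonneg_left hm hT'0.le)
    have hT'1 : T' = T1 := by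
      rcases max_choice T1 (κ * len x) with h1 | h1
      · exact h1
      · exfalso
        have h3 : T' = κ * len x := h1
        have h4 : T' ≤ κ * (T' * (C * (b + C))) := by
          nth_rewrite 1 [h3]
          exact mul_le_mul_of_nonneg_left hl2 hκ0.le
        nlinarith
    have hi := inner_sum_le H (k := k) hT'0 x
    have hi2 := hi.trans (mul_le_mul_of_nonneg_left hm hT'0.le)
    have hmag := (abs_le.1 (mag_bound G x)).2
    have hl0 := len_nonneg x
    have hl3 : len x ^ 2 ≤ (T' * (C * (b + C))) ^ 2 := pow_le_pow_left₀ hl0 hl2 2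
    have hmag2 := hmag.trans (mul_le_mul_of_nonneg_left hl3 G.nonneg)
    have hgT : gT h k x T' ≤ b + C := by
      have h2 : - C ≤ (1 / N) * ∑ i, h (x i, mom h x T' i) := by
        have hN : (0 : ℝ) < N := Npos
        have h3 : ∑ i : ZMod N, (-C) ≤ ∑ i, h (x i, mom h x T' i) :=
          Finset.sum_le_sum fun i _ => H.hC4 _ _
        simp only [Finset.sum_const, Finset.card_univ, ZMod.card, nsmul_eq_mul] at h3
        have h4 := mul_le_mul_of_nonneg_left h3 (one_div_pos.2 hN).le
        refine le_trans (le_of_eq ?_) h4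
        field_simp
      simp only [gT]
      linarith
    rw [act_eq hT'0]
    have h5 := mul_le_mul_of_nonneg_left hgT hT'0.le
    rw [hT'1] at *
    linarith

/-- Small loops have positive action. -/
lemma act_small (H : Tame Λ h hq hp C) (G : Gauge Λ θ θ' K) {a c : ℝ} (hc : 0 < c)
    (hsm : ∀ q0, ∃ p0, ∀ q p, ‖q - q0‖ ≤ c → ‖p - p0‖ ≤ c → h (q, p) ≤ a)
    {k : ℝ} (hk : a ≤ k) (x : ZMod N → E) {T : ℝ} (hT : 0 < T) (hl : len x ≤ c) :
    c * len x - K * len x ^ 2 ≤ act h θ k x T := by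
  obtain ⟨p0, hp0⟩ := hsm (x 0)
  have hN : (0 : ℝ) < N := Npos
  have h1 : ∀ i, ⟪p0, dx x i⟫ + c * ‖dx x i‖ - (T / N) * a ≤ (T / N) * Lag h (x i, vel x T i) := by
    intro i
    have hq : ‖x i - x 0‖ ≤ c := (dist_le_len x i 0).trans hl
    by_cases hd : dx x i = 0
    · have h2 := H.lag_ge (x i, vel x T i) p0
      have h3 := hp0 (x i) p0 hq (by simp [hc.le])
      have h4 := mul_le_mul_of_nonneg_left h2 (div_pos hT hN).le
      have h5 := mul_le_mul_of_nonneg_left h3 (div_pos hT hN).le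
      simp only [vel, hd, smul_zero, inner_zero_right] at h4 ⊢
      simp
      linarith
    · have hdn : 0 < ‖dx x i‖ := norm_pos_iff.2 hd
      set p := p0 + (c / ‖dx x i‖) • dx x i with hp
      have h2 := H.lag_ge (x i, vel x T i) p
      have h3 := hp0 (x i) p hq (by
        simp only [hp, add_sub_cancel_left, norm_smul, norm_div, norm_norm]
        rw [Real.norm_of_nonneg hc.le]
        rw [div_mul_cancel₀ _ hdn.ne'])
      have h4 := mul_le_mul_of_nonneg_left h2 (div_pos hT hN).le
      have h5 := mul_le_mul_of_nonneg_left h3 (div_pos hT hN).le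
      have h6 : T / N * (⟪p, vel x T i⟫) = ⟪p0, dx x i⟫ + c * ‖dx x i‖ := by
        simp only [vel, inner_smul_right, hp, inner_add_left, inner_smul_left,
          real_inner_self_eq_norm_sq, RCLike.conj_to_real]
        field_simp
      simp only at h4
      rw [mul_sub, h6] at h4
      linarith
  have h2 := Finset.sum_le_sum fun i (_ : i ∈ Finset.univ) => h1 i
  rw [Finset.sum_sub_distrib, Finset.sum_add_distrib, ← inner_sum, sum_dx, ← Finset.mul_sum] at h2
  simp only [inner_zero_right, Finset.sum_const, Finset.card_univ, ZMod.card, nsmul_eq_mul] at h2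
  have h3 : (N : ℝ) * (T / N * a) = T * a := by field_simp
  rw [h3] at h2
  have hmag := (abs_le.1 (mag_bound G x)).1
  have h4 := mul_le_mul_of_nonneg_left hk hT.le
  simp only [len] at *
  simp only [act]
  linarith

end disc
end MT

end ModuleB

section ModuleC
open Filter Topology Set MeasureTheory
open scoped RealInnerProductSpace

set_option linter.unusedSectionVars false
set_option linter.unusedVariables false
namespace MT

variable {E : Type*} [NormedAddCommGroup E] [InnerProductSpace ℝ E]
section disc
variable {N : ℕ} [NeZero N]
variable [FiniteDimensional ℝ E]
variable {Λ : AddSubgroup E} {h : E × E → ℝ} {hq hp : E × E → E} {C : ℝ}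
variable {θ : E → E} {θ' : E → E →L[ℝ] E} {K : ℝ}

lemma dx_add_smul (x ξ : ZMod N → E) (σ : ℝ) (i : ZMod N) :
    dx (x + σ • ξ) i = dx x i + σ • dx ξ i := by
  simp only [dx, Pi.add_apply, Pi.smul_apply, smul_sub]; abel

lemma sum_shift (F : ZMod N → ℝ) : ∑ i, F (i - 1) = ∑ i, F i :=
  Equiv.sum_comp (Equiv.subRight (1 : ZMod N)) F

lemma hasD_curve (x ξ : E) (σ : ℝ) : HasDerivAt (fun σ : ℝ => x + σ • ξ) ξ σ := by
  have := ((hasDerivAt_id σ).smul_const ξ).const_add x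
  simpa using this

/-- Directional derivative of the action. -/
lemma act_hasDeriv (H : Tame Λ h hq hp C) (G : Gauge Λ θ θ' K) (k : ℝ) (x ξ : ZMod N → E)
    (T s σ : ℝ) (hT : 0 < T + σ * s) :
    HasDerivAt (fun σ : ℝ => act h θ k (x + σ • ξ) (T + σ * s))
      (∑ i, ⟪gX h hq θ θ' (x + σ • ξ) (T + σ * s) i, ξ i⟫ + gT h k (x + σ • ξ) (T + σ * s) * s) σ := by
  have hN : (N : ℝ) ≠ 0 := Npos.ne'
  set y := x + σ • ξ with hy
  set S := T + σ * s with hS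
  have hTs : HasDerivAt (fun σ : ℝ => T + σ * s) s σ := by
    simpa using ((hasDerivAt_id σ).mul_const s).const_add T
  have hxi : ∀ i, HasDerivAt (fun σ : ℝ => (x + σ • ξ) i) (ξ i) σ := fun i => by
    simpa using hasD_curve (x i) (ξ i) σ
  have hdxi : ∀ i, HasDerivAt (fun σ : ℝ => dx (x + σ • ξ) i) (dx ξ i) σ := fun i => by
    simp only [dx_add_smul]
    exact hasD_curve (dx x i) (dx ξ i) σ
  have hvel : ∀ i, HasDerivAt (fun σ : ℝ => vel (x + σ • ξ) (T + σ * s) i)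
      ((-(N * s / S ^ 2)) • dx y i + (N / S) • dx ξ i) σ := fun i => by
    have h1 : HasDerivAt (fun σ : ℝ => (N : ℝ) / (T + σ * s)) (-(N * s / S ^ 2)) σ := by
      have := (hasDerivAt_const σ (N : ℝ)).div hTs hT.ne'
      exact this.congr_deriv (by rw [← hS]; ring)
    have := h1.smul (hdxi i)
    exact this.congr_deriv (by rw [add_comm])
  have hL : ∀ i, HasDerivAt (fun σ : ℝ => Lag h ((x + σ • ξ) i, vel (x + σ • ξ) (T + σ * s) i))
      (-⟪hq (y i, mom h y S i), ξ i⟫ + ⟪mom h y S i, (-(N * s / S ^ 2)) • dx y i + (N / S) • dx ξ i⟫) σ := by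
    intro i
    have := (H.lag_hasD (y i, vel y S i)).comp_hasDerivAt σ ((hxi i).prodMk (hvel i))
    exact this.congr_deriv (by simp [mom])
  have hterm : ∀ i, HasDerivAt
      (fun σ : ℝ => ((T + σ * s) / N) * Lag h ((x + σ • ξ) i, vel (x + σ • ξ) (T + σ * s) i))
      (-(s / N) * h (y i, mom h y S i) - (S / N) * ⟪hq (y i, mom h y S i), ξ i⟫
        + ⟪mom h y S i, dx ξ i⟫) σ := by
    intro i
    have := (hTs.div_const (N : ℝ)).mul (hL i)
    refine this.congr_deriv ?_
    rw [Tame.lag_eq]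
    change s / N * (⟪mom h y S i, vel y S i⟫ - h (y i, mom h y S i)) + S / N * _ = _
    rw [vel, inner_add_right, inner_smul_right, inner_smul_right, inner_smul_right]
    have : S ≠ 0 := hT.ne'
    field_simp
    ring
  have hmag : ∀ i, HasDerivAt (fun σ : ℝ => ⟪θ ((x + σ • ξ) i), dx (x + σ • ξ) i⟫)
      (⟪θ (y i), dx ξ i⟫ + ⟪θ' (y i) (ξ i), dx y i⟫) σ := by
    intro i
    exact ((G.hasD (y i)).comp_hasDerivAt σ (hxi i)).inner ℝ (hdxi i)
  have hk : HasDerivAt (fun σ : ℝ => k * (T + σ * s)) (k * s) σ := hTs.const_mul k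
  have hall := ((HasDerivAt.fun_sum fun i (_ : i ∈ Finset.univ) => hterm i).add
    (HasDerivAt.fun_sum fun i (_ : i ∈ Finset.univ) => hmag i)).add hk
  refine hall.congr_deriv ?_
  have e1 : ∀ F : ZMod N → E, ∑ i, ⟪F i, dx ξ i⟫ = ∑ i, ⟪F (i - 1) - F i, ξ i⟫ := by
    intro F
    simp only [dx, inner_sub_right, inner_sub_left, Finset.sum_sub_distrib]
    congr 1
    rw [← sum_shift]
    simp
  simp only [Finset.sum_add_distrib, Finset.sum_sub_distrib]
  rw [e1 (fun i => mom h y S i), e1 (fun i => θ (y i)), ← Finset.mul_sum, ← Finset.mul_sum]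
  have e2 : ∀ i, ⟪θ' (y i) (ξ i), dx y i⟫ = ⟪ContinuousLinearMap.adjoint (θ' (y i)) (dx y i), ξ i⟫ := by
    intro i
    rw [ContinuousLinearMap.adjoint_inner_left, real_inner_comm]
  simp only [e2, gX, gT, inner_add_left, inner_sub_left, inner_neg_left, inner_smul_left,
    Finset.sum_add_distrib, Finset.sum_sub_distrib, Finset.sum_neg_distrib, RCLike.conj_to_real,
    ← Finset.mul_sum]
  ring

variable (N) in
lemma vel_continuousOn : ∀ i, ContinuousOn (fun y : (ZMod N → E) × ℝ => vel y.1 y.2 i) {y | 0 < y.2} := by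
  intro i
  unfold vel dx
  refine ContinuousOn.smul ?_ (by fun_prop)
  exact continuousOn_const.div continuousOn_snd fun y hy => ne_of_gt hy

lemma mom_continuousOn (H : Tame Λ h hq hp C) (i : ZMod N) :
    ContinuousOn (fun y : (ZMod N → E) × ℝ => mom h y.1 y.2 i) {y | 0 < y.2} := by
  unfold mom
  exact H.pst_continuous.comp_continuousOn
    (ContinuousOn.prodMk (by fun_prop) (vel_continuousOn N i))

lemma act_continuousOn (H : Tame Λ h hq hp C) (G : Gauge Λ θ θ' K) (k : ℝ) :
    ContinuousOn (fun y : (ZMod N → E) × ℝ => act h θ k y.1 y.2) {y | 0 < y.2} := by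
  unfold act mag dx
  have h1 := G.cont
  refine ContinuousOn.add (ContinuousOn.add ?_ (by fun_prop)) (by fun_prop)
  refine continuousOn_finsetSum _ fun i _ => ContinuousOn.mul (by fun_prop) ?_
  exact H.lag_continuous.comp_continuousOn
    (ContinuousOn.prodMk (by fun_prop) (vel_continuousOn N i))

lemma gT_continuousOn (H : Tame Λ h hq hp C) (k : ℝ) :
    ContinuousOn (fun y : (ZMod N → E) × ℝ => gT h k y.1 y.2) {y | 0 < y.2} := by
  unfold gT
  refine continuousOn_const.sub (continuousOn_const.mul ?_)
  refine continuousOn_finsetSum _ fun i _ => ?_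
  exact H.cont.comp_continuousOn
    (ContinuousOn.prodMk (by fun_prop) (mom_continuousOn H i))

lemma gX_continuousOn (H : Tame Λ h hq hp C) (G : Gauge Λ θ θ' K) (i : ZMod N) :
    ContinuousOn (fun y : (ZMod N → E) × ℝ => gX h hq θ θ' y.1 y.2 i) {y | 0 < y.2} := by
  unfold gX
  have h1 := G.cont
  have h2 := G.cont'
  have hm := fun i => mom_continuousOn (N := N) H i
  have hqc : ContinuousOn (fun y : (ZMod N → E) × ℝ => hq (y.1 i, mom h y.1 y.2 i)) {y | 0 < y.2} :=
    H.cq.comp_continuousOn (ContinuousOn.prodMk (by fun_prop) (hm i))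
  have hadj : Continuous (fun y : (ZMod N → E) × ℝ =>
      ContinuousLinearMap.adjoint (θ' (y.1 i)) (dx y.1 i)) := by
    have h3 : Continuous (fun y : (ZMod N → E) × ℝ => ContinuousLinearMap.adjoint (θ' (y.1 i))) :=
      (LinearIsometryEquiv.continuous (ContinuousLinearMap.adjoint (𝕜 := ℝ) (E := E) (F := E))).comp
        (h2.comp (by fun_prop))
    unfold dx
    exact h3.clm_apply (by fun_prop)
  refine ContinuousOn.add (ContinuousOn.sub (ContinuousOn.add (ContinuousOn.add (ContinuousOn.sub
    (ContinuousOn.neg (ContinuousOn.smul (by fun_prop) hqc)) (hm i)) (hm (i-1))) hadj.continuousOn)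
    (by fun_prop)) (by fun_prop)

/-- Translation by a constant. -/
def trs (m : E) (x : ZMod N → E) : ZMod N → E := fun i => x i + m

@[simp] lemma dx_trs (m : E) (x : ZMod N → E) (i : ZMod N) : dx (trs m x) i = dx x i := by
  simp [dx, trs]

@[simp] lemma len_trs (m : E) (x : ZMod N → E) : len (trs m x) = len x := by simp [len]

@[simp] lemma vel_trs (m : E) (x : ZMod N → E) (T : ℝ) (i : ZMod N) :
    vel (trs m x) T i = vel x T i := by simp [vel]

lemma mom_trs (H : Tame Λ h hq hp C) {m : E} (hm : m ∈ Λ) (x : ZMod N → E) (T : ℝ) (i : ZMod N) :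
    mom h (trs m x) T i = mom h x T i := by
  simp only [mom, vel_trs]
  exact H.lag_per hm _ _

lemma act_trs (H : Tame Λ h hq hp C) (G : Gauge Λ θ θ' K) {m : E} (hm : m ∈ Λ) (k : ℝ)
    (x : ZMod N → E) (T : ℝ) : act h θ k (trs m x) T = act h θ k x T := by
  have h1 : mag θ (trs m x) = mag θ x := by
    obtain ⟨c, hc⟩ := G.per m hm
    simp only [mag, dx_trs]
    simp only [trs, hc, inner_add_left, Finset.sum_add_distrib]
    rw [← inner_sum, sum_dx]; simp
  simp only [act, h1, vel_trs]
  congr 3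
  ext i
  simp only [Lag, trs, H.lag_per hm, H.per m hm]

lemma gT_trs (H : Tame Λ h hq hp C) {m : E} (hm : m ∈ Λ) (k : ℝ)
    (x : ZMod N → E) (T : ℝ) : gT h k (trs m x) T = gT h k x T := by
  simp only [gT, mom_trs H hm]
  simp only [trs, H.per m hm]

lemma gX_trs (H : Tame Λ h hq hp C) (G : Gauge Λ θ θ' K) {m : E} (hm : m ∈ Λ)
    (x : ZMod N → E) (T : ℝ) (i : ZMod N) :
    gX h hq θ θ' (trs m x) T i = gX h hq θ θ' x T i := by
  obtain ⟨c, hc⟩ := G.per m hm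
  simp only [gX, mom_trs H hm, dx_trs]
  simp only [trs, H.perq m hm, G.per' m hm, hc]
  abel

end disc
end MT

end ModuleC

section ModuleD
open Filter Topology Set MeasureTheory
open scoped RealInnerProductSpace
set_option linter.unusedSectionVars false
set_option linter.unusedVariables false
namespace MT

section minimax
variable {Y : Type*} [TopologicalSpace Y]

/-- Admissible paths. -/
structure IsPath (D : Set Y) (y0 y1 : Y) (γ : ℝ → Y) : Prop where
  cont : ContinuousOn γ (Icc 0 1)
  zero : γ 0 = y0
  one : γ 1 = y1
  mem : ∀ t ∈ Icc (0:ℝ) 1, γ t ∈ D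

/-- Upper levels reached by admissible paths. -/
def Levels (D : Set Y) (y0 y1 : Y) (f : Y → ℝ) : Set ℝ :=
  {m | ∃ γ, IsPath D y0 y1 γ ∧ ∀ t ∈ Icc (0:ℝ) 1, f (γ t) ≤ m}

/-- Minimax value. -/
noncomputable def cval (D : Set Y) (y0 y1 : Y) (f : Y → ℝ) : ℝ := sInf (Levels D y0 y1 f)

lemma minimax {D : Set Y} {y0 y1 : Y} {A Tt : Y → ℝ} {k β M η s : ℝ}
    (hfc : ContinuousOn (fun y => A y + k * Tt y) D)
    (hT : ∀ y ∈ D, 0 ≤ Tt y) (hM : 0 ≤ M) (hη : 0 < η) (hs : 0 < s)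
    (h0 : A y0 + k * Tt y0 ≤ β) (h1 : A y1 + k * Tt y1 ≤ β)
    (hβ : β < cval D y0 y1 (fun y => A y + k * Tt y))
    (hne : ∀ k, (Levels D y0 y1 (fun y => A y + k * Tt y)).Nonempty)
    (hbd : BddBelow (Levels D y0 y1 (fun y => A y + k * Tt y)))
    (hslope : ∀ᶠ δ in 𝓝[>] (0:ℝ), cval D y0 y1 (fun y => A y + (k + δ) * Tt y) ≤
      cval D y0 y1 (fun y => A y + k * Tt y) + M * δ)
    {Ψ : Y × ℝ → Y} (hΨc : ContinuousOn Ψ (D ×ˢ Icc 0 s))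
    (hΨD : ∀ y ∈ D, ∀ σ ∈ Icc 0 s, Ψ (y, σ) ∈ D) (hΨ0 : ∀ y ∈ D, Ψ (y, 0) = y)
    (hdrop : ∀ y ∈ D, Tt y ≤ M + 2 → ∀ σ ∈ Icc 0 s,
      A (Ψ (y, σ)) + k * Tt (Ψ (y, σ)) ≤ max (A y + k * Tt y - σ * η) β) : False := by
  set f : Y → ℝ := fun y => A y + k * Tt y with hf
  set c := cval D y0 y1 f with hc
  have e1 : ∀ᶠ δ in 𝓝[>] (0:ℝ), δ < c - β := 
    (eventually_lt_nhds (sub_pos.2 hβ)).filter_mono nhdsWithin_le_nhds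
  have e2 : ∀ᶠ δ in 𝓝[>] (0:ℝ), δ < s * η / (M + 2) := 
    (eventually_lt_nhds (div_pos (mul_pos hs hη) (by linarith))).filter_mono nhdsWithin_le_nhds
  obtain ⟨δ, ⟨⟨hδ, hδ1⟩, hδ2⟩, hδ0⟩ := (((hslope.and e1).and e2).and self_mem_nhdsWithin).exists
  have hδ0 : 0 < δ := hδ0
  rw [lt_div_iff₀ (by linarith)] at hδ2
  obtain ⟨m, ⟨γ, hγ, hγm⟩, hm⟩ := exists_lt_of_csInf_lt (hne (k + δ))
    (show sInf _ < cval D y0 y1 (fun y => A y + (k + δ) * Tt y) + δ by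
      unfold cval; linarith)
  have hb1 : ∀ t ∈ Icc (0:ℝ) 1, f (γ t) + δ * Tt (γ t) ≤ c + (M + 1) * δ := by
    intro t ht
    have := hγm t ht
    simp only [hf]
    nlinarith
  have hb2 : ∀ t ∈ Icc (0:ℝ) 1, f (γ t) ≤ c + (M + 1) * δ := by
    intro t ht
    have := hb1 t ht
    nlinarith [hT _ (hγ.mem t ht), mul_nonneg hδ0.le (hT _ (hγ.mem t ht))]
  have hb3 : ∀ t ∈ Icc (0:ℝ) 1, c - δ ≤ f (γ t) → Tt (γ t) ≤ M + 2 := by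
    intro t ht h3
    have := hb1 t ht
    have : δ * Tt (γ t) ≤ δ * (M + 2) := by linarith
    exact le_of_mul_le_mul_left this hδ0
  let χ : ℝ → ℝ := fun u => s * max 0 (min 1 ((u - (c - δ)) / (δ / 2)))
  have hχc : Continuous χ := by
    simp only [χ]
    fun_prop
  have hχm : ∀ u, χ u ∈ Icc 0 s := by
    intro u
    refine ⟨mul_nonneg hs.le (le_max_left _ _), ?_⟩
    have : max 0 (min 1 ((u - (c - δ)) / (δ / 2))) ≤ 1 := max_le zero_le_one (min_le_left _ _)
    simp only [χ]
    nlinarith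
  have hχ0 : ∀ u, u ≤ c - δ → χ u = 0 := by
    intro u hu
    have : (u - (c - δ)) / (δ / 2) ≤ 0 := div_nonpos_of_nonpos_of_nonneg (by linarith) (by linarith)
    simp only [χ]
    rw [max_eq_left ((min_le_right _ _).trans this), mul_zero]
  have hχ1 : ∀ u, c - δ / 2 ≤ u → χ u = s := by
    intro u hu
    have : 1 ≤ (u - (c - δ)) / (δ / 2) := by
      rw [le_div_iff₀ (by linarith)]; linarith
    simp only [χ]
    rw [min_eq_left this, max_eq_right zero_le_one, mul_one]
  let γ' : ℝ → Y := fun t => Ψ (γ t, χ (f (γ t)))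
  have hpath : IsPath D y0 y1 γ' := by
    refine ⟨?_, ?_, ?_, ?_⟩
    · refine hΨc.comp (hγ.cont.prodMk (hχc.comp_continuousOn (hfc.comp hγ.cont hγ.mem))) ?_
      intro t ht
      exact ⟨hγ.mem t ht, hχm _⟩
    · have hD := hγ.mem 0 (by simp)
      simp only [γ']
      rw [hχ0, hΨ0 _ hD, hγ.zero]
      rw [hγ.zero]; simp only [hf]; linarith
    · have hD := hγ.mem 1 (by simp)
      simp only [γ']
      rw [hχ0, hΨ0 _ hD, hγ.one]
      rw [hγ.one]; simp only [hf]; linarith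
    · intro t ht
      exact hΨD _ (hγ.mem t ht) _ (hχm _)
  have hlev : max (max (c + (M + 1) * δ - s * η) (c - δ / 2)) β ∈ Levels D y0 y1 f := by
    refine ⟨γ', hpath, fun t ht => ?_⟩
    have hD := hγ.mem t ht
    by_cases c1 : f (γ t) ≤ c - δ
    · simp only [γ']
      rw [hχ0 _ c1, hΨ0 _ hD]
      refine le_max_of_le_left (le_max_of_le_right (by linarith))
    push Not at c1
    have hd := hdrop _ hD (hb3 t ht c1.le) _ (hχm (f (γ t)))
    refine hd.trans (max_le_max ?_ le_rfl)
    by_cases c2 : f (γ t) ≤ c - δ / 2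
    · apply le_max_of_le_right
      have := mul_nonneg (hχm (f (γ t))).1 hη.le
      simp only [hf] at c2 this ⊢
      linarith
    · push Not at c2
      apply le_max_of_le_left
      rw [hχ1 _ c2.le]
      have := hb2 t ht
      simp only [hf] at this ⊢
      linarith
  have hle : c ≤ max (max (c + (M + 1) * δ - s * η) (c - δ / 2)) β := csInf_le hbd hlev
  have : max (max (c + (M + 1) * δ - s * η) (c - δ / 2)) β < c := by
    refine max_lt (max_lt ?_ (by linarith)) hβ
    nlinarith
  linarith

lemma cval_mono {D : Set Y} {y0 y1 : Y} {A Tt : Y → ℝ} {k k' : ℝ} (hkk : k ≤ k')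
    (hT : ∀ y ∈ D, 0 ≤ Tt y)
    (hne : (Levels D y0 y1 (fun y => A y + k' * Tt y)).Nonempty)
    (hbd : BddBelow (Levels D y0 y1 (fun y => A y + k * Tt y))) :
    cval D y0 y1 (fun y => A y + k * Tt y) ≤ cval D y0 y1 (fun y => A y + k' * Tt y) := by
  refine csInf_le_csInf hbd hne ?_
  rintro m ⟨γ, hγ, hm⟩
  refine ⟨γ, hγ, fun t ht => le_trans ?_ (hm t ht)⟩
  have := mul_le_mul_of_nonneg_right hkk (hT _ (hγ.mem t ht))
  simp only
  linarith

end minimax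

variable {E : Type*} [NormedAddCommGroup E] [InnerProductSpace ℝ E]
section disc
variable {N : ℕ} [NeZero N]
variable [FiniteDimensional ℝ E]
variable {Λ : AddSubgroup E} {h : E × E → ℝ} {hq hp : E × E → E} {C : ℝ}
variable {θ : E → E} {θ' : E → E →L[ℝ] E} {K : ℝ}

/-- Squared gradient norm. -/
noncomputable def gn (h : E × E → ℝ) (hq : E × E → E) (θ : E → E)
    (θ' : E → E →L[ℝ] E) (k : ℝ) (y : (ZMod N → E) × ℝ) : ℝ :=
  ∑ i, ‖gX h hq θ θ' y.1 y.2 i‖ ^ 2 + gT h k y.1 y.2 ^ 2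

/-- The gradient. -/
noncomputable def gr (h : E × E → ℝ) (hq : E × E → E) (θ : E → E)
    (θ' : E → E →L[ℝ] E) (k : ℝ) (y : (ZMod N → E) × ℝ) : (ZMod N → E) × ℝ :=
  (fun i => gX h hq θ θ' y.1 y.2 i, gT h k y.1 y.2)

lemma gr_continuousOn (H : Tame Λ h hq hp C) (G : Gauge Λ θ θ' K) (k : ℝ) :
    ContinuousOn (gr (N := N) h hq θ θ' k) {y | 0 < y.2} :=
  ContinuousOn.prodMk (continuousOn_pi.2 fun i => gX_continuousOn H G i) (gT_continuousOn H k)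

/-- gradient step -/
noncomputable def st (h : E × E → ℝ) (hq : E × E → E) (θ : E → E)
    (θ' : E → E →L[ℝ] E) (k : ℝ) (y : (ZMod N → E) × ℝ) (σ : ℝ) : (ZMod N → E) × ℝ :=
  y - σ • gr h hq θ θ' k y

lemma isOpen_Tpos : IsOpen {y : (ZMod N → E) × ℝ | 0 < y.2} := isOpen_lt continuous_const continuous_snd

lemma drop_local (H : Tame Λ h hq hp C) (G : Gauge Λ θ θ' K) {k ε : ℝ} (hε : 0 < ε)
    (y0 : (ZMod N → E) × ℝ) (hT : 0 < y0.2) (hg : ε ≤ gn h hq θ θ' k y0) :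
    ∃ s > 0, ∀ᶠ y in 𝓝 y0, ∀ σ ∈ Icc 0 s, 0 < (st h hq θ θ' k y σ).2 ∧
      act h θ k (st h hq θ θ' k y σ).1 (st h hq θ θ' k y σ).2 ≤ act h θ k y.1 y.2 - σ * (ε / 2) := by
  set g := gr (N := N) h hq θ θ' k with hgdef
  set U : Set ((ZMod N → E) × ℝ) := {y | 0 < y.2}
  have hU : IsOpen U := isOpen_Tpos
  have hgc : ContinuousAt g y0 := (gr_continuousOn H G k).continuousAt (hU.mem_nhds hT)
  have hS : ContinuousAt (fun z : ((ZMod N → E) × ℝ) × ℝ => st h hq θ θ' k z.1 z.2) (y0, 0) := by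
    unfold st
    refine continuousAt_fst.sub (continuousAt_snd.smul ?_)
    exact hgc.comp_of_eq continuousAt_fst rfl
  have hS0 : st h hq θ θ' k y0 0 = y0 := by simp [st]
  have hgS : ContinuousAt (fun z : ((ZMod N → E) × ℝ) × ℝ => g (st h hq θ θ' k z.1 z.2)) (y0, 0) := by
    refine ContinuousAt.comp (g := g) ?_ hS
    simp only [hS0]; exact hgc
  have hg1 : ContinuousAt (fun z : ((ZMod N → E) × ℝ) × ℝ => g z.1) (y0, 0) :=
    hgc.comp_of_eq continuousAt_fst rfl
  let φ : ((ZMod N → E) × ℝ) × ℝ → ℝ := fun z =>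
    ∑ i, ⟪(g (st h hq θ θ' k z.1 z.2)).1 i, (g z.1).1 i⟫ + (g (st h hq θ θ' k z.1 z.2)).2 * (g z.1).2
  have hφ : ContinuousAt φ (y0, 0) := by
    have hgS1 : ∀ i, ContinuousAt (fun z : ((ZMod N → E) × ℝ) × ℝ => (g (st h hq θ θ' k z.1 z.2)).1 i) (y0, 0) :=
      fun i => (continuousAt_pi.1 hgS.fst) i
    have hg11 : ∀ i, ContinuousAt (fun z : ((ZMod N → E) × ℝ) × ℝ => (g z.1).1 i) (y0, 0) :=
      fun i => (continuousAt_pi.1 hg1.fst) i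
    refine ContinuousAt.add ?_ (hgS.snd.mul hg1.snd)
    exact tendsto_finsetSum _ fun i _ => (hgS1 i).inner (𝕜 := ℝ) (hg11 i)
  have hφ0 : ε / 2 < φ (y0, 0) := by
    have : φ (y0, 0) = gn h hq θ θ' k y0 := by
      simp only [φ, hS0, hgdef, gr, gn, real_inner_self_eq_norm_sq]; ring
    rw [this]; linarith
  have ev1 : ∀ᶠ z in 𝓝 (y0, (0:ℝ)), ε / 2 < φ z := hφ.eventually_const_lt hφ0
  have ev2 : ∀ᶠ z : ((ZMod N → E) × ℝ) × ℝ in 𝓝 (y0, (0:ℝ)), st h hq θ θ' k z.1 z.2 ∈ U := by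
    apply hS.eventually_mem
    simp only [hS0]; exact hU.mem_nhds hT
  have ev := ev1.and ev2
  rw [nhds_prod_eq, Filter.eventually_prod_iff] at ev
  obtain ⟨pa, hpa, pb, hpb, hab⟩ := ev
  obtain ⟨s', hs', hball⟩ := Metric.eventually_nhds_iff.1 hpb
  refine ⟨s' / 2, by positivity, ?_⟩
  filter_upwards [hpa] with y hy σ hσ
  have hin : ∀ τ ∈ Icc 0 (s' / 2), ε / 2 < φ (y, τ) ∧ st h hq θ θ' k y τ ∈ U := by
    intro τ hτ
    apply hab hy
    apply hball
    rw [Real.dist_eq, sub_zero, abs_of_nonneg hτ.1]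
    linarith [hτ.2]
  refine ⟨(hin σ hσ).2, ?_⟩
  have hstep : ∀ τ, st h hq θ θ' k y τ = (y.1 + τ • (-(g y).1), y.2 + τ * (-(g y).2)) := by
    intro τ
    simp only [st, hgdef]
    ext <;> simp [sub_eq_add_neg]
  have hder : ∀ τ ∈ Icc 0 (s' / 2), HasDerivAt (fun τ => act h θ k (st h hq θ θ' k y τ).1 (st h hq θ θ' k y τ).2)
      (-φ (y, τ)) τ := by
    intro τ hτ
    have h1 := (hin τ hτ).2
    rw [hstep] at h1
    have := act_hasDeriv H G k y.1 (-(g y).1) y.2 (-(g y).2) τ h1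
    simp only [hstep]
    refine this.congr_deriv ?_
    simp only [φ, hstep, hgdef, gr, Pi.neg_apply, inner_neg_right, Finset.sum_neg_distrib]
    ring
  have hsub : Icc 0 σ ⊆ Icc 0 (s' / 2) := Icc_subset_Icc le_rfl hσ.2
  have hmvt := (convex_Icc 0 σ).image_sub_le_mul_sub_of_deriv_le
    (f := fun τ => act h θ k (st h hq θ θ' k y τ).1 (st h hq θ θ' k y τ).2) (C := -(ε / 2))
    (fun τ hτ => (hder τ (hsub hτ)).continuousAt.continuousWithinAt)
    (fun τ hτ => (hder τ (hsub (interior_subset hτ))).differentiableAt.differentiableWithinAt)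
    (fun τ hτ => by
      rw [(hder τ (hsub (interior_subset hτ))).deriv]
      linarith [(hin τ (hsub (interior_subset hτ))).1])
    0 ⟨le_rfl, hσ.1⟩ σ ⟨hσ.1, le_rfl⟩ hσ.1
  have hz : st h hq θ θ' k y 0 = y := by simp [st]
  simp only [hz] at hmvt
  linarith

/-- Domain. -/
def Dom (T1 κ : ℝ) : Set ((ZMod N → E) × ℝ) := {y | T1 ≤ y.2 ∧ κ * len y.1 ≤ y.2}

/-- Retraction. -/
noncomputable def rt (T1 κ : ℝ) (y : (ZMod N → E) × ℝ) : (ZMod N → E) × ℝ :=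
  (y.1, max y.2 (max T1 (κ * len y.1)))

lemma rt_mem (T1 κ : ℝ) (y : (ZMod N → E) × ℝ) : rt T1 κ y ∈ Dom T1 κ :=
  ⟨(le_max_left _ _).trans (le_max_right _ _), (le_max_right _ _).trans (le_max_right _ _)⟩

lemma rt_eq {T1 κ : ℝ} {y : (ZMod N → E) × ℝ} (hy : y ∈ Dom T1 κ) : rt T1 κ y = y := by
  ext
  · rfl
  · exact max_eq_left (max_le hy.1 hy.2)

lemma rt_continuous (T1 κ : ℝ) : Continuous (rt (N := N) (E := E) T1 κ) := by
  unfold rt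
  have := len_continuous (N := N) (E := E)
  fun_prop

lemma drop_unif (H : Tame Λ h hq hp C) (G : Gauge Λ θ θ' K) {Q : Set E} (hQ : IsCompact Q)
    (hQΛ : ∀ x, ∃ m ∈ Λ, x + m ∈ Q) {k ε T1 κ T2 : ℝ} (hε : 0 < ε) (hT1 : 0 < T1) (hκ : 0 < κ)
    (hg : ∀ y ∈ Dom (N := N) T1 κ, y.2 ≤ T2 → ε ≤ gn h hq θ θ' k y) :
    ∃ s > 0, ∀ y ∈ Dom (N := N) T1 κ, y.2 ≤ T2 → ∀ σ ∈ Icc 0 s, 0 < (st h hq θ θ' k y σ).2 ∧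
      act h θ k (st h hq θ θ' k y σ).1 (st h hq θ θ' k y σ).2 ≤ act h θ k y.1 y.2 - σ * (ε / 2) := by
  set P : (ZMod N → E) × ℝ → ℝ → Prop := fun y s => ∀ σ ∈ Icc 0 s, 0 < (st h hq θ θ' k y σ).2 ∧
      act h θ k (st h hq θ θ' k y σ).1 (st h hq θ θ' k y σ).2 ≤ act h θ k y.1 y.2 - σ * (ε / 2) with hP
  set Kc : Set ((ZMod N → E) × ℝ) := {y | y ∈ Dom T1 κ ∧ y.2 ≤ T2 ∧ y.1 0 ∈ Q} with hKc
  have hcomp : IsCompact Kc := by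
    apply Metric.isCompact_of_isClosed_isBounded
    · have := len_continuous (N := N) (E := E)
      refine IsClosed.inter (IsClosed.inter ?_ ?_) (IsClosed.inter ?_ ?_)
      · exact isClosed_le continuous_const continuous_snd
      · exact isClosed_le (by fun_prop) continuous_snd
      · exact isClosed_le continuous_snd continuous_const
      · exact hQ.isClosed.preimage (by fun_prop)
    · obtain ⟨R, hR⟩ := hQ.isBounded.exists_norm_le
      refine isBounded_iff_forall_norm_le.2 ⟨max (R + T2 / κ) T2, fun y hy => ?_⟩
      have hl : len y.1 ≤ T2 / κ := by
        rw [le_div_iff₀ hκ]; linarith [hy.1.2, hy.2.1]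
      rw [Prod.norm_def]
      refine max_le_max ?_ ?_
      · refine (pi_norm_le_iff_of_nonneg ?_).2 fun i => ?_
        · have := (norm_nonneg _).trans (hR _ hy.2.2)
          linarith [len_nonneg y.1]
        · have h1 := dist_le_len y.1 i 0
          have h2 := hR _ hy.2.2
          have h3 : y.1 i = y.1 0 + (y.1 i - y.1 0) := by abel
          rw [h3]
          exact (norm_add_le _ _).trans (by linarith)
      · rw [Real.norm_of_nonneg (by linarith [hy.1.1])]
        exact hy.2.1
  have huni : ∃ s > 0, ∀ y ∈ Kc, P y s := by
    refine hcomp.induction_on (p := fun S => ∃ s > 0, ∀ y ∈ S, P y s) ⟨1, one_pos, by simp⟩ ?_ ?_ ?_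
    · rintro S S' hS ⟨s, hs, h2⟩
      exact ⟨s, hs, fun y hy => h2 y (hS hy)⟩
    · rintro S S' ⟨s, hs, h2⟩ ⟨s', hs', h2'⟩
      refine ⟨min s s', lt_min hs hs', ?_⟩
      rintro y (hy | hy) σ hσ
      · exact h2 y hy σ ⟨hσ.1, hσ.2.trans (min_le_left _ _)⟩
      · exact h2' y hy σ ⟨hσ.1, hσ.2.trans (min_le_right _ _)⟩
    · intro y hy
      obtain ⟨s, hs, hev⟩ := drop_local H G hε y (by linarith [hy.1.1]) (hg y hy.1 hy.2.1)
      exact ⟨_, mem_nhdsWithin_of_mem_nhds hev, s, hs, fun y hy => hy⟩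
  obtain ⟨s, hs, hsP⟩ := huni
  refine ⟨s, hs, fun y hy hyT => ?_⟩
  obtain ⟨m, hm, hmQ⟩ := hQΛ (y.1 0)
  have h1 := hsP (trs m y.1, y.2) ⟨⟨hy.1, by simpa using hy.2⟩, hyT, hmQ⟩
  intro σ hσ
  have h2 := h1 σ hσ
  have hst : st h hq θ θ' k (trs m y.1, y.2) σ =
      (trs m (st h hq θ θ' k y σ).1, (st h hq θ θ' k y σ).2) := by
    ext i
    · simp only [st, gr, gX_trs H G hm, gT_trs H hm, trs, Prod.fst_sub, Prod.smul_fst, Pi.sub_apply,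
        Pi.smul_apply]
      abel
    · simp only [st, gr, gX_trs H G hm, gT_trs H hm, Prod.snd_sub, Prod.smul_snd]
  rw [hst] at h2
  simpa only [act_trs H G hm] using h2

lemma act_k (k : ℝ) (x : ZMod N → E) (T : ℝ) : act h θ k x T = act h θ 0 x T + k * T := by
  simp [act]

/-- The minimax function of the energy. -/
noncomputable def cN (h : E × E → ℝ) (θ : E → E) (T1 κ : ℝ) (y0 y1 : (ZMod N → E) × ℝ) (k : ℝ) : ℝ :=
  cval (Dom T1 κ) y0 y1 (fun y => act h θ 0 y.1 y.2 + k * y.2)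

lemma disc_crit (H : Tame Λ h hq hp C) (G : Gauge Λ θ θ' K) {Q : Set E} (hQ : IsCompact Q)
    (hQΛ : ∀ x, ∃ m ∈ Λ, x + m ∈ Q) {b k T1 κ β M : ℝ} (hT1 : 0 < T1) (hκ0 : 0 < κ)
    (hκ : κ * (C * (b + C)) < 1)
    (hβ : T1 * (C * (b + C)) + K * (T1 * (C * (b + C))) ^ 2 + T1 * (b + C) ≤ β)
    (hk : k ≤ b) (hkC : 0 ≤ k + C) (hM : 0 ≤ M) {y0 y1 : (ZMod N → E) × ℝ}
    (h0 : act h θ k y0.1 y0.2 ≤ β) (h1 : act h θ k y1.1 y1.2 ≤ β)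
    (hβc : β < cN h θ T1 κ y0 y1 k)
    (hne : ∀ k, (Levels (Dom T1 κ) y0 y1 (fun y => act h θ 0 y.1 y.2 + k * y.2)).Nonempty)
    (hbd : BddBelow (Levels (Dom T1 κ) y0 y1 (fun y => act h θ 0 y.1 y.2 + k * y.2)))
    (hslope : ∀ᶠ δ in 𝓝[>] (0:ℝ), cN h θ T1 κ y0 y1 (k + δ) ≤ cN h θ T1 κ y0 y1 k + M * δ)
    {ε : ℝ} (hε : 0 < ε) :
    ∃ y ∈ Dom (N := N) T1 κ, y.2 ≤ M + 2 ∧ gn h hq θ θ' k y < ε := by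
  by_contra hcon
  push Not at hcon
  obtain ⟨s, hs, hdrop⟩ := drop_unif H G hQ hQΛ (T2 := M + 2) hε hT1 hκ0 hcon
  have hDU : Dom (N := N) (E := E) T1 κ ⊆ {y | 0 < y.2} := fun y hy => lt_of_lt_of_le hT1 hy.1
  refine minimax (D := Dom (N := N) (E := E) T1 κ) (A := fun y => act h θ 0 y.1 y.2) (Tt := fun y => y.2)
    (k := k) (β := β) (M := M) (η := ε / 2) (s := s) (y0 := y0) (y1 := y1)
    (Ψ := fun z => rt T1 κ (st h hq θ θ' k z.1 z.2)) ?_ (fun y hy => (hDU hy).le) hM (by positivity) hs ?_ ?_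
    hβc hne hbd hslope ?_ (fun y _ σ _ => rt_mem _ _ _) ?_ ?_
  · simp only [← act_k]
    exact (act_continuousOn H G k).mono hDU
  · rw [← act_k]; exact h0
  · rw [← act_k]; exact h1
  · refine (rt_continuous T1 κ).comp_continuousOn ?_
    unfold st
    refine continuousOn_fst.sub (continuousOn_snd.smul ?_)
    exact ((gr_continuousOn H G k).mono hDU).comp continuousOn_fst fun z hz => hz.1
  · intro y hy
    simp only [st, zero_smul, sub_zero]
    exact rt_eq hy
  · intro y hy hyT σ hσ
    obtain ⟨hp1, hp2⟩ := hdrop y hy hyT σ hσ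
    simp only [← act_k]
    refine (act_retract H G hT1 hκ hκ0 hβ hk hkC _ hp1).trans ?_
    exact max_le_max hp2 le_rfl

end disc
end MT

end ModuleD

section ModuleD2
open Filter Topology Set MeasureTheory
open scoped RealInnerProductSpace
set_option linter.unusedSectionVars false
set_option linter.unusedVariables false
namespace MT

variable {E : Type*} [NormedAddCommGroup E] [InnerProductSpace ℝ E]
section disc
variable [FiniteDimensional ℝ E]
variable {Λ : AddSubgroup E} {h : E × E → ℝ} {hq hp : E × E → E} {C : ℝ}
variable {θ : E → E} {θ' : E → E →L[ℝ] E} {K : ℝ}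

lemma levels_bdd {Y : Type*} [TopologicalSpace Y] (D : Set Y) (y0 y1 : Y) (f : Y → ℝ) :
    BddBelow (Levels D y0 y1 f) := by
  refine ⟨f y0, ?_⟩
  rintro m ⟨γ, hγ, hm⟩
  have := hm 0 (by simp)
  rwa [hγ.zero] at this

set_option maxHeartbeats 1600000 in
lemma disc_main (H : Tame Λ h hq hp C) (G : Gauge Λ θ θ' K) {Q : Set E} (hQ : IsCompact Q)
    (hQΛ : ∀ x, ∃ m ∈ Λ, x + m ∈ Q) {a b c : ℝ} (hc : 0 < c) (hab : a < b)
    (hsm : ∀ q0, ∃ p0, ∀ q p, ‖q - q0‖ ≤ c → ‖p - p0‖ ≤ c → h (q, p) ≤ a)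
    {Ts V : ℝ} (hTs : 0 < Ts) (hV : 0 ≤ V) :
    ∃ T1 > 0, ∃ κ > 0, ∃ U : ℝ, ∀ (N : ℕ) [NeZero N] (x : ZMod N → E),
      act h θ b x Ts < 0 → (∀ i, N * ‖dx x i‖ ≤ V) →
      ∃ cf : ℝ → ℝ, Monotone cf ∧ (∀ k ∈ Icc a b, 0 ≤ cf k ∧ cf k ≤ U) ∧
        ∀ k ∈ Ioo a b, ∀ M, 0 ≤ M → (∀ᶠ δ in 𝓝[>] (0:ℝ), cf (k + δ) ≤ cf k + M * δ) →
        ∀ ε > 0, ∃ y : (ZMod N → E) × ℝ, T1 ≤ y.2 ∧ y.2 ≤ M + 2 ∧ κ * len y.1 ≤ y.2 ∧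
          gn h hq θ θ' k y < ε := by
  have hC1 := H.Cpos
  have haC : 0 ≤ a + C := by
    obtain ⟨p0, hp0⟩ := hsm 0
    have h1 := hp0 0 p0 (by simp [hc.le]) (by simp [hc.le])
    have h2 := H.hC4 0 p0
    linarith
  have hK := G.nonneg
  have hbC : 0 < b + C := by linarith
  set u := C * (b + C) with hu
  have hu0 : 0 < u := by positivity
  set W := u + K * u ^ 2 + (b + C) with hW
  have hW0 : 0 < W := by positivity
  set δ := min c (c / (2 * (K + 1))) with hδ
  have hδ0 : 0 < δ := lt_min hc (by positivity)
  have hKδ : ∀ l, 0 ≤ l → l ≤ δ → K * l ≤ c / 2 := by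
    intro l hl0 hl
    have h1 : l ≤ c / (2 * (K + 1)) := hl.trans (min_le_right _ _)
    rw [le_div_iff₀ (by positivity)] at h1
    nlinarith
  set α := δ * (c / 2) with hα
  have hα0 : 0 < α := by positivity
  set T1 := min 1 (α / (2 * (W + 1))) with hT1d
  have hT1 : 0 < T1 := lt_min one_pos (by positivity)
  set κ := 1 / (2 * u) with hκd
  have hκ0 : 0 < κ := by positivity
  have hκ : κ * (C * (b + C)) < 1 := by
    rw [← hu, hκd]; field_simp; norm_num
  set β := T1 * W with hβd
  have hβ0 : 0 ≤ β := by positivity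
  have hβ : T1 * (C * (b + C)) + K * (T1 * (C * (b + C))) ^ 2 + T1 * (b + C) ≤ β := by
    rw [← hu]
    have h1 : T1 ≤ 1 := min_le_left _ _
    have h2 : T1 ^ 2 ≤ T1 := by nlinarith
    have h3 : K * (T1 * u) ^ 2 ≤ T1 * (K * u ^ 2) := by
      have := mul_le_mul_of_nonneg_right h2 (show 0 ≤ K * u ^ 2 by positivity)
      linarith [this]
    rw [hβd, hW]; linarith
  have hβα : β < α := by
    have h1 : T1 ≤ α / (2 * (W + 1)) := min_le_right _ _
    rw [le_div_iff₀ (by positivity)] at h1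
    nlinarith
  obtain ⟨c0, hc0⟩ := H.super (V / T1)
  set Tb := max Ts (max T1 (κ * V)) with hTb
  have hTb0 : 0 < Tb := lt_of_lt_of_le hTs (le_max_left _ _)
  refine ⟨T1, hT1, κ, hκ0, Tb * |c0| + K * V ^ 2 + max |a| |b| * Tb, ?_⟩
  intro N hN0 x hx hxV
  have hN : (0:ℝ) < N := Npos
  have hlenV : len x ≤ V := by
    have h1 : ∀ i, ‖dx x i‖ ≤ V / N := fun i => by
      rw [le_div_iff₀ hN]; linarith [hxV i]
    have h2 := Finset.sum_le_sum fun i (_ : i ∈ (Finset.univ : Finset (ZMod N))) => h1 i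
    simp only [Finset.sum_const, Finset.card_univ, ZMod.card, nsmul_eq_mul] at h2
    rwa [mul_div_cancel₀ _ hN.ne'] at h2
  have hlenδ : δ < len x := by
    by_contra hcon
    push Not at hcon
    have h1 := act_small H G hc hsm hab.le x hTs (hcon.trans (min_le_left _ _))
    have h2 := hKδ _ (len_nonneg x) hcon
    have h3 := len_nonneg x
    nlinarith
  set y0 : (ZMod N → E) × ℝ := (0, T1) with hy0
  set y1 : (ZMod N → E) × ℝ := rt T1 κ (x, Ts) with hy1
  have hy1T : y1.2 ≤ Tb := max_le_max le_rfl (max_le_max le_rfl (mul_le_mul_of_nonneg_left hlenV hκ0.le))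
  have hy1D : y1 ∈ Dom T1 κ := rt_mem _ _ _
  have hy11 : y1.1 = x := rfl
  -- segment
  have hseg : ∀ k, Tb * |c0| + K * V ^ 2 + |k| * Tb ∈
      Levels (Dom T1 κ) y0 y1 (fun y => act h θ 0 y.1 y.2 + k * y.2) := by
    intro k
    refine ⟨fun s => (s • x, T1 + s * (y1.2 - T1)), ⟨by fun_prop, by simp [hy0], ?_, ?_⟩, ?_⟩
    · simp [← hy11]
    · intro s hs
      refine ⟨?_, ?_⟩
      · have := mul_nonneg hs.1 (sub_nonneg.2 hy1D.1)
        simp only; linarith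
      · simp only
        rw [len_smul x hs.1]
        have h2 := mul_le_mul_of_nonneg_left hy1D.2 hs.1
        rw [hy11] at h2
        have h3 := mul_nonneg (sub_nonneg.2 hs.2) hT1.le
        linarith
    · intro s hs
      simp only
      rw [← act_k]
      set S := T1 + s * (y1.2 - T1) with hS
      have hS1 : T1 ≤ S := by
        have := mul_nonneg hs.1 (sub_nonneg.2 hy1D.1)
        linarith
      have hS2 : S ≤ Tb := by
        have := mul_le_mul_of_nonneg_right hs.2 (sub_nonneg.2 hy1D.1)
        linarith
      have hS0 : 0 < S := by linarith
      have hL : ∀ i, Lag h ((s • x) i, vel (s • x) S i) ≤ |c0| := by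
        intro i
        have hv : ‖vel (s • x) S i‖ ≤ V / T1 := by
          have h1 : dx (s • x) i = s • dx x i := by simp [dx, smul_sub]
          rw [vel, h1, norm_smul, norm_smul, Real.norm_of_nonneg (div_pos hN hS0).le,
            Real.norm_of_nonneg hs.1]
          have h2 : s * ‖dx x i‖ ≤ ‖dx x i‖ := by nlinarith [norm_nonneg (dx x i), hs.2]
          calc N / S * (s * ‖dx x i‖) ≤ N / S * ‖dx x i‖ :=
                mul_le_mul_of_nonneg_left h2 (div_pos hN hS0).le
            _ = (N * ‖dx x i‖) / S := by ring
            _ ≤ V / T1 := div_le_div₀ hV (hxV i) hT1 hS1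
        rw [Tame.lag_eq]
        set p := pst h ((s • x) i, vel (s • x) S i)
        have h3 := hc0 ((s • x) i) p
        have h4 := real_inner_le_norm p (vel (s • x) S i)
        have h5 := mul_le_mul_of_nonneg_left hv (norm_nonneg p)
        have h6 := le_abs_self c0
        simp only
        linarith
      have h1 : ∑ i, (S / N) * Lag h ((s • x) i, vel (s • x) S i) ≤ S * |c0| := by
        have := Finset.sum_le_sum fun i (_ : i ∈ (Finset.univ : Finset (ZMod N))) =>
          mul_le_mul_of_nonneg_left (hL i) (div_pos hS0 hN).le
        refine this.trans (le_of_eq ?_)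
        simp only [Finset.sum_const, Finset.card_univ, ZMod.card, nsmul_eq_mul]
        field_simp
      have h2 := (abs_le.1 (mag_bound G (s • x))).2
      rw [len_smul x hs.1] at h2
      have h3 : (s * len x) ^ 2 ≤ V ^ 2 := by
        apply pow_le_pow_left₀ (mul_nonneg hs.1 (len_nonneg _))
        nlinarith [len_nonneg x, hs.2, hs.1]
      have h4 := mul_le_mul_of_nonneg_left h3 hK
      have h5 : k * S ≤ |k| * Tb :=
        (mul_le_mul_of_nonneg_right (le_abs_self k) hS0.le).trans
          (mul_le_mul_of_nonneg_left hS2 (abs_nonneg k))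
      have h6 := mul_le_mul_of_nonneg_right hS2 (abs_nonneg c0)
      simp only [act]
      linarith
  have hTD : ∀ y ∈ Dom (N := N) (E := E) T1 κ, 0 ≤ y.2 := fun y hy => hT1.le.trans hy.1
  have hlow : ∀ k, a ≤ k → α ≤ cN h θ T1 κ y0 y1 k := by
    intro k hk
    refine le_csInf ⟨_, hseg k⟩ ?_
    rintro m ⟨γ, hγ, hm⟩
    have hcl : ContinuousOn (fun t => len (γ t).1) (Icc 0 1) :=
      len_continuous.comp_continuousOn (continuous_fst.comp_continuousOn hγ.cont)
    have hiv := intermediate_value_Icc zero_le_one hcl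
    have hmem : δ ∈ Icc (len (γ 0).1) (len (γ 1).1) := by
      rw [hγ.zero, hγ.one]
      refine ⟨?_, hlenδ.le⟩
      have : len (y0.1) = 0 := by simp [hy0, len, dx]
      rw [this]; exact hδ0.le
    obtain ⟨t, ht, hteq⟩ := hiv hmem
    refine le_trans ?_ (hm t ht)
    simp only at hteq ⊢
    rw [← act_k]
    have h1 := act_small H G hc hsm hk (γ t).1 (lt_of_lt_of_le hT1 (hγ.mem t ht).1)
      (hteq.le.trans (min_le_left _ _))
    rw [hteq] at h1
    have h2 := hKδ _ hδ0.le le_rfl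
    rw [hα]
    nlinarith
  refine ⟨cN h θ T1 κ y0 y1, ?_, ?_, ?_⟩
  · intro k k' hkk
    exact cval_mono hkk hTD ⟨_, hseg k'⟩ (levels_bdd _ _ _ _)
  · intro k hk
    refine ⟨hα0.le.trans (hlow k hk.1), ?_⟩
    refine (csInf_le (levels_bdd _ _ _ _) (hseg k)).trans ?_
    have : |k| ≤ max |a| |b| := abs_le_max_abs_abs hk.1 hk.2
    have := mul_le_mul_of_nonneg_right this hTb0.le
    linarith
  · intro k hk M hM hsl ε hε
    obtain ⟨y, hyD, hyM, hyg⟩ := disc_crit H G hQ hQΛ hT1 hκ0 hκ hβ hk.2.le (by linarith [hk.1]) hM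
      (y0 := y0) (y1 := y1) (by
        have hl : Lag h ((0:E), (0:E)) ≤ C := by
          rw [Tame.lag_eq]; simp only [inner_zero_right]
          linarith [H.hC4 0 (pst h ((0:E), (0:E)))]
        have : act h θ k y0.1 y0.2 = T1 * Lag h ((0:E), (0:E)) + k * T1 := by
          simp [act, mag, hy0, vel, dx]
          field_simp
        rw [this]
        have h1 := mul_le_mul_of_nonneg_left hl hT1.le
        have h2 := mul_le_mul_of_nonneg_left hk.2.le hT1.le
        have h3 : 0 ≤ T1 * (u + K * u ^ 2) := by positivity
        rw [hβd, hW]; linarith) (by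
        refine (act_retract H G hT1 hκ hκ0 hβ hk.2.le (by linarith [hk.1]) x hTs).trans ?_
        refine max_le ?_ le_rfl
        have h1 : act h θ k x Ts ≤ act h θ b x Ts := by
          rw [act_k k, act_k b]
          have := mul_le_mul_of_nonneg_right hk.2.le hTs.le
          linarith
        linarith)
      (lt_of_lt_of_le hβα (hlow k hk.1.le)) (fun k => ⟨_, hseg k⟩) (levels_bdd _ _ _ _) hsl hε
    exact ⟨y, hyD.1, hyM, hyD.2, hyg⟩

end disc
end MT

end ModuleD2

section ModuleF
open Filter Topology Set MeasureTheory
open scoped RealInnerProductSpace ENNReal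
set_option linter.unusedSectionVars false
set_option linter.unusedVariables false
namespace MT

lemma ae_slope {a b U : ℝ} (cf : ℕ → ℝ → ℝ) (hm : ∀ j, Monotone (cf j))
    (hb : ∀ j, ∀ k ∈ Icc a b, 0 ≤ cf j k ∧ cf j k ≤ U) :
    ∀ᵐ k ∂(volume : Measure ℝ), k ∈ Ioo a b → ∃ M : ℝ, 0 ≤ M ∧
      ∃ᶠ j in atTop, ∀ᶠ δ in 𝓝[>] (0:ℝ), cf j (k + δ) ≤ cf j k + M * δ := by
  by_cases hab : a < b
  swap
  · exact Eventually.of_forall fun k hk => absurd (hk.1.trans hk.2) hab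
  set g : ℕ → ℝ → ℝ≥0∞ := fun j => (hm j).stieltjesFunction.measure.rnDeriv volume with hg
  have hgm : ∀ j, Measurable (g j) := fun j => Measure.measurable_rnDeriv _ _
  have hint : ∀ j, ∫⁻ x in Ioo a b, g j x ≤ ENNReal.ofReal U := by
    intro j
    refine (Measure.setLIntegral_rnDeriv_le _).trans ?_
    rw [StieltjesFunction.measure_Ioo]
    apply ENNReal.ofReal_le_ofReal
    have h1 : Function.leftLim (hm j).stieltjesFunction b ≤ U := by
      refine le_of_tendsto ((hm j).stieltjesFunction.mono.tendsto_leftLim b) ?_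
      filter_upwards [self_mem_nhdsWithin] with x hx
      rw [Monotone.stieltjesFunction_eq]
      exact ((hm j).rightLim_le hx).trans (hb j b ⟨hab.le, le_rfl⟩).2
    have h2 : 0 ≤ (hm j).stieltjesFunction a := by
      rw [Monotone.stieltjesFunction_eq]
      exact (hb j a ⟨le_rfl, hab.le⟩).1.trans ((hm j).le_rightLim le_rfl)
    linarith
  have hfat : ∫⁻ x in Ioo a b, liminf (fun j => g j x) atTop ≠ ∞ := by
    refine ne_top_of_le_ne_top (b := ENNReal.ofReal U) ENNReal.ofReal_ne_top ?_
    refine (lintegral_liminf_le hgm).trans ?_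
    refine liminf_le_of_frequently_le' ?_
    exact Eventually.frequently (Eventually.of_forall hint)
  have hae := ae_lt_top (Measurable.liminf hgm) hfat
  rw [ae_restrict_iff' measurableSet_Ioo] at hae
  have hder : ∀ᵐ k ∂(volume : Measure ℝ), ∀ j, HasDerivAt (cf j) (g j k).toReal k ∧ g j k < ∞ := by
    rw [ae_all_iff]
    intro j
    filter_upwards [(hm j).ae_hasDerivAt, Measure.rnDeriv_lt_top (hm j).stieltjesFunction.measure volume]
      with k h1 h2
    exact ⟨h1, h2⟩
  filter_upwards [hae, hder] with k h1 h2 hk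
  have h3 := h1 hk
  obtain ⟨M, hM1, hM2⟩ := ENNReal.lt_iff_exists_real_btwn.1 h3
  refine ⟨M, hM1, ?_⟩
  have h4 := frequently_lt_of_liminf_lt (by isBoundedDefault) hM2.1
  refine h4.mono fun j hj => ?_
  have hlt : (g j k).toReal < M := by
    rw [← ENNReal.ofReal_toReal (h2 j).2.ne] at hj
    exact (ENNReal.ofReal_lt_ofReal_iff_of_nonneg ENNReal.toReal_nonneg).1 hj
  have hs := (h2 j).1.tendsto_slope
  have hs2 : ∀ᶠ y in 𝓝[≠] k, slope (cf j) k y < M := hs.eventually_lt_const hlt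
  have hs3 : Tendsto (fun δ : ℝ => k + δ) (𝓝[>] 0) (𝓝[≠] k) := by
    refine tendsto_nhdsWithin_iff.2 ⟨?_, ?_⟩
    · have : Tendsto (fun δ : ℝ => k + δ) (𝓝 0) (𝓝 (k + 0)) := (continuous_const.add continuous_id).tendsto 0
      rw [add_zero] at this
      exact this.mono_left nhdsWithin_le_nhds
    · filter_upwards [self_mem_nhdsWithin] with δ hδ
      have : (0:ℝ) < δ := hδ
      simp [this.ne']
  filter_upwards [hs3.eventually hs2, self_mem_nhdsWithin] with δ h5 hδ
  have hδ : (0:ℝ) < δ := hδ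
  rw [slope_def_field, add_sub_cancel_left, div_lt_iff₀ hδ] at h5
  linarith

end MT

end ModuleF

section ModuleL
open Filter Topology Set MeasureTheory
open scoped RealInnerProductSpace ENNReal
set_option linter.unusedSectionVars false
set_option linter.unusedVariables false
namespace MT
section limit
variable {W : Type*} [NormedAddCommGroup W] [NormedSpace ℝ W]

lemma tele (z : ℤ → W) {τ e : ℝ} (F0 : W) (i : ℤ) (n : ℕ)
    (hz : ∀ m, i ≤ m → m < i + n → ‖z (m + 1) - z m - τ • F0‖ ≤ τ * e) :
    ‖z (i + n) - z i - (n * τ) • F0‖ ≤ n * τ * e := by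
  induction n with
  | zero => simp
  | succ n ih =>
    have h1 := ih (fun m h1 h2 => hz m h1 (h2.trans (by push_cast; linarith)))
    have h2 := hz (i + n) (by linarith) (by push_cast; linarith)
    have h3 : z (i + (n + 1 : ℕ)) - z i - ((n + 1 : ℕ) * τ) • F0 =
      (z (i + n) - z i - (n * τ) • F0) + (z (i + n + 1) - z (i + n) - τ • F0) := by
      push_cast
      rw [← add_assoc, add_mul, one_mul, add_smul]
      abel
    rw [h3]
    refine (norm_add_le _ _).trans ?_
    push_cast
    linarith

lemma step_est (z : ℤ → W) {τ e s t : ℝ} (hτ : 0 < τ) (he : 0 ≤ e) (F0 : W) (hst : s ≤ t)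
    (hz : ∀ m, ⌊s / τ⌋ ≤ m → m < ⌊t / τ⌋ → ‖z (m + 1) - z m - τ • F0‖ ≤ τ * e) :
    ‖z ⌊t / τ⌋ - z ⌊s / τ⌋ - (t - s) • F0‖ ≤ (t - s + τ) * e + τ * ‖F0‖ := by
  have hfl : ⌊s / τ⌋ ≤ ⌊t / τ⌋ := Int.floor_le_floor (by gcongr)
  obtain ⟨n, hn⟩ := Int.eq_ofNat_of_zero_le (sub_nonneg.2 hfl)
  have hn' : ⌊t / τ⌋ = ⌊s / τ⌋ + n := by linarith
  rw [hn'] at hz ⊢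
  have h1 := tele z F0 _ n hz
  have hnr : (n : ℝ) = ⌊t / τ⌋ - ⌊s / τ⌋ := by rw [hn']; push_cast; ring
  have a1 := Int.floor_le (t / τ)
  have a2 := Int.lt_floor_add_one (t / τ)
  have a3 := Int.floor_le (s / τ)
  have a4 := Int.lt_floor_add_one (s / τ)
  have et : t = t / τ * τ := by field_simp
  have es : s = s / τ * τ := by field_simp
  have b1 : n * τ ≤ t - s + τ := by
    have : (n : ℝ) ≤ t / τ - s / τ + 1 := by rw [hnr]; linarith
    have := mul_le_mul_of_nonneg_right this hτ.le
    rw [add_mul, sub_mul, ← et, ← es] at this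
    linarith
  have b2 : t - s - τ ≤ n * τ := by
    have : t / τ - s / τ - 1 ≤ n := by rw [hnr]; linarith
    have := mul_le_mul_of_nonneg_right this hτ.le
    rw [sub_mul, sub_mul, ← et, ← es] at this
    linarith
  have h2 : z (⌊s / τ⌋ + n) - z ⌊s / τ⌋ - (t - s) • F0 =
      (z (⌊s / τ⌋ + n) - z ⌊s / τ⌋ - (n * τ) • F0) + (n * τ - (t - s)) • F0 := by
    rw [sub_smul (n * τ : ℝ)]; abel
  rw [h2]
  refine (norm_add_le _ _).trans (add_le_add (h1.trans (mul_le_mul_of_nonneg_right b1 he)) ?_)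
  rw [norm_smul]
  refine mul_le_mul_of_nonneg_right ?_ (norm_nonneg _)
  rw [Real.norm_eq_abs, abs_le]
  constructor <;> linarith

lemma limit_ode {K : Set W} (hK : IsCompact K) (F : W × W → W) (hF : Continuous F)
    (N : ℕ → ℕ) (hN : Tendsto N atTop atTop) (hN0 : ∀ j, 0 < N j) (T ε : ℕ → ℝ) {T1 T2 : ℝ}
    (hT1 : 0 < T1) (hT : ∀ j, T j ∈ Icc T1 T2) (hε0 : ∀ j, 0 ≤ ε j) (hε1 : ∀ j, ε j ≤ 1)
    (hε : Tendsto ε atTop (𝓝 0)) (z : ℕ → ℤ → W) (hzp : ∀ j i, z j (i + N j) = z j i)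
    (hzK : ∀ j i, z j i ∈ K)
    (hz : ∀ j i, ‖z j (i + 1) - z j i - (T j / N j) • F (z j i, z j (i + 1))‖ ≤ (T j / N j) * ε j) :
    ∃ S, 0 < S ∧ ∃ Z : ℝ → W, (∀ t, Z t ∈ K) ∧ Function.Periodic Z S ∧
      (∀ t, HasDerivAt Z (F (Z t, Z t)) t) ∧
      ∀ g : W → ℝ, Continuous g → ∀ c, (∀ j, ∃ i, g (z j i) ≤ c + ε j) → ∃ t, g (Z t) ≤ c := by
  obtain ⟨L0, hL0⟩ := ((hK.prod hK).image hF).isBounded.exists_norm_le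
  set L := max L0 0 with hL
  have hLb : ∀ w ∈ K, ∀ w' ∈ K, ‖F (w, w')‖ ≤ L := fun w hw w' hw' =>
    (hL0 _ ⟨(w, w'), ⟨hw, hw'⟩, rfl⟩).trans (le_max_left _ _)
  have hL0' : 0 ≤ L := le_max_right _ _
  set τ : ℕ → ℝ := fun j => T j / N j with hτd
  have hTpos : ∀ j, 0 < T j := fun j => lt_of_lt_of_le hT1 (hT j).1
  have hNpos : ∀ j, (0:ℝ) < N j := fun j => Nat.cast_pos.2 (hN0 j)
  have hτ0 : ∀ j, 0 < τ j := fun j => div_pos (hTpos j) (hNpos j)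
  have hτlim : Tendsto τ atTop (𝓝 0) := by
    have h1 : Tendsto (fun j => T2 / (N j : ℝ)) atTop (𝓝 0) :=
      (tendsto_natCast_atTop_atTop.comp hN).const_div_atTop T2
    refine squeeze_zero (fun j => (hτ0 j).le) (fun j => ?_) h1
    exact div_le_div_of_nonneg_right (hT j).2 (hNpos j).le
  set U : Filter ℕ := (hyperfilter ℕ : Filter ℕ) with hU
  have hUle : U ≤ atTop := by
    rw [← Nat.cofinite_eq_atTop]; exact hyperfilter_le_cofinite
  set Y : ℕ → ℝ → W := fun j t => z j ⌊t / τ j⌋ with hY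
  have hstep : ∀ j i, ‖z j (i + 1) - z j i - τ j • (0:W)‖ ≤ τ j * (L + 1) := by
    intro j i
    have h1 := hz j i
    have h2 := hLb _ (hzK j i) _ (hzK j (i + 1))
    have h3 : z j (i + 1) - z j i - τ j • (0:W) = (z j (i + 1) - z j i - τ j • F (z j i, z j (i + 1)))
      + τ j • F (z j i, z j (i + 1)) := by simp
    rw [h3]
    refine (norm_add_le _ _).trans ?_
    rw [norm_smul, Real.norm_of_nonneg (hτ0 j).le]
    have h4 := mul_le_mul_of_nonneg_left h2 (hτ0 j).le
    have h5 := mul_le_mul_of_nonneg_left (hε1 j) (hτ0 j).le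
    linarith
  have hlip0 : ∀ j s t, s ≤ t → ‖Y j t - Y j s‖ ≤ (t - s + τ j) * (L + 1) := by
    intro j s t hst
    have := step_est (z j) (hτ0 j) (by linarith) 0 hst (fun m _ _ => hstep j m)
    simpa using this
  have hlip : ∀ j s t, ‖Y j t - Y j s‖ ≤ (|t - s| + τ j) * (L + 1) := by
    intro j s t
    rcases le_total s t with hst | hst
    · rw [abs_of_nonneg (sub_nonneg.2 hst)]; exact hlip0 j s t hst
    · rw [abs_of_nonpos (sub_nonpos.2 hst), norm_sub_rev, neg_sub]; exact hlip0 j t s hst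
  have hlimZ : ∀ t, ∃ w ∈ K, Tendsto (fun j => Y j t) U (𝓝 w) := by
    intro t
    obtain ⟨w, hw, hle⟩ := hK.ultrafilter_le_nhds ((hyperfilter ℕ).map (fun j => Y j t))
      (by
        rw [Ultrafilter.coe_map]
        exact tendsto_principal.2 (Eventually.of_forall fun j => hzK j _))
    exact ⟨w, hw, hle⟩
  choose Z hZK hZ using hlimZ
  obtain ⟨S, hS, hSlim⟩ : ∃ S ∈ Icc T1 T2, Tendsto T U (𝓝 S) := by
    obtain ⟨w, hw, hle⟩ := (isCompact_Icc (a := T1) (b := T2)).ultrafilter_le_nhds ((hyperfilter ℕ).map T)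
      (by
        rw [Ultrafilter.coe_map]
        exact tendsto_principal.2 (Eventually.of_forall hT))
    exact ⟨w, hw, hle⟩
  have hτU : Tendsto τ U (𝓝 0) := hτlim.mono_left hUle
  have hεU : Tendsto ε U (𝓝 0) := hε.mono_left hUle
  -- limit along moving times
  have hmove : ∀ (s : ℕ → ℝ) t, Tendsto s U (𝓝 t) → Tendsto (fun j => Y j (s j)) U (𝓝 (Z t)) := by
    intro s t hs
    have h1 : Tendsto (fun j => Y j (s j) - Y j t) U (𝓝 0) := by
      refine squeeze_zero_norm (fun j => hlip j t (s j)) ?_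
      have : Tendsto (fun j => (|s j - t| + τ j) * (L + 1)) U (𝓝 ((|t - t| + 0) * (L + 1))) :=
        ((hs.sub_const t).abs.add hτU).mul_const _
      simpa using this
    have := h1.add (hZ t)
    simpa using this
  refine ⟨S, lt_of_lt_of_le hT1 hS.1, Z, hZK, ?_, ?_, ?_⟩
  · intro t
    have h1 := hmove (fun j => t + T j) (t + S) (hSlim.const_add t)
    have h2 : ∀ j, Y j (t + T j) = Y j t := by
      intro j
      simp only [hY]
      have : (t + T j) / τ j = t / τ j + (N j : ℤ) := by
        simp only [hτd]
        have := (hTpos j).ne'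
        have := (hNpos j).ne'
        push_cast
        field_simp
      rw [this, Int.floor_add_intCast, hzp]
    simp only [h2] at h1
    exact tendsto_nhds_unique h1 (hZ t)
  · intro t0
    set F0 := F (Z t0, Z t0) with hF0
    -- local estimate
    have hloc : ∀ η > 0, ∃ r > 0, ∀ s t, s ≤ t → |s - t0| ≤ r → |t - t0| ≤ r →
        ‖Z t - Z s - (t - s) • F0‖ ≤ (t - s) * η := by
      intro η hη
      obtain ⟨ρ, hρ, hρF⟩ := Metric.continuousAt_iff.1 (hF.continuousAt (x := (Z t0, Z t0))) η hη
      refine ⟨ρ / (8 * (L + 1)), by positivity, ?_⟩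
      set r := ρ / (8 * (L + 1)) with hr
      have hrL : r * (L + 1) = ρ / 8 := by rw [hr]; field_simp
      intro s t hst hs ht
      have ev1 : ∀ᶠ j in U, τ j < r := hτU.eventually_lt_const (by positivity)
      have ev2 : ∀ᶠ j in U, dist (Y j t0) (Z t0) < ρ / 8 :=
        (hZ t0).eventually (Metric.ball_mem_nhds _ (by positivity))
      have ev : ∀ᶠ j in U, ‖Y j t - Y j s - (t - s) • F0‖ ≤
          (t - s + τ j) * (η + ε j) + τ j * ‖F0‖ := by
        filter_upwards [ev1, ev2] with j h1 h2
        refine step_est (z j) (hτ0 j) (by linarith [hε0 j]) F0 hst ?_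
        have hclose : ∀ m : ℤ, ⌊s / τ j⌋ ≤ m → m ≤ ⌊t / τ j⌋ → dist (z j m) (Z t0) < ρ := by
          intro m hm1 hm2
          have e1 : z j m = Y j (m * τ j) := by
            simp only [hY]
            rw [mul_div_cancel_right₀ _ (hτ0 j).ne', Int.floor_intCast]
          have hm1' : s - τ j ≤ m * τ j := by
            have a4 := Int.lt_floor_add_one (s / τ j)
            have : s / τ j - 1 ≤ m := by
              have : (⌊s / τ j⌋ : ℝ) ≤ m := by exact_mod_cast hm1
              linarith
            have := mul_le_mul_of_nonneg_right this (hτ0 j).le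
            rwa [sub_mul, div_mul_cancel₀ _ (hτ0 j).ne', one_mul] at this
          have hm2' : m * τ j ≤ t := by
            have a4 := Int.floor_le (t / τ j)
            have : (m:ℝ) ≤ t / τ j := by
              have : (m : ℝ) ≤ (⌊t / τ j⌋ : ℝ) := by exact_mod_cast hm2
              linarith
            have := mul_le_mul_of_nonneg_right this (hτ0 j).le
            rwa [div_mul_cancel₀ _ (hτ0 j).ne'] at this
          have h3 := hlip j t0 (m * τ j)
          have h4 : |m * τ j - t0| ≤ 2 * r := by
            rw [abs_le] at hs ht ⊢
            constructor <;> linarith [hs.1, hs.2, ht.1, ht.2]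
          have h5 : (|m * τ j - t0| + τ j) * (L + 1) ≤ (3 * r) * (L + 1) :=
            mul_le_mul_of_nonneg_right (by linarith) (by linarith)
          rw [e1]
          calc dist (Y j (m * τ j)) (Z t0) ≤ dist (Y j (m * τ j)) (Y j t0) + dist (Y j t0) (Z t0) :=
                dist_triangle _ _ _
            _ < ρ := by rw [dist_eq_norm]; linarith
        intro m hm1 hm2
        have c1 := hclose m hm1 hm2.le
        have c2 := hclose (m + 1) (by linarith) (by linarith)
        have c3 : dist (F (z j m, z j (m + 1))) F0 < η := by
          apply hρF
          rw [Prod.dist_eq]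
          exact max_lt c1 c2
        have c4 := hz j m
        have c5 : z j (m + 1) - z j m - τ j • F0 = (z j (m + 1) - z j m - τ j • F (z j m, z j (m + 1)))
          + τ j • (F (z j m, z j (m + 1)) - F0) := by
          rw [smul_sub]; abel
        rw [c5]
        refine (norm_add_le _ _).trans ?_
        rw [norm_smul, Real.norm_of_nonneg (hτ0 j).le, ← dist_eq_norm (F _)]
        have c6 := mul_le_mul_of_nonneg_left c3.le (hτ0 j).le
        linarith
      have hl1 : Tendsto (fun j => ‖Y j t - Y j s - (t - s) • F0‖) U (𝓝 ‖Z t - Z s - (t - s) • F0‖) :=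
        (((hZ t).sub (hZ s)).sub_const _).norm
      have hl2 : Tendsto (fun j => (t - s + τ j) * (η + ε j) + τ j * ‖F0‖) U
          (𝓝 ((t - s + 0) * (η + 0) + 0 * ‖F0‖)) :=
        ((hτU.const_add _).mul (hεU.const_add _)).add (hτU.mul_const _)
      have := le_of_tendsto_of_tendsto hl1 hl2 ev
      simpa using this
    rw [hasDerivAt_iff_isLittleO, Asymptotics.isLittleO_iff]
    intro η hη
    obtain ⟨r, hr, hloc'⟩ := hloc η hη
    filter_upwards [Metric.closedBall_mem_nhds t0 hr] with t ht
    rw [Metric.mem_closedBall, Real.dist_eq] at ht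
    rcases le_total t0 t with hst | hst
    · have := hloc' t0 t hst (by simpa using hr.le) ht
      rw [Real.norm_of_nonneg (sub_nonneg.2 hst)]
      linarith
    · have := hloc' t t0 hst ht (by simpa using hr.le)
      rw [Real.norm_of_nonpos (sub_nonpos.2 hst)]
      have e : Z t - Z t0 - (t - t0) • F0 = -(Z t0 - Z t - (t0 - t) • F0) := by
        rw [neg_sub, sub_smul, sub_smul]; abel
      rw [e, norm_neg]
      linarith
  · intro g hg c hc
    have hex : ∀ j, ∃ s ∈ Icc 0 T2, g (Y j s) ≤ c + ε j := by
      intro j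
      obtain ⟨i, hi⟩ := hc j
      have hper : Function.Periodic (z j) (N j : ℤ) := fun i => hzp j i
      have hNz : (0:ℤ) < N j := by exact_mod_cast hN0 j
      have e1 : z j (i % N j) = z j i := by
        have := hper.int_mul (i / N j) (i % N j)
        rw [mul_comm, Int.cast_id, Int.emod_add_mul_ediv] at this
        exact this.symm
      have hi0 := Int.emod_nonneg i hNz.ne'
      have hi1 := Int.emod_lt_of_pos i hNz
      refine ⟨(i % N j : ℤ) * τ j, ⟨mul_nonneg (by exact_mod_cast hi0) (hτ0 j).le, ?_⟩, ?_⟩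
      · have h1 : ((i % N j : ℤ) : ℝ) ≤ N j := by exact_mod_cast hi1.le
        have h2 := mul_le_mul_of_nonneg_right h1 (hτ0 j).le
        have h3 : (N j : ℝ) * τ j = T j := by
          simp only [hτd]; rw [mul_div_cancel₀ _ (hNpos j).ne']
        linarith [(hT j).2]
      · simp only [hY]
        rw [mul_div_cancel_right₀ _ (hτ0 j).ne', Int.floor_intCast, e1]
        exact hi
    choose s hs hgs using hex
    obtain ⟨t, ht, hle⟩ := (isCompact_Icc (a := 0) (b := T2)).ultrafilter_le_nhds ((hyperfilter ℕ).map s)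
      (by
        rw [Ultrafilter.coe_map]
        exact tendsto_principal.2 (Eventually.of_forall hs))
    have hst : Tendsto s U (𝓝 t) := hle
    refine ⟨t, ?_⟩
    have h1 := (hg.tendsto _).comp (hmove s t hst)
    have h2 := hεU.const_add c
    rw [add_zero] at h2
    exact le_of_tendsto_of_tendsto h1 h2 (Eventually.of_forall hgs)

end limit
end MT

end ModuleL

section ModuleP
open Filter Topology Set MeasureTheory
open scoped RealInnerProductSpace ENNReal
set_option linter.unusedSectionVars false
set_option linter.unusedVariables false
namespace MT

variable {E : Type*} [NormedAddCommGroup E] [InnerProductSpace ℝ E]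
section disc
variable [FiniteDimensional ℝ E]
variable {Λ : AddSubgroup E} {h : E × E → ℝ} {hq hp : E × E → E} {C : ℝ}
variable {θ : E → E} {θ' : E → E →L[ℝ] E} {K : ℝ}

/-- The discrete/continuous vector field in canonical coordinates. -/
noncomputable def FF (hq hp : E × E → E) (θ : E → E) (θ' : E → E →L[ℝ] E) (w : (E × E) × (E × E)) : E × E :=
  (hp (w.1.1, w.1.2 - θ w.1.1), -hq (w.2.1, w.2.2 - θ w.2.1) +
    ContinuousLinearMap.adjoint (θ' w.2.1) (hp (w.2.1, w.2.2 - θ w.2.1)))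

lemma FF_continuous (H : Tame Λ h hq hp C) (G : Gauge Λ θ θ' K) : Continuous (FF hq hp θ θ') := by
  unfold FF
  have h1 := G.cont
  have h2 := G.cont'
  have h4 := H.cq
  have h5 := H.cp
  have h3 : Continuous (fun y : (E × E) × (E × E) => ContinuousLinearMap.adjoint (θ' y.2.1)) :=
      (LinearIsometryEquiv.continuous (ContinuousLinearMap.adjoint (𝕜 := ℝ) (E := E) (F := E))).comp
        (h2.comp (by fun_prop))
  refine Continuous.prodMk (by fun_prop) (Continuous.add (by fun_prop) (h3.clm_apply (by fun_prop)))

lemma gn_trs {N : ℕ} [NeZero N] (H : Tame Λ h hq hp C) (G : Gauge Λ θ θ' K) {m : E} (hm : m ∈ Λ) (k : ℝ)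
    (y : (ZMod N → E) × ℝ) : gn h hq θ θ' k (trs m y.1, y.2) = gn h hq θ θ' k y := by
  simp only [gn, gX_trs H G hm, gT_trs H hm]

lemma orbit_step (H : Tame Λ h hq hp C) (G : Gauge Λ θ θ' K) {Q : Set E} (hQ : IsCompact Q)
    (hQΛ : ∀ x, ∃ m ∈ Λ, x + m ∈ Q) {T1 T2 κ : ℝ} (k : ℝ) (hT1 : 0 < T1) (hκ : 0 < κ) :
    ∃ R : ℝ, ∀ (N : ℕ) [NeZero N] (y : (ZMod N → E) × ℝ) (ε : ℝ), 0 < ε → ε ≤ 1 →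
      T1 ≤ y.2 → y.2 ≤ T2 → κ * len y.1 ≤ y.2 → gn h hq θ θ' k y < (min 1 (T1 / N) * ε) ^ 2 →
      ∃ z : ℤ → E × E, (∀ i, z (i + N) = z i) ∧ (∀ i, z i ∈ Metric.closedBall 0 R) ∧
        (∀ i, ‖z (i + 1) - z i - (y.2 / N) • FF hq hp θ θ' (z i, z (i + 1))‖ ≤ (y.2 / N) * ε) ∧
        (∃ i, h ((z i).1, (z i).2 - θ (z i).1) ≤ k + ε) ∧
        (∃ i, k - ε ≤ h ((z i).1, (z i).2 - θ (z i).1)) := by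
  obtain ⟨RQ, hRQ⟩ := hQ.isBounded.exists_norm_le
  set Rx := RQ + T2 / κ with hRx
  set RP := C * (k + 1 + C) + (‖θ 0‖ + K * Rx) + (T2 * C + K * (T2 / κ) + T2) with hRP
  refine ⟨max Rx RP, ?_⟩
  intro N _ y0 ε hε hε1 hyT1 hyT2 hylen hgn
  have hN : (0:ℝ) < N := Npos
  obtain ⟨m, hm, hmQ⟩ := hQΛ (y0.1 0)
  set T := y0.2 with hT
  set x := trs m y0.1 with hx
  have hT0 : 0 < T := by linarith
  rw [← gn_trs H G hm] at hgn
  have hlen : κ * len x ≤ T := by rw [hx, len_trs]; exact hylen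
  have hlen2 : len x ≤ T2 / κ := by rw [le_div_iff₀ hκ]; linarith
  have hK := G.nonneg
  have hC1 := H.Cpos
  set δ := min 1 (T1 / N) * ε with hδ
  have hmin : 0 < min 1 (T1 / N) := lt_min one_pos (by positivity)
  have hδ0 : 0 < δ := mul_pos hmin hε
  have hδ1 : δ ≤ ε := by
    have := min_le_left 1 (T1 / N)
    rw [hδ]; nlinarith
  have hτ : 0 < T / N := by positivity
  have hδ2 : δ ≤ T / N * ε := by
    have h1 := min_le_right 1 (T1 / (N:ℝ))
    have h2 : T1 / N ≤ T / N := by gcongr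
    rw [hδ]
    exact mul_le_mul_of_nonneg_right (h1.trans h2) hε.le
  have hsq : 0 ≤ ∑ i, ‖gX h hq θ θ' x T i‖ ^ 2 := Finset.sum_nonneg fun i _ => by positivity
  have hgT : |gT h k x T| ≤ ε := by
    refine le_trans (abs_le_of_sq_le_sq ?_ hδ0.le) hδ1
    simp only [gn] at hgn
    nlinarith [hsq]
  have hgX : ∀ i, ‖gX h hq θ θ' x T i‖ ≤ T / N * ε := by
    intro i
    refine le_trans ?_ hδ2
    have h1 : ‖gX h hq θ θ' x T i‖ ^ 2 ≤ ∑ i, ‖gX h hq θ θ' x T i‖ ^ 2 :=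
      Finset.single_le_sum (f := fun i => ‖gX h hq θ θ' x T i‖ ^ 2)
        (fun i _ => by positivity) (Finset.mem_univ i)
    have h2 : ‖gX h hq θ θ' x T i‖ ^ 2 ≤ δ ^ 2 := by
      simp only [gn] at hgn
      nlinarith [sq_nonneg (gT h k x T)]
    exact le_of_sq_le_sq h2 hδ0.le |> fun h => h
  set p := mom h x T with hp'
  set P : ZMod N → E := fun i => p i + θ (x i) with hP
  have hPsub : ∀ i, P i - θ (x i) = p i := fun i => by simp [hP]
  have hdxv : ∀ i, dx x i = (T / N) • hp (x i, p i) := by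
    intro i
    rw [hp', hp_mom H, vel, smul_smul]
    rw [show T / N * (N / T) = 1 by field_simp, one_smul]
  have hdP : ∀ i, dx P i = (T / N) • (-hq (x (i+1), p (i+1)) +
      ContinuousLinearMap.adjoint (θ' (x (i+1))) (hp (x (i+1), p (i+1)))) - gX h hq θ θ' x T (i+1) := by
    intro i
    simp only [dx, hP, gX]
    rw [show x (i + 1 + 1) - x (i + 1) = dx x (i+1) from rfl, hdxv (i+1), map_smul, add_sub_cancel_right,
      smul_add, smul_neg]
    abel
  -- energies
  have hmean : ∑ i, h (x i, p i) = N * (k - gT h k x T) := by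
    simp only [gT, ← hp']
    field_simp
    ring
  have hg := abs_le.1 hgT
  have hlo : ∃ i, h (x i, p i) ≤ k + ε := by
    have : ∑ i, h (x i, p i) ≤ ∑ i : ZMod N, (k + ε) := by
      rw [hmean]
      simp only [Finset.sum_const, Finset.card_univ, ZMod.card, nsmul_eq_mul]
      exact mul_le_mul_of_nonneg_left (by linarith) hN.le
    obtain ⟨i, _, hi⟩ := Finset.exists_le_of_sum_le ⟨0, Finset.mem_univ _⟩ this
    exact ⟨i, hi⟩
  have hhi : ∃ i, k - ε ≤ h (x i, p i) := by
    have : ∑ i : ZMod N, (k - ε) ≤ ∑ i, h (x i, p i) := by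
      rw [hmean]
      simp only [Finset.sum_const, Finset.card_univ, ZMod.card, nsmul_eq_mul]
      exact mul_le_mul_of_nonneg_left (by linarith) hN.le
    obtain ⟨i, _, hi⟩ := Finset.exists_le_of_sum_le ⟨0, Finset.mem_univ _⟩ this
    exact ⟨i, hi⟩
  -- bounds
  have hxb : ∀ i, ‖x i‖ ≤ Rx := by
    intro i
    have h1 := dist_le_len x i 0
    have h2 := hRQ _ hmQ
    have h3 : x i = (y0.1 0 + m) + (x i - x 0) := by
      simp only [hx, trs]
      abel
    rw [h3]
    exact (norm_add_le _ _).trans (by linarith)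
  have hdPb : ∀ i, ‖dx P i‖ ≤ (T / N) * C + K * ‖dx x (i + 1)‖ + T / N * ε := by
    intro i
    rw [hdP, smul_add]
    refine (norm_sub_le _ _).trans (add_le_add ((norm_add_le _ _).trans (add_le_add ?_ ?_)) (hgX _))
    · rw [norm_smul, Real.norm_of_nonneg hτ.le, norm_neg]
      exact mul_le_mul_of_nonneg_left (H.qb _) hτ.le
    · rw [← map_smul, ← hdxv]
      refine (ContinuousLinearMap.le_opNorm _ _).trans ?_
      rw [LinearIsometryEquiv.norm_map]
      exact mul_le_mul_of_nonneg_right (G.bd _) (norm_nonneg _)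
  have hlenP : len P ≤ T2 * C + K * (T2 / κ) + T2 := by
    have h1 := Finset.sum_le_sum fun i (_ : i ∈ (Finset.univ : Finset (ZMod N))) => hdPb i
    have hsh := Equiv.sum_comp (Equiv.addRight (1 : ZMod N)) (fun i => K * ‖dx x i‖)
    simp only [Equiv.coe_addRight] at hsh
    have hsh2 : ∑ i, K * ‖dx x i‖ = K * len x := (Finset.mul_sum _ _ _).symm
    rw [Finset.sum_add_distrib, Finset.sum_add_distrib, hsh, hsh2] at h1
    simp only [Finset.sum_const, Finset.card_univ, ZMod.card, nsmul_eq_mul] at h1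
    have e1 : (N : ℝ) * (T / N * C) = T * C := by field_simp
    have e2 : (N : ℝ) * (T / N * ε) = T * ε := by field_simp
    rw [e1, e2] at h1
    have h2 : K * len x ≤ K * (T2 / κ) := mul_le_mul_of_nonneg_left hlen2 hK
    have h3 : T * C ≤ T2 * C := mul_le_mul_of_nonneg_right hyT2 (by linarith)
    have h4 : T * ε ≤ T2 := by nlinarith
    change len P ≤ _ + K * len x + _ at h1
    linarith
  have hPb : ∀ i, ‖P i‖ ≤ RP := by
    intro i
    obtain ⟨i0, hi0⟩ := hlo
    have h1 := dist_le_len P i i0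
    have h2 := H.hC (x i0) (p i0)
    have h3 : C * (h (x i0, p i0) + C) ≤ C * (k + 1 + C) :=
      mul_le_mul_of_nonneg_left (by linarith) (by linarith)
    have h4 : ‖θ (x i0)‖ ≤ ‖θ 0‖ + K * Rx := by
      have h5 := G.lip (x i0) 0
      rw [sub_zero] at h5
      have h6 : θ (x i0) = θ 0 + (θ (x i0) - θ 0) := by abel
      rw [h6]
      refine (norm_add_le _ _).trans ?_
      have := mul_le_mul_of_nonneg_left (hxb i0) hK
      linarith
    have h7 : P i = p i0 + θ (x i0) + (P i - P i0) := by simp [hP]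
    rw [h7]
    refine (norm_add_le _ _).trans ?_
    have h8 := norm_add_le (p i0) (θ (x i0))
    linarith
  refine ⟨fun i => (x (i : ZMod N), P (i : ZMod N)), ?_, ?_, ?_, ?_, ?_⟩
  · intro i; simp
  · intro i
    rw [mem_closedBall_zero_iff, Prod.norm_def]
    exact max_le_max (hxb _) (hPb _)
  · intro i
    have e : ((x ((i + 1 : ℤ) : ZMod N), P ((i + 1 : ℤ) : ZMod N)) : E × E) - (x (i : ZMod N), P (i : ZMod N)) -
      (T / N) • FF hq hp θ θ' ((x (i : ZMod N), P (i : ZMod N)), (x ((i + 1 : ℤ) : ZMod N), P ((i + 1 : ℤ) : ZMod N))) =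
      (0, -gX h hq θ θ' x T ((i : ZMod N) + 1)) := by
      simp only [FF, hPsub, Int.cast_add, Int.cast_one]
      ext1
      · simp only [Prod.fst_sub, Prod.smul_fst]
        rw [← hdxv]; simp [dx]
      · simp only [Prod.snd_sub, Prod.smul_snd]
        have := hdP (i : ZMod N)
        rw [dx] at this
        rw [this]; abel
    simp only
    rw [e, Prod.norm_def, norm_zero, norm_neg]
    exact max_le (by positivity) (hgX _)
  · obtain ⟨i, hi⟩ := hlo
    obtain ⟨i, rfl⟩ := ZMod.intCast_surjective i
    exact ⟨i, by simpa only [hPsub] using hi⟩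
  · obtain ⟨i, hi⟩ := hhi
    obtain ⟨i, rfl⟩ := ZMod.intCast_surjective i
    exact ⟨i, by simpa only [hPsub] using hi⟩

/-- Canonical periodic orbit of energy k. -/
def HasOrbit (h : E × E → ℝ) (hq hp : E × E → E) (θ : E → E) (θ' : E → E →L[ℝ] E) (k : ℝ) : Prop :=
  ∃ S, 0 < S ∧ ∃ X P : ℝ → E, Function.Periodic X S ∧ Function.Periodic P S ∧
    (∀ t, HasDerivAt X (hp (X t, P t - θ (X t))) t) ∧
    (∀ t, HasDerivAt P (-hq (X t, P t - θ (X t)) +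
      ContinuousLinearMap.adjoint (θ' (X t)) (hp (X t, P t - θ (X t)))) t) ∧
    ∀ t, h (X t, P t - θ (X t)) = k

lemma orbit_of_approx (H : Tame Λ h hq hp C) (G : Gauge Λ θ θ' K) {Q : Set E} (hQ : IsCompact Q)
    (hQΛ : ∀ x, ∃ m ∈ Λ, x + m ∈ Q) {T1 T2 κ : ℝ} (k : ℝ) (hT1 : 0 < T1) (hκ : 0 < κ)
    (hap : ∀ n : ℕ, ∀ ε : ℝ → ℝ, (∀ r, 0 < r → 0 < ε r) → ∃ N : ℕ, n ≤ N ∧ ∃ _ : NeZero N,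
      ∃ y : (ZMod N → E) × ℝ, T1 ≤ y.2 ∧ y.2 ≤ T2 ∧ κ * len y.1 ≤ y.2 ∧ gn h hq θ θ' k y < ε N) :
    HasOrbit h hq hp θ θ' k := by
  obtain ⟨R, hR⟩ := orbit_step H G hQ hQΛ (T2 := T2) k hT1 hκ
  have key : ∀ j : ℕ, ∃ N : ℕ, j + 1 ≤ N ∧ ∃ T ∈ Icc T1 T2, 
      ∃ z : ℤ → E × E, (∀ i, z (i + N) = z i) ∧ (∀ i, z i ∈ Metric.closedBall 0 R) ∧
        (∀ i, ‖z (i + 1) - z i - (T / N) • FF hq hp θ θ' (z i, z (i + 1))‖ ≤ (T / N) * (1 / ((j:ℝ) + 1))) ∧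
        (∃ i, h ((z i).1, (z i).2 - θ (z i).1) ≤ k + 1 / ((j:ℝ) + 1)) ∧
        (∃ i, k - 1 / ((j:ℝ) + 1) ≤ h ((z i).1, (z i).2 - θ (z i).1)) := by
    intro j
    obtain ⟨N, hN, hN0, y, h1, h2, h3, h4⟩ := hap (j + 1) (fun r => (min 1 (T1 / r) * (1 / ((j:ℝ) + 1))) ^ 2) (by
      intro r hr
      have : 0 < min 1 (T1 / r) := lt_min one_pos (by positivity)
      positivity)
    refine ⟨N, hN, y.2, ⟨h1, h2⟩, hR N y (1 / ((j:ℝ) + 1)) (by positivity) ?_ h1 h2 h3 h4⟩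
    rw [div_le_one (by positivity)]
    linarith [(Nat.cast_nonneg j : (0:ℝ) ≤ j)]
  choose N hN T hT z hz1 hz2 hz3 hz4 hz5 using key
  haveI : ProperSpace (E × E) := FiniteDimensional.proper ℝ (E × E)
  have hNt : Tendsto N atTop atTop := tendsto_atTop_mono (fun j => (Nat.le_succ j).trans (hN j)) tendsto_id
  obtain ⟨S, hS, Z, hZK, hZp, hZd, hZg⟩ := limit_ode (isCompact_closedBall (0 : E × E) R) (FF hq hp θ θ')
    (FF_continuous H G) N hNt (fun j => lt_of_lt_of_le (Nat.succ_pos j) (hN j)) T (fun j => 1 / ((j:ℝ) + 1))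
    hT1 hT (fun j => by positivity) (fun j => by
      rw [div_le_one (by positivity)]
      linarith [(Nat.cast_nonneg j : (0:ℝ) ≤ j)]) tendsto_one_div_add_atTop_nhds_zero_nat z hz1 hz2 hz3
  have hX : ∀ t, HasDerivAt (fun t => (Z t).1) (hp ((Z t).1, (Z t).2 - θ (Z t).1)) t := fun t => by
    have := (hZd t).fst
    exact this
  have hP : ∀ t, HasDerivAt (fun t => (Z t).2) (-hq ((Z t).1, (Z t).2 - θ (Z t).1) +
      ContinuousLinearMap.adjoint (θ' (Z t).1) (hp ((Z t).1, (Z t).2 - θ (Z t).1))) t := fun t => by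
    have := (hZd t).snd
    exact this
  refine ⟨S, hS, fun t => (Z t).1, fun t => (Z t).2, fun t => by simp only [hZp t],
    fun t => by simp only [hZp t], hX, hP, ?_⟩
  set g : E × E → ℝ := fun w => h (w.1, w.2 - θ w.1) with hg
  have hgc : Continuous g := by
    have := H.cont
    have := G.cont
    fun_prop
  have hconst : ∀ t s, g (Z t) = g (Z s) := by
    have hd : ∀ t, HasDerivAt (fun t => g (Z t)) 0 t := by
      intro t
      have h1 := ((hP t).sub ((G.hasD (Z t).1).comp_hasDerivAt t (hX t)))
      have h2 := (H.hasD ((Z t).1, (Z t).2 - θ (Z t).1)).comp_hasDerivAt t ((hX t).prodMk h1)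
      refine h2.congr_deriv ?_
      simp only [pairL_apply, inner_sub_right, inner_add_right, inner_neg_right,
        ContinuousLinearMap.adjoint_inner_right]
      rw [real_inner_comm (hq _), real_inner_comm (hp _) (θ' _ _)]
      ring
    exact fun t s => is_const_of_deriv_eq_zero (fun t => (hd t).differentiableAt) (fun t => (hd t).deriv) t s
  obtain ⟨t1, ht1⟩ := hZg g hgc k hz4
  obtain ⟨t2, ht2⟩ := hZg (fun w => -g w) hgc.neg (-k) (fun j => by
    obtain ⟨i, hi⟩ := hz5 j
    exact ⟨i, by simp only [hg]; linarith⟩)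
  intro t
  change g (Z t) = k
  have e1 := hconst t t1
  have e2 := hconst t t2
  linarith

end disc
end MT

end ModuleP

section ModuleR
open Filter Topology Set MeasureTheory
open scoped RealInnerProductSpace ENNReal
set_option linter.unusedSectionVars false
set_option linter.unusedVariables false
namespace MT

variable {E : Type*} [NormedAddCommGroup E] [InnerProductSpace ℝ E]
section disc
variable [FiniteDimensional ℝ E]
variable {Λ : AddSubgroup E} {h : E × E → ℝ} {hq hp : E × E → E} {C : ℝ}
variable {θ : E → E} {θ' : E → E →L[ℝ] E} {K : ℝ}

lemma ae_orbit (H : Tame Λ h hq hp C) (G : Gauge Λ θ θ' K) {Q : Set E} (hQ : IsCompact Q)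
    (hQΛ : ∀ x, ∃ m ∈ Λ, x + m ∈ Q) {a b c : ℝ} (hc : 0 < c) (hab : a < b)
    (hsm : ∀ q0, ∃ p0, ∀ q p, ‖q - q0‖ ≤ c → ‖p - p0‖ ≤ c → h (q, p) ≤ a)
    {Ts V : ℝ} (hTs : 0 < Ts) (hV : 0 ≤ V)
    (hneg : ∀ R : ℕ, ∃ N, R ≤ N ∧ ∃ _ : NeZero N, ∃ x : ZMod N → E,
      act h θ b x Ts < 0 ∧ ∀ i, N * ‖dx x i‖ ≤ V) :
    ∀ᵐ k ∂(volume : Measure ℝ), k ∈ Ioo a b → HasOrbit h hq hp θ θ' k := by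
  obtain ⟨T1, hT1, κ, hκ, U, hU⟩ := disc_main H G hQ hQΛ hc hab hsm hTs hV
  choose N hN hN0 x hx hx2 using hneg
  have hU' : ∀ j, ∃ cf : ℝ → ℝ, Monotone cf ∧ (∀ k ∈ Icc a b, 0 ≤ cf k ∧ cf k ≤ U) ∧
        ∀ k ∈ Ioo a b, ∀ M, 0 ≤ M → (∀ᶠ δ in 𝓝[>] (0:ℝ), cf (k + δ) ≤ cf k + M * δ) →
        ∀ ε > 0, ∃ y : (ZMod (N j) → E) × ℝ, T1 ≤ y.2 ∧ y.2 ≤ M + 2 ∧ 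
          κ * (letI := hN0 j; len y.1) ≤ y.2 ∧ (letI := hN0 j; gn h hq θ θ' k y) < ε := by
    intro j
    letI := hN0 j
    exact hU (N j) (x j) (hx j) (hx2 j)
  choose cf hcm hcb hcy using hU'
  filter_upwards [ae_slope cf hcm hcb] with k hk hkab
  obtain ⟨M, hM, hf⟩ := hk hkab
  refine orbit_of_approx H G hQ hQΛ (T2 := M + 2) k hT1 hκ ?_
  intro n ε hε
  obtain ⟨j, hj, hjs⟩ := frequently_atTop.1 hf n
  obtain ⟨y, h1, h2, h3, h4⟩ := hcy j k hkab M hM hjs (ε (N j)) (hε _ (by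
    have := (hN0 j).ne
    positivity))
  exact ⟨N j, hj.trans (hN j), hN0 j, y, h1, h2, h3, h4⟩

end disc
end MT

end ModuleR

section ModuleM1
open Filter Topology Set MeasureTheory
open scoped RealInnerProductSpace ENNReal
set_option linter.unusedSectionVars false
set_option linter.unusedVariables false
namespace MT

variable {E : Type*} [NormedAddCommGroup E] [InnerProductSpace ℝ E]
section mane
variable [FiniteDimensional ℝ E]
variable {Λ : AddSubgroup E} {h : E × E → ℝ} {hq hp : E × E → E} {C : ℝ}
variable {θ : E → E} {θ' : E → E →L[ℝ] E} {K : ℝ}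

/-- Cost of the step `x → x + d` in time `τ`. -/
noncomputable def gc (h : E × E → ℝ) (θ : E → E) (b D τ : ℝ) (x d : E) : ℝ :=
  τ * (Lag h (x, τ⁻¹ • d) + b) + ⟪θ x, d⟫ + D * ‖d‖ * (τ + ‖d‖)

lemma gc_refine (H : Tame Λ h hq hp C) (G : Gauge Λ θ θ' K) {b τ : ℝ} (hτ : 0 < τ) {R : ℕ}
    {r : ℕ} (hr : r < R) (x d : E) :
    gc h θ b (C + K) (τ / R) (x + ((r : ℝ) / R) • d) ((R : ℝ)⁻¹ • d) ≤
      (1 / R) * gc h θ b (C + K) τ x d := by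
  have hR : (0 : ℝ) < R := Nat.cast_pos.2 (by omega)
  have hC := H.Cpos
  have hK := G.nonneg
  unfold gc
  have e1 : (τ / R)⁻¹ • (R : ℝ)⁻¹ • d = τ⁻¹ • d := by
    rw [smul_smul]; congr 1; field_simp
  rw [e1]
  have hn : ‖(R : ℝ)⁻¹ • d‖ = ‖d‖ / R := by
    rw [norm_smul, norm_inv, Real.norm_of_nonneg hR.le]; ring
  have h0 : (0:ℝ) ≤ (r:ℝ) / R := by positivity
  have hd : ‖x + ((r : ℝ) / R) • d - x‖ = (r : ℝ) / R * ‖d‖ := by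
    rw [add_sub_cancel_left, norm_smul, Real.norm_of_nonneg h0]
  have h1 := H.lag_lip (x + ((r : ℝ) / R) • d) x (τ⁻¹ • d)
  have h2 := G.lip (x + ((r : ℝ) / R) • d) x
  rw [hd] at h1 h2
  have h3 : ⟪θ (x + ((r : ℝ) / R) • d), d⟫ ≤ ⟪θ x, d⟫ + K * (r / R * ‖d‖) * ‖d‖ := by
    have := real_inner_le_norm (θ (x + ((r : ℝ) / R) • d) - θ x) d
    rw [inner_sub_left] at this
    have h4 := mul_le_mul_of_nonneg_right h2 (norm_nonneg d)
    linarith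
  rw [hn, inner_smul_right]
  have hrR : (r : ℝ) + 1 ≤ R := by exact_mod_cast hr
  have h5 : (r : ℝ) / R + 1 / R ≤ 1 := by
    rw [← add_div, div_le_one hR]; exact hrR
  have hdn := norm_nonneg d
  have h6 : τ / R * (Lag h (x + ((r : ℝ) / R) • d, τ⁻¹ • d) + b) ≤
      τ / R * (Lag h (x, τ⁻¹ • d) + C * (r / R * ‖d‖) + b) :=
    mul_le_mul_of_nonneg_left (by linarith) (by positivity)
  have h7 : (R : ℝ)⁻¹ * ⟪θ (x + ((r : ℝ) / R) • d), d⟫ ≤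
      (R : ℝ)⁻¹ * (⟪θ x, d⟫ + K * (r / R * ‖d‖) * ‖d‖) :=
    mul_le_mul_of_nonneg_left h3 (by positivity)
  refine (add_le_add_left (add_le_add h6 h7) _).trans ?_
  have h8 : (C * τ * ‖d‖ + K * ‖d‖ * ‖d‖) * (r / R) ≤ (C + K) * ‖d‖ * (τ + ‖d‖) * (r / R) := by
    refine mul_le_mul_of_nonneg_right ?_ h0
    have : 0 ≤ C * ‖d‖ * ‖d‖ + K * τ * ‖d‖ := by positivity
    nlinarith
  have h9 : (C + K) * ‖d‖ * (τ + ‖d‖) * (r / R + 1 / R) ≤ (C + K) * ‖d‖ * (τ + ‖d‖) * 1 :=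
    mul_le_mul_of_nonneg_left h5 (by positivity)
  have h10 : (R:ℝ)⁻¹ * ((C * τ * ‖d‖ + K * ‖d‖ * ‖d‖) * (r / R) + (C + K) * ‖d‖ * (τ + ‖d‖) * (1 / R)) ≤
      (R:ℝ)⁻¹ * ((C + K) * ‖d‖ * (τ + ‖d‖)) :=
    mul_le_mul_of_nonneg_left (by linarith) (by positivity)
  have e2 : τ / R * (Lag h (x, τ⁻¹ • d) + C * (r / R * ‖d‖) + b) +
      (R : ℝ)⁻¹ * (⟪θ x, d⟫ + K * (r / R * ‖d‖) * ‖d‖) + (C + K) * (‖d‖ / R) * (τ / R + ‖d‖ / R) =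
      (R:ℝ)⁻¹ * (τ * (Lag h (x, τ⁻¹ • d) + b) + ⟪θ x, d⟫) +
      (R:ℝ)⁻¹ * ((C * τ * ‖d‖ + K * ‖d‖ * ‖d‖) * (r / R) + (C + K) * ‖d‖ * (τ + ‖d‖) * (1 / R)) := by
    field_simp
    ring
  rw [e2]
  have e3 : 1 / (R:ℝ) * (τ * (Lag h (x, τ⁻¹ • d) + b) + ⟪θ x, d⟫ + (C + K) * ‖d‖ * (τ + ‖d‖)) =
      (R:ℝ)⁻¹ * (τ * (Lag h (x, τ⁻¹ • d) + b) + ⟪θ x, d⟫) + (R:ℝ)⁻¹ * ((C + K) * ‖d‖ * (τ + ‖d‖)) := by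
    ring
  rw [e3]
  linarith

/-- Cost of a chain. -/
noncomputable def chc (h : E × E → ℝ) (θ : E → E) (b D τ : ℝ) (N : ℕ) (x : ℕ → E) : ℝ :=
  ∑ i ∈ Finset.range N, gc h θ b D τ (x i) (x (i + 1) - x i)

/-- Refined chain. -/
noncomputable def rch (R : ℕ) (x : ℕ → E) (j : ℕ) : E :=
  x (j / R) + (((j % R : ℕ) : ℝ) / R) • (x (j / R + 1) - x (j / R))

lemma rch_eq {R : ℕ} (x : ℕ → E) (i : ℕ) {r : ℕ} (hr : r < R) :
    rch R x (i * R + r) = x i + ((r : ℝ) / R) • (x (i + 1) - x i) := by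
  have h1 : (i * R + r) / R = i := by
    rw [mul_comm, Nat.mul_add_div (by omega), Nat.div_eq_of_lt hr, add_zero]
  have h2 : (i * R + r) % R = r := by
    rw [mul_comm, Nat.mul_add_mod, Nat.mod_eq_of_lt hr]
  unfold rch
  rw [h1, h2]

lemma rch_mul {R : ℕ} (hR : 0 < R) (x : ℕ → E) (i : ℕ) : rch R x (i * R) = x i := by
  have := rch_eq x i hR
  simpa using this

lemma rch_step {R : ℕ} (x : ℕ → E) (i : ℕ) {r : ℕ} (hr : r < R) :
    rch R x (i * R + r + 1) - rch R x (i * R + r) = (R : ℝ)⁻¹ • (x (i + 1) - x i) := by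
  have hR : (R : ℝ) ≠ 0 := Nat.cast_ne_zero.2 (by omega)
  have h1 : rch R x (i * R + r + 1) = x i + (((r : ℝ) + 1) / R) • (x (i + 1) - x i) := by
    rcases lt_or_eq_of_le (Nat.succ_le_of_lt hr) with h | h
    · have := rch_eq x i h
      rw [Nat.succ_eq_add_one, ← add_assoc] at this
      rw [this]
      push_cast
      rfl
    · have h2 : i * R + r + 1 = (i + 1) * R := by rw [add_mul, one_mul, ← h, Nat.succ_eq_add_one]; ring
      rw [h2, rch_mul (by omega)]
      have h3 : (r : ℝ) + 1 = R := by exact_mod_cast h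
      rw [h3, div_self hR, one_smul]
      abel
  rw [h1, rch_eq x i hr, add_sub_add_left_eq_sub, ← sub_smul]
  congr 1
  field_simp
  ring

lemma sum_range_mul_ (F : ℕ → ℝ) (N R : ℕ) :
    ∑ j ∈ Finset.range (N * R), F j = ∑ i ∈ Finset.range N, ∑ r ∈ Finset.range R, F (i * R + r) := by
  induction N with
  | zero => simp
  | succ N ih => rw [add_mul, one_mul, Finset.sum_range_add, ih, Finset.sum_range_succ]

lemma chc_refine (H : Tame Λ h hq hp C) (G : Gauge Λ θ θ' K) {b τ : ℝ} (hτ : 0 < τ) {R : ℕ}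
    (hR : 0 < R) (N : ℕ) (x : ℕ → E) :
    chc h θ b (C + K) (τ / R) (N * R) (rch R x) ≤ chc h θ b (C + K) τ N x := by
  unfold chc
  rw [sum_range_mul_]
  refine Finset.sum_le_sum fun i _ => ?_
  have hR' : (R : ℝ) ≠ 0 := Nat.cast_ne_zero.2 (by omega)
  have h1 : ∀ r ∈ Finset.range R, gc h θ b (C + K) (τ / R) (rch R x (i * R + r))
      (rch R x (i * R + r + 1) - rch R x (i * R + r)) ≤
      1 / R * gc h θ b (C + K) τ (x i) (x (i + 1) - x i) := by
    intro r hr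
    rw [rch_step x i (Finset.mem_range.1 hr), rch_eq x i (Finset.mem_range.1 hr)]
    exact gc_refine H G hτ (Finset.mem_range.1 hr) _ _
  refine (Finset.sum_le_sum h1).trans (le_of_eq ?_)
  rw [Finset.sum_const, Finset.card_range, nsmul_eq_mul]
  field_simp

/-- `y` can be reached from `x` at cost at most `r`. -/
def Reach (h : E × E → ℝ) (θ : E → E) (b D : ℝ) (x y : E) (r : ℝ) : Prop :=
  ∃ M N : ℕ, 0 < M ∧ 0 < N ∧ ∃ c : ℕ → E, c 0 = x ∧ c N = y ∧ chc h θ b D (1 / M) N c ≤ r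

lemma Reach.refine (H : Tame Λ h hq hp C) (G : Gauge Λ θ θ' K) {b r : ℝ} {M N : ℕ} (hM : 0 < M)
    {c : ℕ → E} (hc : chc h θ b (C + K) (1 / M) N c ≤ r) {R : ℕ} (hR : 0 < R) :
    chc h θ b (C + K) (1 / ((M * R : ℕ) : ℝ)) (N * R) (rch R c) ≤ r := by
  have hM' : (0:ℝ) < M := Nat.cast_pos.2 hM
  have := chc_refine (b := b) H G (τ := 1 / M) (by positivity) hR N c
  rw [div_div] at this
  push_cast
  exact this.trans hc

lemma Reach.trans (H : Tame Λ h hq hp C) (G : Gauge Λ θ θ' K) {b r s : ℝ} {x y z : E}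
    (h1 : Reach h θ b (C + K) x y r) (h2 : Reach h θ b (C + K) y z s) :
    Reach h θ b (C + K) x z (r + s) := by
  obtain ⟨M1, N1, hM1, hN1, c1, hc1, hc1', hr⟩ := h1
  obtain ⟨M2, N2, hM2, hN2, c2, hc2, hc2', hs⟩ := h2
  have hr' := Reach.refine H G hM1 hr hM2
  have hs' := Reach.refine H G hM2 hs hM1
  rw [mul_comm M2 M1] at hs'
  set d1 := rch M2 c1
  set d2 := rch M1 c2
  have e1 : d1 0 = x := by rw [← hc1, ← rch_mul hM2 c1 0, zero_mul]
  have e2 : d1 (N1 * M2) = y := (rch_mul hM2 c1 N1).trans hc1'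
  have e3 : d2 0 = y := by rw [← hc2, ← rch_mul hM1 c2 0, zero_mul]
  have e4 : d2 (N2 * M1) = z := (rch_mul hM1 c2 N2).trans hc2'
  set n := N1 * M2
  set m := N2 * M1
  refine ⟨M1 * M2, n + m, by positivity, by positivity,
    fun i => if i ≤ n then d1 i else d2 (i - n), by simp [e1], ?_, ?_⟩
  · have hm : 0 < m := by positivity
    simp [hm, e4, show ¬ (n + m ≤ n) by omega]
  · unfold chc at hr' hs' ⊢
    rw [Finset.sum_range_add]
    refine add_le_add ?_ ?_
    · refine le_trans (le_of_eq ?_) hr'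
      refine Finset.sum_congr rfl fun i hi => ?_
      have := Finset.mem_range.1 hi
      simp only [show i ≤ n by omega, show i + 1 ≤ n by omega, if_true]
    · refine le_trans (le_of_eq ?_) hs'
      refine Finset.sum_congr rfl fun i hi => ?_
      simp only [show ¬ (n + i + 1 ≤ n) by omega, if_false, show n + i + 1 - n = i + 1 by omega]
      rcases Nat.eq_zero_or_pos i with h0 | h0
      · subst h0
        simp [e2, e3]
      · simp only [show ¬ (n + i ≤ n) by omega, if_false, show n + i - n = i by omega]

lemma Reach.single {b D : ℝ} {M : ℕ} (hM : 0 < M) (x d : E) :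
    Reach h θ b D x (x + d) (gc h θ b D (1 / M) x d) := by
  refine ⟨M, 1, hM, one_pos, fun i => x + (i : ℝ) • d, by simp, by simp, ?_⟩
  simp [chc]

/-- negative closed chains give negative discrete loops. -/
lemma loops_of_reach (H : Tame Λ h hq hp C) (G : Gauge Λ θ θ' K) {b r : ℝ} {x0 : E}
    (hre : Reach h θ b (C + K) x0 x0 r) (hr : r < 0) :
    ∃ Ts V : ℝ, 0 < Ts ∧ 0 ≤ V ∧ ∀ R : ℕ, ∃ N, R ≤ N ∧ ∃ _ : NeZero N, ∃ x : ZMod N → E,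
      act h θ b x Ts < 0 ∧ ∀ i, N * ‖dx x i‖ ≤ V := by
  obtain ⟨M, N, hM, hN, c, hc, hc', hcr⟩ := hre
  have hM' : (0:ℝ) < M := Nat.cast_pos.2 hM
  have hN' : (0:ℝ) < N := Nat.cast_pos.2 hN
  set W := ∑ i ∈ Finset.range N, ‖c (i + 1) - c i‖ with hW
  refine ⟨N / M, N * W, by positivity, by positivity, fun R0 => ?_⟩
  set R := R0 + 1 with hR
  have hRp : 0 < R := by omega
  have hR' : (0:ℝ) < R := Nat.cast_pos.2 hRp
  have h1 := Reach.refine H G hM hcr hRp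
  set d := rch R c with hd
  have hn0 : 0 < N * R := by positivity
  have e0 : d 0 = d (N * R) := by
    rw [hd, rch_mul hRp, hc', ← hc]
    have := rch_mul hRp c 0
    rw [zero_mul] at this
    exact this
  have inst : NeZero (N * R) := ⟨hn0.ne'⟩
  refine ⟨N * R, ?_, inst, fun i => d i.val, ?_, ?_⟩
  · calc R0 ≤ 1 * R := by omega
      _ ≤ N * R := Nat.mul_le_mul_right _ hN
  · have hv : ∀ l ∈ Finset.range (N * R), dx (fun i : ZMod (N * R) => d i.val) (l : ZMod (N * R)) =
        d (l + 1) - d l := by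
      intro l hl
      have hl' := Finset.mem_range.1 hl
      unfold dx
      have e1 : ((l : ZMod (N * R))).val = l := ZMod.val_cast_of_lt hl'
      rcases lt_or_eq_of_le (Nat.succ_le_of_lt hl') with h2 | h2
      · have e2 : ((l : ZMod (N * R)) + 1).val = l + 1 := by
          have := ZMod.val_cast_of_lt (n := N * R) (a := l + 1) h2
          push_cast at this
          exact this
        simp only [e1, e2]
      · have e2 : ((l : ZMod (N * R)) + 1).val = 0 := by
          have h3 : ((l : ZMod (N * R)) + 1) = ((l + 1 : ℕ) : ZMod (N * R)) := by push_cast; rfl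
          rw [h3, show l + 1 = N * R from h2, ZMod.natCast_self, ZMod.val_zero]
        simp only [e1, e2]
        rw [e0, show l + 1 = N * R from h2]
    refine lt_of_le_of_lt (le_trans ?_ h1) hr
    have hb : b * ((N:ℝ) / M) = ∑ i : ZMod (N * R), b * (1 / ((M * R : ℕ) : ℝ)) := by
      rw [Finset.sum_const, Finset.card_univ, ZMod.card, nsmul_eq_mul]
      push_cast
      field_simp
    unfold act mag chc
    rw [hb, ← Finset.sum_add_distrib, ← Finset.sum_add_distrib, ← sum_range_zmod]
    refine Finset.sum_le_sum fun l hl => ?_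
    have e1 : ((l : ZMod (N * R))).val = l := ZMod.val_cast_of_lt (Finset.mem_range.1 hl)
    simp only [vel, hv l hl, e1]
    unfold gc
    have e2 : (N:ℝ) / M / ((N * R : ℕ) : ℝ) = 1 / ((M * R : ℕ) : ℝ) := by
      push_cast
      field_simp
    have e3 : ((N * R : ℕ) : ℝ) / ((N:ℝ) / M) = (1 / ((M * R : ℕ) : ℝ))⁻¹ := by
      push_cast
      field_simp
    rw [e2, e3]
    have h5 : 0 ≤ (C + K) * ‖d (l + 1) - d l‖ * (1 / ((M * R : ℕ) : ℝ) + ‖d (l + 1) - d l‖) := by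
      have := H.Cpos
      have := G.nonneg
      positivity
    linarith
  · have key : ∀ l < N * R, ‖d (l + 1) - d l‖ ≤ (R:ℝ)⁻¹ * W := by
      intro l hl
      have h3 : l / R * R + l % R = l := Nat.div_add_mod' l R
      have h4 := rch_step c (l / R) (Nat.mod_lt l hRp)
      rw [h3] at h4
      rw [hd, h4, norm_smul, norm_inv, Real.norm_of_nonneg hR'.le]
      refine mul_le_mul_of_nonneg_left ?_ (by positivity)
      have hi : l / R < N := Nat.div_lt_of_lt_mul (by rwa [mul_comm])
      exact Finset.single_le_sum (f := fun i => ‖c (i + 1) - c i‖) (fun i _ => norm_nonneg _) (Finset.mem_range.2 hi)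
    intro i
    have e1 : ∃ l < N * R, dx (fun i : ZMod (N * R) => d i.val) i = d (l + 1) - d l := by
      refine ⟨i.val, ZMod.val_lt i, ?_⟩
      unfold dx
      rcases lt_or_eq_of_le (Nat.succ_le_of_lt (ZMod.val_lt i)) with h2 | h2
      · have e2 : (i + 1).val = i.val + 1 := by
          have := ZMod.val_cast_of_lt (n := N * R) (a := i.val + 1) h2
          push_cast at this
          rwa [ZMod.natCast_zmod_val] at this
        simp only [e2]
      · have e2 : (i + 1).val = 0 := by
          have h3 : (i + 1) = ((i.val + 1 : ℕ) : ZMod (N * R)) := by push_cast; rw [ZMod.natCast_zmod_val]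
          rw [h3, show i.val + 1 = N * R from h2, ZMod.natCast_self, ZMod.val_zero]
        simp only [e2]
        rw [e0, show i.val + 1 = N * R from h2]
    obtain ⟨l, hl, e⟩ := e1
    rw [e]
    calc ((N * R : ℕ) : ℝ) * ‖d (l + 1) - d l‖ ≤ ((N * R : ℕ) : ℝ) * ((R:ℝ)⁻¹ * W) :=
          mul_le_mul_of_nonneg_left (key l hl) (by positivity)
      _ = N * W := by push_cast; field_simp

end mane
end MT

end ModuleM1

section ModuleM2
open Filter Topology Set MeasureTheory
open scoped RealInnerProductSpace ENNReal Convolution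
set_option linter.unusedSectionVars false
set_option linter.unusedVariables false
namespace MT

variable {E : Type*} [NormedAddCommGroup E] [InnerProductSpace ℝ E]
section mane
variable [FiniteDimensional ℝ E]
variable {Λ : AddSubgroup E} {h : E × E → ℝ} {hq hp : E × E → E} {C : ℝ}
variable {θ : E → E} {θ' : E → E →L[ℝ] E} {K : ℝ}

lemma subsol (H : Tame Λ h hq hp C) (G : Gauge Λ θ θ' K) {b : ℝ}
    (hno : ∀ x r, Reach h θ b (C + K) x x r → 0 ≤ r) :
    ∃ u : E → ℝ, Continuous u ∧ ∀ M : ℕ, 0 < M → ∀ x d,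
      u (x + d) ≤ u x + gc h θ b (C + K) (1 / M) x d := by
  set S : E → Set ℝ := fun y => {r | Reach h θ b (C + K) 0 y r} with hS
  have hne : ∀ y, (S y).Nonempty := fun y =>
    ⟨gc h θ b (C + K) (1 / (1:ℕ)) 0 y, by
      have := Reach.single (h := h) (θ := θ) (b := b) (D := C + K) one_pos 0 y
      rwa [zero_add] at this⟩
  have hbd : ∀ y, BddBelow (S y) := by
    intro y
    have h1 := Reach.single (h := h) (θ := θ) (b := b) (D := C + K) one_pos y (-y)
    rw [add_neg_cancel] at h1
    refine ⟨-gc h θ b (C + K) (1 / (1:ℕ)) y (-y), fun r hr => ?_⟩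
    have := hno 0 _ (Reach.trans H G hr h1)
    linarith
  have key : ∀ M : ℕ, 0 < M → ∀ x d,
      sInf (S (x + d)) ≤ sInf (S x) + gc h θ b (C + K) (1 / M) x d := by
    intro M hM x d
    rw [← sub_le_iff_le_add]
    refine le_csInf (hne x) fun r hr => ?_
    rw [sub_le_iff_le_add]
    exact csInf_le (hbd _) (Reach.trans H G hr (Reach.single hM x d))
  refine ⟨fun y => sInf (S y), ?_, key⟩
  rw [continuous_iff_continuousAt]
  intro x
  rw [Metric.continuousAt_iff']
  intro ε hε
  obtain ⟨M, hM0, hM⟩ : ∃ M : ℕ, 0 < M ∧ (1 / (M:ℝ)) * (Lag h (x, 0) + b) < ε := by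
    have h1 : Tendsto (fun n : ℕ => (1 / (n:ℝ)) * (Lag h (x, 0) + b)) atTop (𝓝 (0 * (Lag h (x, 0) + b))) :=
      tendsto_one_div_atTop_nhds_zero_nat.mul_const _
    rw [zero_mul] at h1
    obtain ⟨M, h2, h3⟩ := ((h1.eventually_lt_const hε).and (eventually_gt_atTop 0)).exists
    exact ⟨M, h3, h2⟩
  have hL := H.lag_continuous
  have hθ := G.cont
  have hA : Continuous fun y => gc h θ b (C + K) (1 / M) x (y - x) := by
    unfold gc
    fun_prop
  have hB : Continuous fun y => gc h θ b (C + K) (1 / M) y (x - y) := by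
    unfold gc
    fun_prop
  have hA0 : gc h θ b (C + K) (1 / M) x (x - x) < ε := by
    simp only [gc, sub_self, smul_zero, inner_zero_right, norm_zero]
    linarith
  filter_upwards [(hA.tendsto x).eventually_lt_const hA0, (hB.tendsto x).eventually_lt_const hA0] with y h1 h2
  have k1 := key M hM0 x (y - x)
  have k2 := key M hM0 y (x - y)
  rw [add_sub_cancel] at k1 k2
  rw [Real.dist_eq, abs_sub_lt_iff]
  constructor <;> linarith

lemma mollify [MeasurableSpace E] [BorelSpace E] (H : Tame Λ h hq hp C) (G : Gauge Λ θ θ' K) {b : ℝ}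
    {u : E → ℝ} (hu : Continuous u) (hI : ∀ M : ℕ, 0 < M → ∀ x d,
      u (x + d) ≤ u x + gc h θ b (C + K) (1 / M) x d) {ρ : ℝ} (hρ : 0 < ρ) :
    ∃ w : E → ℝ, ContDiff ℝ (⊤ : ℕ∞) w ∧ ∀ x v,
      fderiv ℝ w x v ≤ Lag h (x, v) + b + ⟪θ x, v⟫ + ρ * (C + K * ‖v‖) := by
  set μ : Measure E := Measure.addHaar
  let φ : ContDiffBump (0 : E) := ⟨ρ / 2, ρ, by positivity, by linarith⟩
  set f := φ.normed μ with hf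
  have hfc : Continuous f := φ.continuous_normed
  have hfs : HasCompactSupport f := φ.hasCompactSupport_normed
  have hC := H.Cpos
  have hK := G.nonneg
  have hw : ContDiff ℝ (⊤ : ℕ∞) (f ⋆[ContinuousLinearMap.lsmul ℝ ℝ, μ] u) :=
    hfs.contDiff_convolution_left _ φ.contDiff_normed hu.locallyIntegrable
  set w := f ⋆[ContinuousLinearMap.lsmul ℝ ℝ, μ] u with hwd
  have hwx : ∀ x, w x = ∫ t, f t * u (x - t) ∂μ := fun x => rfl
  have hint : ∀ g : E → ℝ, Continuous g → Integrable (fun t => f t * g t) μ := fun g hg =>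
    (hfc.mul hg).integrable_of_hasCompactSupport hfs.mul_right
  refine ⟨w, hw, fun x v => ?_⟩
  set c := Lag h (x, v) + b + ⟪θ x, v⟫ + ρ * (C + K * ‖v‖) with hc
  have hd : HasFDerivAt w (fderiv ℝ w x) x :=
    ((hw.differentiable (by simp)) x).hasFDerivAt
  have h1 := (hd.lim_real v).comp (tendsto_natCast_atTop_atTop (R := ℝ))
  have h2 : Tendsto (fun M : ℕ => c + (C + K) * ‖v‖ * (1 + ‖v‖) * (1 / (M:ℝ))) atTop (𝓝 (c + (C + K) * ‖v‖ * (1 + ‖v‖) * 0)) :=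
    tendsto_const_nhds.add (tendsto_one_div_atTop_nhds_zero_nat.const_mul _)
  rw [mul_zero, add_zero] at h2
  refine le_of_tendsto_of_tendsto h1 h2 ?_
  filter_upwards [eventually_gt_atTop 0] with M hM
  have hM' : (0:ℝ) < M := Nat.cast_pos.2 hM
  simp only [Function.comp_apply, smul_eq_mul]
  have h3 : w (x + (M:ℝ)⁻¹ • v) - w x ≤ (1 / M) * (c + (C + K) * ‖v‖ * (1 + ‖v‖) * (1 / (M:ℝ))) := by
    rw [hwx, hwx, ← integral_sub (hint _ (by fun_prop)) (hint _ (by fun_prop))]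
    have h4 : (1 / M) * (c + (C + K) * ‖v‖ * (1 + ‖v‖) * (1 / (M:ℝ))) =
        ∫ t, f t * ((1 / M) * (c + (C + K) * ‖v‖ * (1 + ‖v‖) * (1 / (M:ℝ)))) ∂μ := by
      rw [integral_mul_const, hf, φ.integral_normed, one_mul]
    rw [h4]
    refine integral_mono ((hint _ (by fun_prop)).sub (hint _ (by fun_prop))) (hint _ continuous_const) fun t => ?_
    have hf0 : 0 ≤ f t := φ.nonneg_normed t
    simp only
    rw [← mul_sub]
    by_cases ht : ‖t‖ < ρ
    · refine mul_le_mul_of_nonneg_left ?_ hf0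
      have h5 := hI M hM (x - t) ((M:ℝ)⁻¹ • v)
      have e1 : x + (M:ℝ)⁻¹ • v - t = x - t + (M:ℝ)⁻¹ • v := by abel
      rw [e1]
      have e2 : (1 / (M:ℝ))⁻¹ • (M:ℝ)⁻¹ • v = v := by
        rw [smul_smul, one_div, inv_inv, mul_inv_cancel₀ hM'.ne', one_smul]
      have h6 := H.lag_lip (x - t) x v
      have h7 := G.lip (x - t) x
      rw [sub_sub_cancel_left, norm_neg] at h6 h7
      have h8 := real_inner_le_norm (θ (x - t) - θ x) v
      rw [inner_sub_left] at h8
      have h9 : ‖θ (x - t) - θ x‖ * ‖v‖ ≤ K * ρ * ‖v‖ :=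
        mul_le_mul_of_nonneg_right (h7.trans (mul_le_mul_of_nonneg_left ht.le hK)) (norm_nonneg _)
      have h10 : C * ‖t‖ ≤ C * ρ := mul_le_mul_of_nonneg_left ht.le (by linarith)
      unfold gc at h5
      rw [e2, inner_smul_right, norm_smul, norm_inv, Real.norm_of_nonneg hM'.le] at h5
      have h11 : (1 / (M:ℝ)) * (Lag h (x - t, v) + b + ⟪θ (x - t), v⟫) ≤ (1 / M) * c :=
        mul_le_mul_of_nonneg_left (by rw [hc]; linarith) (by positivity)
      have e3 : (C + K) * ((M:ℝ)⁻¹ * ‖v‖) * (1 / M + (M:ℝ)⁻¹ * ‖v‖) =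
        1 / M * ((C + K) * ‖v‖ * (1 + ‖v‖) * (1 / (M:ℝ))) := by
        field_simp
      rw [e3] at h5
      have e4 : (M:ℝ)⁻¹ = 1 / M := by ring
      rw [e4] at h5 ⊢
      rw [mul_add (1 / (M:ℝ)) c]
      linarith
    · have : f t = 0 := by
        have h5 : t ∉ Function.support f := by
          rw [hf, φ.support_normed_eq]
          simpa using ht
        simpa using h5
      rw [this, zero_mul, zero_mul]
  calc (M:ℝ) * (w (x + (M:ℝ)⁻¹ • v) - w x) ≤ M * ((1 / M) * (c + (C + K) * ‖v‖ * (1 + ‖v‖) * (1 / (M:ℝ)))) :=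
      mul_le_mul_of_nonneg_left h3 hM'.le
    _ = _ := by field_simp

lemma mane_dichotomy [MeasurableSpace E] [BorelSpace E] (H : Tame Λ h hq hp C) (G : Gauge Λ θ θ' K)
    {b b' : ℝ} (hb : b < b') :
    (∃ x r, r < 0 ∧ Reach h θ b (C + K) x x r) ∨
    ∃ w : E → ℝ, ContDiff ℝ (⊤ : ℕ∞) w ∧ ∀ q, h (q, gradient w q - θ q) ≤ b' := by
  by_cases hno : ∀ x r, Reach h θ b (C + K) x x r → 0 ≤ r
  swap
  · push Not at hno
    obtain ⟨x, r, h1, h2⟩ := hno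
    exact Or.inl ⟨x, r, h2, h1⟩
  right
  obtain ⟨u, hu, hI⟩ := subsol H G hno
  have hC := H.Cpos
  have hK := G.nonneg
  obtain ⟨ρ, hρ, hρ1⟩ : ∃ ρ : ℝ, 0 < ρ ∧ b + ρ * (C + K * (C * (b' + C))) < b' ∧ ρ * K * C < 1 := by
    have h1 : Tendsto (fun ρ : ℝ => b + ρ * (C + K * (C * (b' + C)))) (𝓝[>] 0) (𝓝 (b + 0 * (C + K * (C * (b' + C))))) :=
      (Continuous.tendsto (by fun_prop) _).mono_left nhdsWithin_le_nhds
    have h2 : Tendsto (fun ρ : ℝ => ρ * K * C) (𝓝[>] 0) (𝓝 (0 * K * C)) :=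
      (Continuous.tendsto (by fun_prop) _).mono_left nhdsWithin_le_nhds
    rw [zero_mul, add_zero] at h1
    rw [zero_mul, zero_mul] at h2
    obtain ⟨ρ, ⟨h3, h4⟩, h5⟩ := (((h1.eventually_lt_const hb).and (h2.eventually_lt_const one_pos)).and self_mem_nhdsWithin).exists
    exact ⟨ρ, h5, h3, h4⟩
  obtain ⟨w, hw, hwd⟩ := mollify H G hu hI hρ
  refine ⟨w, hw, fun q => ?_⟩
  set p := gradient w q - θ q with hp'
  have hg : HasGradientAt w (gradient w q) q := ((hw.differentiable (by simp)) q).hasGradientAt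
  have h1 := hwd q (hp (q, p))
  have h2 : fderiv ℝ w q (hp (q, p)) = ⟪gradient w q, hp (q, p)⟫ := by
    rw [hg.hasFDerivAt.fderiv]
    simp
  have h3 : pst h (q, hp (q, p)) = p := H.pst_eq (H.leg_of_hp rfl)
  have h4 := Tame.lag_eq h (q, hp (q, p))
  rw [h3] at h4
  simp only at h4
  have h5 : ⟪p, hp (q, p)⟫ = ⟪gradient w q, hp (q, p)⟫ - ⟪θ q, hp (q, p)⟫ := by
    rw [hp', inner_sub_left]
  have h6 := H.hC2 q p
  have h7 : h (q, p) ≤ b + ρ * (C + K * (C * (h (q, p) + C))) := by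
    have : ρ * (C + K * ‖hp (q, p)‖) ≤ ρ * (C + K * (C * (h (q, p) + C))) := by gcongr
    linarith
  by_contra hcon
  push Not at hcon
  have h8 : ρ * K * C * (h (q, p) - b') < 1 * (h (q, p) - b') :=
    mul_lt_mul_of_pos_right hρ1.2 (by linarith)
  nlinarith [hρ1.1]

end mane
end MT

end ModuleM2

section ModuleT
open Filter Topology Set MeasureTheory
open scoped RealInnerProductSpace ENNReal
set_option linter.unusedSectionVars false
set_option linter.unusedVariables false
namespace MT

variable {E : Type*} [NormedAddCommGroup E] [InnerProductSpace ℝ E]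
section ext
variable [FiniteDimensional ℝ E]

/-- Clamp. -/
noncomputable def cl (t : ℝ) : ℝ := max 0 (min 1 ((t + 1) / 2))

/-- Smoothed positive part. -/
noncomputable def sm (t : ℝ) : ℝ := cl t * (t + 1) - cl t ^ 2

lemma cl_nonneg (t : ℝ) : 0 ≤ cl t := le_max_left _ _
lemma cl_le_one (t : ℝ) : cl t ≤ 1 := max_le zero_le_one (min_le_left _ _)
lemma cl_cont : Continuous cl := by unfold cl; fun_prop

lemma cl_of_ge {t : ℝ} (ht : 1 ≤ t) : cl t = 1 := by
  unfold cl
  rw [min_eq_left (by linarith), max_eq_right zero_le_one]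

lemma cl_of_le {t : ℝ} (ht : t ≤ -1) : cl t = 0 := by
  unfold cl
  rw [max_eq_left]
  exact (min_le_right _ _).trans (by linarith)

lemma sm_of_ge {t : ℝ} (ht : 1 ≤ t) : sm t = t := by
  unfold sm; rw [cl_of_ge ht]; ring

lemma sm_of_le {t : ℝ} (ht : t ≤ -1) : sm t = 0 := by
  unfold sm; rw [cl_of_le ht]; ring

lemma sm_ge (t : ℝ) {d : ℝ} (hd : 0 ≤ d) (hd1 : d ≤ 1) : d * (t + 1) - d ^ 2 ≤ sm t := by
  unfold sm
  rcases le_total t (-1) with h | h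
  · rw [cl_of_le h]
    nlinarith
  · rcases le_total 1 t with h1 | h1
    · rw [cl_of_ge h1]
      nlinarith
    · have : cl t = (t + 1) / 2 := by
        unfold cl
        rw [min_eq_right (by linarith), max_eq_right (by linarith)]
      rw [this]
      nlinarith [sq_nonneg ((t + 1) / 2 - d)]

lemma sm_tan (t t' : ℝ) : sm t + cl t * (t' - t) ≤ sm t' := by
  have := sm_ge t' (cl_nonneg t) (cl_le_one t)
  have e : sm t = cl t * (t + 1) - cl t ^ 2 := rfl
  linarith

lemma sm_nonneg (t : ℝ) : 0 ≤ sm t := by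
  have := sm_ge t le_rfl zero_le_one
  linarith

lemma sm_le (t : ℝ) : t ≤ sm t := by
  have := sm_ge t zero_le_one le_rfl
  linarith

lemma sm_deriv (t : ℝ) : HasDerivAt sm (cl t) t := by
  rw [hasDerivAt_iff_isLittleO, Asymptotics.isLittleO_iff]
  intro c hc
  have h1 := Metric.continuousAt_iff'.1 (cl_cont.continuousAt (x := t)) c hc
  filter_upwards [h1] with t' ht'
  rw [Real.dist_eq] at ht'
  have a1 := sm_tan t t'
  have a2 := sm_tan t' t
  rw [smul_eq_mul, Real.norm_eq_abs, Real.norm_eq_abs]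
  have a3 : 0 ≤ sm t' - sm t - (t' - t) * cl t := by linarith
  rw [abs_of_nonneg a3]
  calc sm t' - sm t - (t' - t) * cl t ≤ (cl t' - cl t) * (t' - t) := by linarith
    _ ≤ |(cl t' - cl t) * (t' - t)| := le_abs_self _
    _ = |cl t' - cl t| * |t' - t| := abs_mul _ _
    _ ≤ c * |t' - t| := mul_le_mul_of_nonneg_right ht'.le (abs_nonneg _)

/-- `C¹` data of a Tonelli Hamiltonian. -/
structure PreTame (Λ : AddSubgroup E) (h : E × E → ℝ) (hq hp : E × E → E) : Prop where
  hasD : ∀ z, HasFDerivAt h (pairL (hq z) (hp z)) z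
  cq : Continuous hq
  cp : Continuous hp
  per : ∀ m ∈ Λ, ∀ q p, h (q + m, p) = h (q, p)
  perq : ∀ m ∈ Λ, ∀ q p, hq (q + m, p) = hq (q, p)
  perp : ∀ m ∈ Λ, ∀ q p, hp (q + m, p) = hp (q, p)
  tan : ∀ q p p', p ≠ p' → h (q, p) + ⟪hp (q, p), p' - p⟫ < h (q, p')
  super : ∀ A : ℝ, ∃ c : ℝ, ∀ q p, A * ‖p‖ - c ≤ h (q, p)

variable {Λ : AddSubgroup E} {h : E × E → ℝ} {hq hp : E × E → E} {C : ℝ}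

lemma strictConvexOn_of_tan {f : E → ℝ} {g : E → E}
    (hf : ∀ p p', p ≠ p' → f p + ⟪g p, p' - p⟫ < f p') : StrictConvexOn ℝ univ f := by
  refine ⟨convex_univ, fun x _ y _ hxy a b ha hb hab => ?_⟩
  set z := a • x + b • y with hz
  have e1 : x - z = b • (x - y) := by
    rw [hz]
    have : a = 1 - b := by linarith
    rw [this]; module
  have e2 : y - z = -(a • (x - y)) := by
    rw [hz]
    have : b = 1 - a := by linarith
    rw [this]; module
  have hxy' : x - y ≠ 0 := sub_ne_zero.2 hxy
  have n1 : z ≠ x := by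
    intro h1
    rw [h1, sub_self] at e1
    exact (smul_ne_zero hb.ne' hxy') e1.symm
  have n2 : z ≠ y := by
    intro h1
    rw [h1, sub_self] at e2
    exact (smul_ne_zero ha.ne' hxy') (neg_eq_zero.1 e2.symm)
  have h1 := hf z x n1
  have h2 := hf z y n2
  rw [e1, inner_smul_right] at h1
  rw [e2, inner_neg_right, inner_smul_right] at h2
  simp only [smul_eq_mul]
  have h3 := mul_lt_mul_of_pos_left h1 ha
  have h4 := mul_lt_mul_of_pos_left h2 hb
  have h5 : a * f z + b * f z = f z := by rw [← add_mul, hab, one_mul]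
  nlinarith

/-- The quadratic comparison function. -/
noncomputable def qg (A R D : ℝ) (p : E) : ℝ := A * (‖p‖ ^ 2 - R ^ 2) - D

lemma qg_tan {A : ℝ} (hA : 0 < A) (R D : ℝ) {p p' : E} (hp : p ≠ p') :
    qg A R D p + ⟪(2 * A) • p, p' - p⟫ < qg A R D p' := by
  unfold qg
  have h1 : ‖p'‖ ^ 2 = ‖p‖ ^ 2 + 2 * ⟪p, p' - p⟫ + ‖p' - p‖ ^ 2 := by
    rw [← norm_add_sq_real]; simp
  have h2 : 0 < ‖p' - p‖ ^ 2 := by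
    have : p' - p ≠ 0 := sub_ne_zero.2 hp.symm
    positivity
  rw [real_inner_smul_left, h1]
  nlinarith

lemma qg_hasD (A R D : ℝ) (z : E × E) :
    HasFDerivAt (fun z : E × E => qg A R D z.2) (pairL 0 ((2 * A) • z.2)) z := by
  have h1 : HasFDerivAt (fun z : E × E => ‖z.2‖ ^ 2) _ z :=
    (hasFDerivAt_snd (𝕜 := ℝ) (p := z)).norm_sq
  have h2 := ((h1.sub_const (R ^ 2)).const_mul A).sub_const D
  refine h2.congr_fderiv ?_
  ext w <;> simp [real_inner_smul_left] <;> ring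

end ext
end MT

end ModuleT

section ModuleT2
open Filter Topology Set MeasureTheory
open scoped RealInnerProductSpace ENNReal
set_option linter.unusedSectionVars false
set_option linter.unusedVariables false
namespace MT

variable {E : Type*} [NormedAddCommGroup E] [InnerProductSpace ℝ E]
section ext
variable [FiniteDimensional ℝ E]
variable {Λ : AddSubgroup E} {h : E × E → ℝ} {hq hp : E × E → E} {C : ℝ}

lemma bound_on {F : Type*} [NormedAddCommGroup F] {Q : Set E} (hQ : IsCompact Q)
    (hQΛ : ∀ x, ∃ m ∈ Λ, x + m ∈ Q) {f : E × E → F} (hf : Continuous f)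
    (hper : ∀ m ∈ Λ, ∀ q p, f (q + m, p) = f (q, p)) (r : ℝ) :
    ∃ c, 0 ≤ c ∧ ∀ q p, ‖p‖ ≤ r → ‖f (q, p)‖ ≤ c := by
  have hP : ProperSpace E := FiniteDimensional.proper ℝ E
  obtain ⟨c, hc⟩ := (hQ.prod (isCompact_closedBall (0 : E) r)).exists_bound_of_continuousOn hf.continuousOn
  refine ⟨max c 0, le_max_right _ _, fun q p hp => ?_⟩
  obtain ⟨m, hm, hmQ⟩ := hQΛ q
  rw [← hper m hm q p]
  exact (hc (q + m, p) ⟨hmQ, by simpa using hp⟩).trans (le_max_left _ _)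

lemma sm_lip (t t' : ℝ) : sm t + (1 - cl t') * 0 + min 0 (t' - t) ≤ sm t' := by
  have := sm_tan t t'
  have h1 := cl_nonneg t
  have h2 := cl_le_one t
  rcases le_total 0 (t' - t) with h | h
  · rw [min_eq_left h]; nlinarith
  · rw [min_eq_right h]; nlinarith

set_option maxHeartbeats 2000000 in
lemma tame_ext (H : PreTame Λ h hq hp) {Q : Set E} (hQ : IsCompact Q)
    (hQΛ : ∀ x, ∃ m ∈ Λ, x + m ∈ Q) (l : ℝ) :
    ∃ (R C : ℝ) (k : E × E → ℝ) (kq kp : E × E → E), Tame Λ k kq kp C ∧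
      (∀ z, R ≤ ‖z.2‖ → l < h z) ∧ (∀ z, R ≤ ‖z.2‖ → l < k z) ∧
      (∀ z, ‖z.2‖ < R → k z = h z) := by
  have hhc : Continuous h := continuous_iff_continuousAt.2 fun z => (H.hasD z).continuousAt
  obtain ⟨c1, hc1⟩ := H.super 1
  set R := max 1 (l + 1 + c1) with hR
  have hR1 : 1 ≤ R := le_max_left _ _
  have hR2 : l + 1 + c1 ≤ R := le_max_right _ _
  set D := c1 + 1 with hD
  have hlow : ∀ z, 1 - D ≤ h z := fun z => by
    have := hc1 z.1 z.2
    have h2 := norm_nonneg z.2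
    simp only [Prod.mk.eta] at this
    linarith
  have hhi : ∀ z : E × E, R ≤ ‖z.2‖ → l < h z := fun z hz => by
    have := hc1 z.1 z.2
    simp only [Prod.mk.eta] at this
    linarith
  obtain ⟨H0, hH0, hHb⟩ := bound_on hQ hQΛ hhc H.per (R + 2)
  obtain ⟨H1, hH1, hHb1⟩ := bound_on hQ hQΛ H.cq H.perq (R + 2)
  obtain ⟨H2, hH2, hHb2⟩ := bound_on hQ hQΛ H.cp H.perp (R + 2)
  set A := H0 + |D| + |l| + 2 with hA
  have hA1 : 1 ≤ A := by have := abs_nonneg D; have := abs_nonneg l; linarith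
  set g : E × E → ℝ := fun z => qg A R D z.2 with hg
  have hgval : ∀ z, g z = A * (‖z.2‖ ^ 2 - R ^ 2) - D := fun z => rfl
  have hgc : Continuous g := by
    have : Continuous fun z : E × E => A * (‖z.2‖ ^ 2 - R ^ 2) - D := by fun_prop
    exact this
  set k0 : E × E → ℝ := fun z => g z + sm (h z - g z) with hk0
  set q0 : E × E → E := fun z => cl (h z - g z) • hq z with hq0
  set p0 : E × E → E := fun z => cl (h z - g z) • hp z + (1 - cl (h z - g z)) • (2 * A) • z.2 with hp0
  have k0D : ∀ z, HasFDerivAt k0 (pairL (q0 z) (p0 z)) z := by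
    intro z
    have h1 := qg_hasD A R D z
    have h2 := (sm_deriv (h z - g z)).comp_hasFDerivAt z ((H.hasD z).sub h1)
    refine (h1.add h2).congr_fderiv ?_
    ext w <;> simp [hq0, hp0, real_inner_smul_left, inner_add_left] <;> ring
  have hshell : ∀ z : E × E, R + 1 ≤ ‖z.2‖ → ‖z.2‖ ≤ R + 2 → h z - g z ≤ -1 := by
    intro z h1 h2
    have h3 := hHb z.1 z.2 h2
    rw [Prod.mk.eta, Real.norm_eq_abs] at h3
    have h4 := le_abs_self (h z)
    have h5 : (R + 1) ^ 2 ≤ ‖z.2‖ ^ 2 := by gcongr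
    have h6 : 1 ≤ ‖z.2‖ ^ 2 - R ^ 2 := by nlinarith
    have h7 : A * 1 ≤ A * (‖z.2‖ ^ 2 - R ^ 2) := by gcongr
    rw [hgval]
    have h8 := le_abs_self D
    have h9 := abs_nonneg l
    linarith
  have hcc : Continuous fun z => cl (h z - g z) := cl_cont.comp (hhc.sub hgc)
  have q0c : Continuous q0 := hcc.smul H.cq
  have p0c : Continuous p0 := (hcc.smul H.cp).add ((continuous_const.sub hcc).smul (by fun_prop))
  set k : E × E → ℝ := fun z => if ‖z.2‖ < R + 3 / 2 then k0 z else g z with hk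
  set kq : E × E → E := fun z => if ‖z.2‖ < R + 3 / 2 then q0 z else 0 with hkq
  set kp : E × E → E := fun z => if ‖z.2‖ < R + 3 / 2 then p0 z else (2 * A) • z.2 with hkp
  have sh0 : ∀ z : E × E, R + 1 ≤ ‖z.2‖ → ‖z.2‖ ≤ R + 2 → k0 z = g z ∧ q0 z = 0 ∧ p0 z = (2 * A) • z.2 := by
    intro z h1 h2
    have h3 := hshell z h1 h2
    refine ⟨?_, ?_, ?_⟩
    · simp only [hk0]; rw [sm_of_le h3, add_zero]
    · simp only [hq0]; rw [cl_of_le h3, zero_smul]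
    · simp only [hp0]; rw [cl_of_le h3, zero_smul, sub_zero, one_smul, zero_add]
  have in1 : ∀ z : E × E, ‖z.2‖ < R + 2 → k z = k0 z ∧ kq z = q0 z ∧ kp z = p0 z := by
    intro z hz
    by_cases h1 : ‖z.2‖ < R + 3 / 2
    · simp only [hk, hkq, hkp, if_pos h1]; exact ⟨trivial, trivial, trivial⟩
    · obtain ⟨a1, a2, a3⟩ := sh0 z (by linarith) hz.le
      simp only [hk, hkq, hkp, if_neg h1]; exact ⟨a1.symm, a2.symm, a3.symm⟩
  have in2 : ∀ z : E × E, R + 1 < ‖z.2‖ → k z = g z ∧ kq z = 0 ∧ kp z = (2 * A) • z.2 := by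
    intro z hz
    by_cases h1 : ‖z.2‖ < R + 3 / 2
    · obtain ⟨a1, a2, a3⟩ := sh0 z hz.le (by linarith)
      simp only [hk, hkq, hkp, if_pos h1]; exact ⟨a1, a2, a3⟩
    · simp only [hk, hkq, hkp, if_neg h1]; exact ⟨trivial, trivial, trivial⟩
  have nb1 : ∀ z : E × E, ‖z.2‖ < R + 2 → ∀ᶠ w in 𝓝 z, ‖w.2‖ < R + 2 := fun z hz =>
    (Continuous.tendsto (by fun_prop : Continuous fun w : E × E => ‖w.2‖) z).eventually_lt_const hz
  have nb2 : ∀ z : E × E, R + 1 < ‖z.2‖ → ∀ᶠ w in 𝓝 z, R + 1 < ‖w.2‖ := fun z hz =>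
    (Continuous.tendsto (by fun_prop : Continuous fun w : E × E => ‖w.2‖) z).eventually_const_lt hz
  have cases : ∀ z : E × E, ‖z.2‖ < R + 2 ∨ R + 1 < ‖z.2‖ := fun z => by
    rcases lt_or_ge ‖z.2‖ (R + 2) with h1 | h1
    · exact Or.inl h1
    · exact Or.inr (by linarith)
  have kg : ∀ z, g z ≤ k z := by
    intro z
    rcases cases z with h1 | h1
    · rw [(in1 z h1).1]
      have := sm_nonneg (h z - g z)
      simp only [hk0]; linarith
    · rw [(in2 z h1).1]
  have k0tan : ∀ q p p', p ≠ p' → k0 (q, p) + ⟪p0 (q, p), p' - p⟫ < k0 (q, p') := by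
    intro q p p' hne
    have a1 := H.tan q p p' hne
    have a2 := qg_tan (by linarith : (0:ℝ) < A) R D hne
    have a3 := sm_tan (h (q, p) - g (q, p)) (h (q, p') - g (q, p'))
    have a4 := cl_nonneg (h (q, p) - g (q, p))
    have a5 := cl_le_one (h (q, p) - g (q, p))
    have b2 : g (q, p) + ⟪(2 * A) • p, p' - p⟫ < g (q, p') := a2
    simp only [hk0, hp0]
    rw [inner_add_left, real_inner_smul_left, real_inner_smul_left _ _ (1 - cl _)]
    set σ := cl (h (q, p) - g (q, p))
    rcases eq_or_lt_of_le a4 with h0 | h0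
    · rw [← h0] at a3 ⊢
      linarith
    · have e1 := mul_lt_mul_of_pos_left a1 h0
      have e2 := mul_le_mul_of_nonneg_left b2.le (by linarith : 0 ≤ 1 - σ)
      nlinarith
  have ktan : ∀ q p p', p ≠ p' → k (q, p) + ⟪kp (q, p), p' - p⟫ < k (q, p') := by
    intro q p p' hne
    rcases lt_or_ge (R + 1) ‖p‖ with h1 | h1
    · obtain ⟨a1, -, a3⟩ := in2 (q, p) h1
      rw [a1, a3]
      have hApos : (0:ℝ) < A := by linarith
      exact lt_of_lt_of_le (qg_tan hApos R D hne) (kg (q, p'))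
    · obtain ⟨a1, -, a3⟩ := in1 (q, p) (by simp only; linarith)
      rw [a1, a3]
      rcases lt_or_ge ‖p'‖ (R + 2) with h2 | h2
      · rw [(in1 (q, p') h2).1]
        exact k0tan q p p' hne
      · rw [(in2 (q, p') (by simp only; linarith)).1]
        -- intermediate point
        set d := p' - p with hd
        have hcont : ContinuousOn (fun t : ℝ => ‖p + t • d‖) (Icc 0 1) := by fun_prop
        obtain ⟨t, ht, hte⟩ : ∃ t ∈ Icc (0:ℝ) 1, ‖p + t • d‖ = R + 3 / 2 := by
          have := intermediate_value_Icc (zero_le_one (α := ℝ)) hcont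
          have hm : R + 3 / 2 ∈ Icc ‖p + (0:ℝ) • d‖ ‖p + (1:ℝ) • d‖ := by
            rw [zero_smul, add_zero, one_smul, hd, add_sub_cancel]
            constructor <;> linarith
          obtain ⟨t, ht, e⟩ := this hm
          exact ⟨t, ht, e⟩
        set r := p + t • d with hr
        have hrp : r ≠ p := by intro e; rw [e] at hte; linarith
        have hrp' : r ≠ p' := by intro e; rw [e] at hte; linarith
        have ht0 : 0 < t := by
          rcases eq_or_lt_of_le ht.1 with e | e
          · exfalso; apply hrp; rw [hr, ← e, zero_smul, add_zero]
          · exact e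
        have b1 := k0tan q p r hrp.symm
        have b2 := k0tan q r p hrp
        obtain ⟨s1, -, s3⟩ := sh0 (q, r) (by simp only; linarith) (by simp only; linarith)
        have b3 := qg_tan (by linarith : (0:ℝ) < A) R D hrp'
        have e1 : r - p = t • d := by rw [hr]; abel
        have e2 : p - r = -(t • d) := by rw [hr]; abel
        have e3 : p' - r = (1 - t) • d := by
          have : p' = p + d := by rw [hd]; abel
          rw [this, hr]; module
        rw [e1, inner_smul_right] at b1
        rw [e2, inner_neg_right, inner_smul_right, s3] at b2
        rw [e3, inner_smul_right] at b3
        rw [s1] at b1 b2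
        simp only at b2
        have b4 : t * ⟪p0 (q, p), d⟫ < t * ⟪(2 * A) • r, d⟫ := by linarith
        have b5 : ⟪p0 (q, p), d⟫ < ⟪(2 * A) • r, d⟫ := lt_of_mul_lt_mul_left b4 ht0.le
        have b6 := mul_le_mul_of_nonneg_left b5.le (by linarith [ht.2] : 0 ≤ 1 - t)
        have b7 : g (q, r) + (1 - t) * ⟪(2 * A) • r, d⟫ < g (q, p') := b3
        linarith
  have kD : ∀ z, HasFDerivAt k (pairL (kq z) (kp z)) z := by
    intro z
    rcases cases z with h1 | h1
    · obtain ⟨-, a2, a3⟩ := in1 z h1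
      rw [a2, a3]
      refine (k0D z).congr_of_eventuallyEq ?_
      filter_upwards [nb1 z h1] with w hw using (in1 w hw).1
    · obtain ⟨-, a2, a3⟩ := in2 z h1
      rw [a2, a3]
      refine (qg_hasD A R D z).congr_of_eventuallyEq ?_
      filter_upwards [nb2 z h1] with w hw using (in2 w hw).1
  have kqc : Continuous kq := by
    rw [continuous_iff_continuousAt]
    intro z
    rcases cases z with h1 | h1
    · refine q0c.continuousAt.congr ?_
      filter_upwards [nb1 z h1] with w hw using (in1 w hw).2.1.symm
    · refine (continuousAt_const (y := (0 : E))).congr ?_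
      filter_upwards [nb2 z h1] with w hw using (in2 w hw).2.1.symm
  have kpc : Continuous kp := by
    rw [continuous_iff_continuousAt]
    intro z
    rcases cases z with h1 | h1
    · refine p0c.continuousAt.congr ?_
      filter_upwards [nb1 z h1] with w hw using (in1 w hw).2.2.symm
    · have : ContinuousAt (fun z : E × E => (2 * A) • z.2) z := by fun_prop
      refine this.congr ?_
      filter_upwards [nb2 z h1] with w hw using (in2 w hw).2.2.symm
  have gper : ∀ (m q p : E), g (q + m, p) = g (q, p) := fun m q p => rfl
  have R0 : 0 ≤ A * R ^ 2 + |D| := by positivity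
  set L := (1 + (R + 2)) * (1 + (H2 + 2 * A * (R + 2))) with hL
  have hL0 : 0 ≤ L := by positivity
  refine ⟨R, A * R ^ 2 + |D| + L + H1 + 5 + 2 * A, k, kq, kp, ⟨kD, kqc, kpc, ?_, ?_, fun q => strictConvexOn_of_tan (ktan q), ?_, ?_, ?_, ?_⟩, hhi, ?_, ?_⟩
  · intro m hm q p
    simp only [hk, hk0, gper, H.per m hm]
  · intro m hm q p
    simp only [hkq, hq0, gper, H.per m hm, H.perq m hm]
  · intro A'
    refine ⟨A' ^ 2 + A * R ^ 2 + D, fun q p => ?_⟩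
    refine le_trans ?_ (kg _)
    rw [hgval]
    simp only
    have h1 : 1 * ‖p‖ ^ 2 ≤ A * ‖p‖ ^ 2 := by gcongr
    nlinarith [sq_nonneg (A' - ‖p‖ / 2), sq_nonneg ‖p‖]
  · nlinarith
  · intro z
    rcases cases z with h1 | h1
    · rw [(in1 z h1).2.1]
      have h2 := hHb1 z.1 z.2 h1.le
      simp only [hq0]
      rw [norm_smul, Real.norm_of_nonneg (cl_nonneg _)]
      have h3 := cl_le_one (h z - g z)
      have h4 : cl (h z - g z) * ‖hq z‖ ≤ 1 * H1 := by
        gcongr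
      linarith
    · rw [(in2 z h1).2.1, norm_zero]
      positivity
  · intro q p
    set c := A * R ^ 2 + |D| + L + H1 + 5 + 2 * A with hc
    have hDa := le_abs_self D
    have hgk := kg (q, p)
    rw [hgval] at hgk
    simp only at hgk
    have hpn := norm_nonneg p
    rcases lt_or_ge ‖p‖ (R + 2) with h1 | h1
    · rw [(in1 (q, p) h1).2.2]
      have h2 := hHb2 q p h1.le
      have h3 : ‖p0 (q, p)‖ ≤ H2 + 2 * A * (R + 2) := by
        simp only [hp0]
        have a4 := cl_nonneg (h (q, p) - g (q, p))
        have a5 := cl_le_one (h (q, p) - g (q, p))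
        refine (norm_add_le _ _).trans (add_le_add ?_ ?_)
        · rw [norm_smul, Real.norm_of_nonneg a4]
          calc _ ≤ 1 * H2 := by gcongr
            _ = H2 := one_mul _
        · rw [norm_smul, norm_smul, Real.norm_of_nonneg (by linarith : 0 ≤ 1 - cl (h (q, p) - g (q, p))),
            Real.norm_of_nonneg (by linarith : 0 ≤ 2 * A)]
          calc _ ≤ 1 * (2 * A * (R + 2)) := by
                  gcongr
                  · linarith
            _ = _ := one_mul _
      have h4 : (1 + ‖p‖) * (1 + ‖p0 (q, p)‖) ≤ L := by
        rw [hL]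
        gcongr
      have h5 : L + 5 ≤ k (q, p) + c := by
        have : 0 ≤ A * ‖p‖ ^ 2 := by positivity
        rw [hc]
        nlinarith
      have h6 : 1 ≤ c := by rw [hc]; linarith
      nlinarith
    · rw [(in2 (q, p) (by simp only; linarith)).2.2]
      simp only
      rw [norm_smul, Real.norm_of_nonneg (by linarith : 0 ≤ 2 * A)]
      have h5 : A * ‖p‖ ^ 2 + (5 + 2 * A) ≤ k (q, p) + c := by
        rw [hc]
        nlinarith
      have h6 : 5 ≤ c := by rw [hc]; linarith
      have h7 : 5 * (A * ‖p‖ ^ 2 + (5 + 2 * A)) ≤ c * (k (q, p) + c) := by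
        have : 0 ≤ A * ‖p‖ ^ 2 + (5 + 2 * A) := by positivity
        exact mul_le_mul h6 h5 this (by linarith)
      refine le_trans ?_ h7
      nlinarith [sq_nonneg (‖p‖ - 1), mul_nonneg (by linarith : 0 ≤ A) (sq_nonneg (‖p‖ - 1)), mul_le_mul_of_nonneg_right hA1 (sq_nonneg ‖p‖)]
  · intro z hz
    rcases cases z with h1 | h1
    · rw [(in1 z h1).1]
      have := sm_le (h z - g z)
      have h2 := hhi z hz
      simp only [hk0]
      linarith
    · refine lt_of_lt_of_le ?_ (kg z)
      rw [hgval]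
      have h5 : (R + 1) ^ 2 ≤ ‖z.2‖ ^ 2 := by gcongr
      have h6 : 1 ≤ ‖z.2‖ ^ 2 - R ^ 2 := by nlinarith
      have h7 : A * 1 ≤ A * (‖z.2‖ ^ 2 - R ^ 2) := by gcongr
      have h8 := le_abs_self D
      have h9 := le_abs_self l
      linarith
  · intro z hz
    rw [(in1 z (by linarith)).1]
    simp only [hk0]
    have h1 : g z ≤ -D := by
      rw [hgval]
      have h2 : ‖z.2‖ ^ 2 ≤ R ^ 2 := by gcongr
      have : A * (‖z.2‖ ^ 2 - R ^ 2) ≤ 0 := mul_nonpos_of_nonneg_of_nonpos (by linarith) (by linarith)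
      linarith
    have h2 := hlow z
    rw [sm_of_ge (by linarith)]
    ring

end ext
end MT

end ModuleT2

section ModuleU
open Filter Topology Set MeasureTheory
open scoped RealInnerProductSpace ENNReal
set_option linter.unusedSectionVars false
set_option linter.unusedVariables false
namespace MT

variable {E : Type*} [NormedAddCommGroup E] [InnerProductSpace ℝ E]
section smoothH
variable [FiniteDimensional ℝ E]
variable {Λ : AddSubgroup E}

lemma contDiff_of_inner {F : Type*} [NormedAddCommGroup F] [NormedSpace ℝ F] {m : WithTop ℕ∞}
    {f : F → E} (hf : ∀ v, ContDiff ℝ m fun z => ⟪f z, v⟫) : ContDiff ℝ m f := by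
  have : f = fun z => ∑ i, ⟪f z, stdOrthonormalBasis ℝ E i⟫ • stdOrthonormalBasis ℝ E i := by
    funext z
    conv_lhs => rw [← (stdOrthonormalBasis ℝ E).sum_repr' (f z)]
    exact Finset.sum_congr rfl fun i _ => by rw [real_inner_comm]
  rw [this]
  exact ContDiff.sum fun i _ => (hf _).smul contDiff_const

lemma inner_grad (f : E → ℝ) (x v : E) : haveI := FiniteDimensional.complete ℝ E
    ⟪gradient f x, v⟫ = fderiv ℝ f x v := by
  haveI := FiniteDimensional.complete ℝ E
  simp [gradient]

variable [CompleteSpace E]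

/-- partial gradients -/
noncomputable def gq (H : E × E → ℝ) (z : E × E) : E := gradient (fun q' => H (q', z.2)) z.1
/-- partial gradients -/
noncomputable def gp (H : E × E → ℝ) (z : E × E) : E := gradient (fun p' => H (z.1, p')) z.2

variable {H : E × E → ℝ}

lemma gq_inner (hH : Differentiable ℝ H) (z : E × E) (v : E) :
    ⟪gq H z, v⟫ = fderiv ℝ H z (v, 0) := by
  rw [gq, inner_grad]
  have h1 : HasFDerivAt (fun q' => H (q', z.2)) ((fderiv ℝ H z).comp (ContinuousLinearMap.inl ℝ E E)) z.1 := by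
    have h0 : HasFDerivAt (fun q' : E => (q', z.2)) (ContinuousLinearMap.inl ℝ E E) z.1 :=
      (hasFDerivAt_id (𝕜 := ℝ) z.1).prodMk (hasFDerivAt_const z.2 z.1)
    have h2 : HasFDerivAt H (fderiv ℝ H z) ((fun q' : E => (q', z.2)) z.1) := (hH z).hasFDerivAt
    have := h2.comp z.1 h0
    exact this
  rw [h1.fderiv]; simp

lemma gp_inner (hH : Differentiable ℝ H) (z : E × E) (v : E) :
    ⟪gp H z, v⟫ = fderiv ℝ H z (0, v) := by
  rw [gp, inner_grad]
  have h1 : HasFDerivAt (fun p' => H (z.1, p')) ((fderiv ℝ H z).comp (ContinuousLinearMap.inr ℝ E E)) z.2 := by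
    have h0 : HasFDerivAt (fun p' : E => (z.1, p')) (ContinuousLinearMap.inr ℝ E E) z.2 :=
      (hasFDerivAt_const z.1 z.2).prodMk (hasFDerivAt_id (𝕜 := ℝ) z.2)
    have h2 : HasFDerivAt H (fderiv ℝ H z) ((fun p' : E => (z.1, p')) z.2) := (hH z).hasFDerivAt
    have := h2.comp z.2 h0
    exact this
  rw [h1.fderiv]; simp

lemma gq_smooth (hH : ContDiff ℝ (⊤ : ℕ∞) H) : ContDiff ℝ (⊤ : ℕ∞) (gq H) := by
  refine contDiff_of_inner fun v => ?_
  simp_rw [gq_inner (hH.differentiable (by simp))]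
  exact (hH.fderiv_right (m := (⊤ : ℕ∞)) (by simp)).clm_apply contDiff_const

lemma gp_smooth (hH : ContDiff ℝ (⊤ : ℕ∞) H) : ContDiff ℝ (⊤ : ℕ∞) (gp H) := by
  refine contDiff_of_inner fun v => ?_
  simp_rw [gp_inner (hH.differentiable (by simp))]
  exact (hH.fderiv_right (m := (⊤ : ℕ∞)) (by simp)).clm_apply contDiff_const

lemma grad_smooth {w : E → ℝ} (hw : ContDiff ℝ (⊤ : ℕ∞) w) : ContDiff ℝ (⊤ : ℕ∞) (gradient w) := by
  refine contDiff_of_inner fun v => ?_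
  simp_rw [inner_grad]
  exact (hw.fderiv_right (m := (⊤ : ℕ∞)) (by simp)).clm_apply contDiff_const

lemma hasD_pair (hH : Differentiable ℝ H) (z : E × E) :
    HasFDerivAt H (pairL (gq H z) (gp H z)) z := by
  refine (hH z).hasFDerivAt.congr_fderiv ?_
  ext v
  · simp [pairL_apply, gq_inner hH]
  · simp [pairL_apply, gp_inner hH]

lemma preTame_of_smooth (hH : ContDiff ℝ (⊤ : ℕ∞) H)
    (hper : ∀ m ∈ Λ, ∀ q p, H (q + m, p) = H (q, p))
    (hconv : ∀ (q p v : E), v ≠ 0 → 0 < iteratedFDeriv ℝ 2 (fun p' => H (q, p')) p ![v, v])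
    (hsuper : ∀ A : ℝ, 0 < A → ∃ C : ℝ, ∀ q p, A * ‖p‖ - C ≤ H (q, p)) :
    PreTame Λ H (gq H) (gp H) := by
  have hd : Differentiable ℝ H := hH.differentiable (by simp)
  refine ⟨hasD_pair hd, (gq_smooth hH).continuous, (gp_smooth hH).continuous, hper, ?_, ?_, ?_, ?_⟩
  · intro m hm q p
    show gradient (fun q' => H (q', p)) (q + m) = gradient (fun q' => H (q', p)) q
    have : (fun q' => H (q', p)) = fun q' => H (q' + m, p) := by
      funext q'; rw [hper m hm]
    unfold gradient
    conv_rhs => rw [this]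
    rw [fderiv_comp_add_right (f := fun q' => H (q', p))]
  · intro m hm q p
    show gradient (fun p' => H (q + m, p')) p = gradient (fun p' => H (q, p')) p
    simp_rw [hper m hm]
  · intro q p p' hne
    set f : E → ℝ := fun p' => H (q, p') with hf
    have hfs : ContDiff ℝ (⊤ : ℕ∞) f := hH.comp (contDiff_const.prodMk contDiff_id)
    have hfd : Differentiable ℝ f := hfs.differentiable (by simp)
    have hfd2 : Differentiable ℝ (fderiv ℝ f) :=
      (hfs.fderiv_right (m := (⊤ : ℕ∞)) (by simp)).differentiable (by simp)
    set d := p' - p with hdd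
    have hd0 : d ≠ 0 := sub_ne_zero.2 hne.symm
    have hl : ∀ t : ℝ, HasDerivAt (fun t : ℝ => p + t • d) d t := fun t => by
      simpa using ((hasDerivAt_id t).smul_const d).const_add p
    have h1 : ∀ t : ℝ, HasDerivAt (fun t : ℝ => f (p + t • d)) (fderiv ℝ f (p + t • d) d) t :=
      fun t => (hfd _).hasFDerivAt.comp_hasDerivAt t (hl t)
    have h2 : ∀ t : ℝ, HasDerivAt (fun t : ℝ => fderiv ℝ f (p + t • d) d)
        (fderiv ℝ (fderiv ℝ f) (p + t • d) d d) t := fun t => by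
      have := (hfd2 _).hasFDerivAt.comp_hasDerivAt t (hl t)
      simpa using this.clm_apply (hasDerivAt_const t d)
    have hmono : StrictMono (fun t : ℝ => fderiv ℝ f (p + t • d) d) := by
      refine strictMono_of_deriv_pos fun t => ?_
      rw [(h2 t).deriv]
      have := hconv q (p + t • d) d hd0
      rw [iteratedFDeriv_two_apply] at this
      simpa using this
    obtain ⟨ξ, hξ, he⟩ := exists_hasDerivAt_eq_slope (fun t : ℝ => f (p + t • d)) _ one_pos
      (fun t _ => (h1 t).continuousAt.continuousWithinAt) (fun t _ => h1 t)
    have hm := hmono hξ.1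
    have e1 : fderiv ℝ f p d = ⟪gp H (q, p), d⟫ := by rw [gp, inner_grad]
    have e2 : p + d = p' := by rw [hdd]; abel
    simp only [zero_smul, add_zero, one_smul, sub_zero, div_one, e2] at hm he
    rw [he, e1] at hm
    have : f p' = H (q, p') := rfl
    have : f p = H (q, p) := rfl
    linarith
  · intro A
    obtain ⟨c, hc⟩ := hsuper (max A 1) (by positivity)
    refine ⟨c, fun q p => (hc q p).trans' ?_⟩
    have := mul_le_mul_of_nonneg_right (le_max_left A 1) (norm_nonneg p)
    linarith

/-- If `k = h` near `z`, partial gradients agree. -/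
lemma pairL_inj {a b a' b' : E} (h : pairL a b = pairL a' b') : a = a' ∧ b = b' := by
  constructor
  · refine ext_inner_right ℝ fun v => ?_
    have := congrArg (fun L => L (v, (0 : E))) h
    simpa [pairL_apply] using this
  · refine ext_inner_right ℝ fun v => ?_
    have := congrArg (fun L => L ((0 : E), v)) h
    simpa [pairL_apply] using this

end smoothH
end MT

end ModuleU

section ModuleV1
open Filter Topology Set MeasureTheory
open scoped RealInnerProductSpace ENNReal
set_option linter.unusedSectionVars false
set_option linter.unusedVariables false
namespace MT

section param
universe u
variable {F : Type u} [NormedAddCommGroup F] [NormedSpace ℝ F] [FiniteDimensional ℝ F]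
variable {G : Type u} [NormedAddCommGroup G] [NormedSpace ℝ G] [FiniteDimensional ℝ G]
  [MeasurableSpace G] [BorelSpace G]

lemma par_integrable {V : Type u} [NormedAddCommGroup V] [NormedSpace ℝ V]
    {μ : Measure G} [IsFiniteMeasure μ] {K : Set G} (hK : IsCompact K) (hμ : ∀ᵐ y ∂μ, y ∈ K)
    {g : G → V} (hg : Continuous g) : Integrable g μ := by
  obtain ⟨c, hc⟩ := hK.exists_bound_of_continuousOn hg.continuousOn
  have : SecondCountableTopology G := by
    have := FiniteDimensional.proper ℝ G
    infer_instance
  exact (integrable_const c).mono' hg.aestronglyMeasurable (hμ.mono fun y hy => hc y hy)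

lemma par_hasFDeriv {V : Type u} [NormedAddCommGroup V] [NormedSpace ℝ V]
    {μ : Measure G} [IsFiniteMeasure μ] {K : Set G} (hK : IsCompact K) (hμ : ∀ᵐ y ∂μ, y ∈ K)
    {f : F × G → V} (hf : ContDiff ℝ (⊤ : ℕ∞) f) (x : F) :
    HasFDerivAt (fun x => ∫ y, f (x, y) ∂μ)
      (∫ y, (fderiv ℝ f (x, y)).comp (ContinuousLinearMap.inl ℝ F G) ∂μ) x := by
  have hPF := FiniteDimensional.proper ℝ F
  have hPG := FiniteDimensional.proper ℝ G
  have hc' : Continuous fun z : F × G => (fderiv ℝ f z).comp (ContinuousLinearMap.inl ℝ F G) :=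
    (hf.continuous_fderiv (by simp)).clm_comp continuous_const
  obtain ⟨c, hc⟩ := ((isCompact_closedBall x 1).prod hK).exists_bound_of_continuousOn hc'.continuousOn
  refine hasFDerivAt_integral_of_dominated_of_fderiv_le (s := Metric.closedBall x 1)
    (F := fun x y => f (x, y))
    (F' := fun x y => (fderiv ℝ f (x, y)).comp (ContinuousLinearMap.inl ℝ F G))
    (bound := fun _ => c) (Metric.closedBall_mem_nhds x one_pos) ?_ ?_ ?_ ?_ ?_ ?_
  · exact Eventually.of_forall fun x => (par_integrable hK hμ (by fun_prop)).aestronglyMeasurable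
  · exact par_integrable hK hμ (by fun_prop)
  · exact (par_integrable hK hμ (hc'.comp (by fun_prop))).aestronglyMeasurable
  · exact hμ.mono fun y hy x' hx' => hc (x', y) ⟨hx', hy⟩
  · exact integrable_const _
  · refine Eventually.of_forall fun y x' _ => ?_
    have h0 : HasFDerivAt (fun q' : F => (q', y)) (ContinuousLinearMap.inl ℝ F G) x' :=
      (hasFDerivAt_id (𝕜 := ℝ) x').prodMk (hasFDerivAt_const y x')
    have h2 : HasFDerivAt f (fderiv ℝ f (x', y)) ((fun q' : F => (q', y)) x') :=
      (hf.differentiable (by simp) _).hasFDerivAt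
    exact h2.comp x' h0

lemma par_smooth_nat (n : ℕ) : ∀ {V : Type u} [NormedAddCommGroup V] [NormedSpace ℝ V]
    {μ : Measure G} [IsFiniteMeasure μ] {K : Set G} (hK : IsCompact K) (hμ : ∀ᵐ y ∂μ, y ∈ K)
    {f : F × G → V} (hf : ContDiff ℝ (⊤ : ℕ∞) f), ContDiff ℝ n (fun x => ∫ y, f (x, y) ∂μ) := by
  induction n with
  | zero =>
    intro V _ _ μ _ K hK hμ f hf
    rw [Nat.cast_zero, contDiff_zero]
    exact continuous_iff_continuousAt.2 fun x => (par_hasFDeriv hK hμ hf x).continuousAt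
  | succ n ih =>
    intro V _ _ μ _ K hK hμ f hf
    push_cast
    rw [contDiff_succ_iff_hasFDerivAt]
    refine ⟨_, ?_, par_hasFDeriv hK hμ hf⟩
    exact ih (f := fun z : F × G => (fderiv ℝ f z).comp (ContinuousLinearMap.inl ℝ F G)) hK hμ
      ((hf.fderiv_right (m := (⊤ : ℕ∞)) (by simp)).clm_comp contDiff_const)

lemma par_smooth {V : Type u} [NormedAddCommGroup V] [NormedSpace ℝ V]
    {μ : Measure G} [IsFiniteMeasure μ] {K : Set G} (hK : IsCompact K) (hμ : ∀ᵐ y ∂μ, y ∈ K)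
    {f : F × G → V} (hf : ContDiff ℝ (⊤ : ℕ∞) f) :
    ContDiff ℝ (⊤ : ℕ∞) (fun x => ∫ y, f (x, y) ∂μ) :=
  contDiff_infty.2 fun n => par_smooth_nat n hK hμ hf

end param
end MT

end ModuleV1

section ModuleV2
open Filter Topology Set MeasureTheory
open scoped RealInnerProductSpace ENNReal
set_option linter.unusedSectionVars false
set_option linter.unusedVariables false
namespace MT

section theta
variable {E : Type} [NormedAddCommGroup E] [InnerProductSpace ℝ E] [FiniteDimensional ℝ E]
  [MeasurableSpace E] [BorelSpace E]
variable {ι : Type} [Fintype ι]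

/-- the lattice spanned by a basis -/
def lat (b : Module.Basis ι ℝ E) : AddSubgroup E := (Submodule.span ℤ (Set.range b)).toAddSubgroup

lemma fd_compact (b : Module.Basis ι ℝ E) : IsCompact (closure (ZSpan.fundamentalDomain b)) := by
  have := FiniteDimensional.proper ℝ E
  exact (ZSpan.fundamentalDomain_isBounded b).isCompact_closure

lemma fd_cover (b : Module.Basis ι ℝ E) (x : E) :
    ∃ m ∈ lat b, x + m ∈ closure (ZSpan.fundamentalDomain b) := by
  refine ⟨-(ZSpan.floor b x : E), neg_mem (ZSpan.floor b x).2, subset_closure ?_⟩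
  have := ZSpan.fract_mem_fundamentalDomain b x
  rwa [ZSpan.fract_apply, sub_eq_add_neg] at this

lemma avg_trans (b : Module.Basis ι ℝ E) (ν : Measure E) [ν.IsAddHaarMeasure] {g : E → ℝ}
    (hg : ∀ m ∈ lat b, ∀ q, g (q + m) = g q) (q : E) :
    ∫ a in ZSpan.fundamentalDomain b, g (q + a) ∂ν = ∫ a in ZSpan.fundamentalDomain b, g a ∂ν := by
  set D := ZSpan.fundamentalDomain b
  have hD := ZSpan.isAddFundamentalDomain' b ν
  have h1 : ∫ a in D, g (q + a) ∂ν = ∫ x in (fun a => q + a) '' D, g x ∂ν :=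
    ((measurePreserving_add_left ν q).setIntegral_image_emb (measurableEmbedding_addLeft q) g D).symm
  have hD2 : IsAddFundamentalDomain (Submodule.span ℤ (Set.range b)).toAddSubgroup
      ((fun a => q + a) '' D) ν := hD.vadd_of_comm q
  haveI : Countable (Submodule.span ℤ (Set.range b)).toAddSubgroup :=
    inferInstanceAs (Countable (Submodule.span ℤ (Set.range b)))
  rw [h1]
  refine hD2.setIntegral_eq hD fun m x => ?_
  show g ((m : E) + x) = g x
  rw [add_comm]
  exact hg m m.2 x

variable {B : E → E →L[ℝ] E}

lemma dB_skew (hB : Differentiable ℝ B) (hskew : ∀ q u v : E, ⟪B q u, v⟫ = -⟪B q v, u⟫)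
    (x w a u : E) : ⟪fderiv ℝ B x w a, u⟫ = -⟪fderiv ℝ B x w u, a⟫ := by
  have key : ∀ a u : E, HasDerivAt (fun t : ℝ => ⟪B (x + t • w) a, u⟫) ⟪fderiv ℝ B x w a, u⟫ 0 := by
    intro a u
    have hl : HasDerivAt (fun t : ℝ => x + t • w) w 0 := by
      simpa using ((hasDerivAt_id (0 : ℝ)).smul_const w).const_add x
    have h2 : HasFDerivAt B (fderiv ℝ B x) (x + (0 : ℝ) • w) := by
      simpa using (hB x).hasFDerivAt
    have h3 := h2.comp_hasDerivAt (0 : ℝ) hl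
    have h4 := (h3.clm_apply (hasDerivAt_const (0 : ℝ) a)).inner ℝ (hasDerivAt_const (0 : ℝ) u)
    simpa using h4
  have h1 := key a u
  have h2 := (key u a).neg
  have : (fun t : ℝ => ⟪B (x + t • w) a, u⟫) = -(fun t : ℝ => ⟪B (x + t • w) u, a⟫) := by
    funext t; exact hskew _ _ _
  rw [this] at h1
  exact h1.unique h2

lemma dB_key (hB : Differentiable ℝ B) (hskew : ∀ q u v : E, ⟪B q u, v⟫ = -⟪B q v, u⟫)
    (hcl : ∀ q u v w : E,
      ⟪(fderiv ℝ B q u) v, w⟫ + ⟪(fderiv ℝ B q v) w, u⟫ + ⟪(fderiv ℝ B q w) u, v⟫ = 0)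
    (x a u v : E) : ⟪fderiv ℝ B x u a, v⟫ - ⟪fderiv ℝ B x v a, u⟫ = ⟪fderiv ℝ B x a u, v⟫ := by
  have h1 := hcl x u a v
  have h2 := dB_skew hB hskew x v a u
  have h3 := dB_skew hB hskew x a u v
  linarith

set_option maxHeartbeats 1000000 in
lemma exists_theta (b : Module.Basis ι ℝ E) (hB : ContDiff ℝ (⊤ : ℕ∞) B)
    (hper : ∀ m ∈ lat b, ∀ q, B (q + m) = B q)
    (hskew : ∀ q u v : E, ⟪B q u, v⟫ = -⟪B q v, u⟫)
    (hcl : ∀ q u v w : E,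
      ⟪(fderiv ℝ B q u) v, w⟫ + ⟪(fderiv ℝ B q v) w, u⟫ + ⟪(fderiv ℝ B q w) u, v⟫ = 0) :
    ∃ θ : E → E, ContDiff ℝ (⊤ : ℕ∞) θ ∧
      (∀ q u v : E, ⟪fderiv ℝ θ q u, v⟫ - ⟪fderiv ℝ θ q v, u⟫ = ⟪B q u, v⟫) ∧
      ∃ K, Gauge (lat b) θ (fderiv ℝ θ) K := by
  have hPE := FiniteDimensional.proper ℝ E
  have hBd : Differentiable ℝ B := hB.differentiable (by simp)
  obtain ⟨ν, hν⟩ : ∃ ν : Measure E, ν.IsAddHaarMeasure := ⟨Measure.addHaar, inferInstance⟩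
  set D := ZSpan.fundamentalDomain b with hDdef
  have hDm : MeasurableSet D := ZSpan.fundamentalDomain_measurableSet b
  have hD0 : ν D ≠ 0 := ZSpan.measure_fundamentalDomain_ne_zero b
  have hDfin : ν D < ⊤ := (ZSpan.fundamentalDomain_isBounded b).measure_lt_top
  haveI : IsFiniteMeasure (ν.restrict D) := ⟨by simpa using hDfin⟩
  set μ : Measure (E × ℝ) := (ν.restrict D).prod (volume.restrict (Ioc (0 : ℝ) 1)) with hμ
  have hK : IsCompact (closure D ×ˢ Icc (0 : ℝ) 1) := (fd_compact b).prod isCompact_Icc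
  have hμK : ∀ᵐ z ∂μ, z ∈ closure D ×ˢ Icc (0 : ℝ) 1 := by
    rw [hμ, Measure.prod_restrict]
    refine (ae_restrict_mem (hDm.prod measurableSet_Ioc)).mono fun z hz => ?_
    exact ⟨subset_closure hz.1, Ioc_subset_Icc_self hz.2⟩
  set c : ℝ := (ν.real D)⁻¹ with hc
  have hcD : c * ν.real D = 1 := inv_mul_cancel₀ (by
    rw [measureReal_def]; exact (ENNReal.toReal_pos hD0 hDfin.ne).ne')
  have hDK : ∀ᵐ a ∂(ν.restrict D), a ∈ closure D :=
    (ae_restrict_mem hDm).mono fun a ha => subset_closure ha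
  set f : E × (E × ℝ) → E := fun z => B (z.1 + z.2.2 • z.2.1) z.2.1 with hf
  have hfs : ContDiff ℝ (⊤ : ℕ∞) f := by
    refine (hB.comp ?_).clm_apply (by fun_prop)
    fun_prop
  set Bb : E →L[ℝ] E := c • ∫ a in D, B a ∂ν with hBb
  set η : E → E := fun q => ∫ z, f (q, z) ∂μ with hη
  have hηs : ContDiff ℝ (⊤ : ℕ∞) η := par_smooth hK hμK hfs
  have hηd : Differentiable ℝ η := hηs.differentiable (by simp)
  have hηper : ∀ m ∈ lat b, ∀ q, η (q + m) = η q := by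
    intro m hm q
    refine integral_congr_ae (Eventually.of_forall fun z => ?_)
    show B (q + m + z.2 • z.1) z.1 = B (q + z.2 • z.1) z.1
    rw [add_right_comm, hper m hm]
  have hBb_inner : ∀ u v, ⟪Bb u, v⟫ = c * ∫ a in D, ⟪B a u, v⟫ ∂ν := by
    intro u v
    have h1 : Integrable B (ν.restrict D) := par_integrable (fd_compact b) hDK hB.continuous
    have h2 := ((innerSL ℝ v).comp (ContinuousLinearMap.apply ℝ E u)).integral_comp_comm h1
    rw [hBb, ContinuousLinearMap.smul_apply, real_inner_smul_left, real_inner_comm]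
    congr 1
    simp only [ContinuousLinearMap.comp_apply, ContinuousLinearMap.apply_apply, innerSL_apply_apply] at h2
    rw [← h2]
    exact integral_congr_ae (Eventually.of_forall fun a => real_inner_comm _ _)
  have hηD : ∀ q u v, ⟪fderiv ℝ η q u, v⟫ = ∫ z, ⟪fderiv ℝ B (q + z.2 • z.1) u z.1, v⟫ ∂μ := by
    intro q u v
    rw [(par_hasFDeriv hK hμK hfs q).fderiv]
    have hc' : Continuous fun z : E × (E × ℝ) =>
        (fderiv ℝ f z).comp (ContinuousLinearMap.inl ℝ E (E × ℝ)) :=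
      (hfs.continuous_fderiv (by simp)).clm_comp continuous_const
    have h1 : Integrable (fun z => (fderiv ℝ f (q, z)).comp (ContinuousLinearMap.inl ℝ E (E × ℝ))) μ :=
      par_integrable hK hμK (hc'.comp (by fun_prop))
    have h2 := ((innerSL ℝ v).comp (ContinuousLinearMap.apply ℝ E u)).integral_comp_comm h1
    rw [real_inner_comm]
    simp only [ContinuousLinearMap.comp_apply, ContinuousLinearMap.apply_apply, innerSL_apply_apply] at h2
    rw [← h2]
    refine integral_congr_ae (Eventually.of_forall fun z => ?_)
    show ⟪v, fderiv ℝ f (q, z) (ContinuousLinearMap.inl ℝ E (E × ℝ) u)⟫ = _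
    rw [real_inner_comm]
    congr 1
    have h0 : HasFDerivAt (fun q' : E => (q', z)) (ContinuousLinearMap.inl ℝ E (E × ℝ)) q :=
      (hasFDerivAt_id (𝕜 := ℝ) q).prodMk (hasFDerivAt_const z q)
    have h3 : HasFDerivAt f (fderiv ℝ f (q, z)) ((fun q' : E => (q', z)) q) :=
      (hfs.differentiable (by simp) _).hasFDerivAt
    have h4 := h3.comp q h0
    have h5 : HasFDerivAt (fun q' : E => q' + z.2 • z.1) (ContinuousLinearMap.id ℝ E) q :=
      (hasFDerivAt_id q).add_const _
    have h6 : HasFDerivAt (fun q' : E => B (q' + z.2 • z.1)) (fderiv ℝ B (q + z.2 • z.1)) q :=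
      (hBd (q + z.2 • z.1)).hasFDerivAt.comp q h5
    have h7 := h6.clm_apply (hasFDerivAt_const z.1 q)
    have h8 := h4.unique h7
    have h9 := congrArg (fun L => L u) h8
    simpa using h9
  have hdB : Continuous (fderiv ℝ B) := hB.continuous_fderiv (by simp)
  have hdη : ∀ q u v, c * (⟪fderiv ℝ η q u, v⟫ - ⟪fderiv ℝ η q v, u⟫) = ⟪Bb u, v⟫ - ⟪B q u, v⟫ := by
    intro q u v
    have hi : ∀ u v : E, Integrable (fun z : E × ℝ => ⟪fderiv ℝ B (q + z.2 • z.1) u z.1, v⟫) μ := by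
      intro u v
      refine par_integrable hK hμK ?_
      have : Continuous fun z : E × ℝ => fderiv ℝ B (q + z.2 • z.1) := hdB.comp (by fun_prop)
      exact ((this.clm_apply continuous_const).clm_apply continuous_fst).inner continuous_const
    have hi2 : Integrable (fun z : E × ℝ => ⟪fderiv ℝ B (q + z.2 • z.1) z.1 u, v⟫) μ := by
      refine par_integrable hK hμK ?_
      have : Continuous fun z : E × ℝ => fderiv ℝ B (q + z.2 • z.1) := hdB.comp (by fun_prop)
      exact ((this.clm_apply continuous_fst).clm_apply continuous_const).inner continuous_const
    rw [hηD, hηD, ← integral_sub (hi u v) (hi v u)]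
    simp_rw [dB_key hBd hskew hcl]
    rw [hμ, integral_prod _ hi2]
    have hFTC : ∀ a : E, ∫ s in Ioc (0 : ℝ) 1, ⟪fderiv ℝ B (q + s • a) a u, v⟫ =
        ⟪B (q + a) u, v⟫ - ⟪B q u, v⟫ := by
      intro a
      rw [← intervalIntegral.integral_of_le zero_le_one]
      have hd : ∀ s : ℝ, HasDerivAt (fun s : ℝ => ⟪B (q + s • a) u, v⟫)
          ⟪fderiv ℝ B (q + s • a) a u, v⟫ s := by
        intro s
        have hl : HasDerivAt (fun t : ℝ => q + t • a) a s := by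
          simpa using ((hasDerivAt_id s).smul_const a).const_add q
        have h3 := (hBd (q + s • a)).hasFDerivAt.comp_hasDerivAt s hl
        have h4 := (h3.clm_apply (hasDerivAt_const s u)).inner ℝ (hasDerivAt_const s v)
        simpa using h4
      have hcont : Continuous fun s : ℝ => ⟪fderiv ℝ B (q + s • a) a u, v⟫ := by
        have : Continuous fun s : ℝ => fderiv ℝ B (q + s • a) := hdB.comp (by fun_prop)
        exact ((this.clm_apply continuous_const).clm_apply continuous_const).inner continuous_const
      rw [intervalIntegral.integral_eq_sub_of_hasDerivAt (fun s _ => hd s)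
        (hcont.intervalIntegrable _ _)]
      simp
    simp only [hFTC]
    have hcB : Continuous fun a : E => ⟪B (q + a) u, v⟫ := by
      have : Continuous fun a : E => B (q + a) := hB.continuous.comp (by fun_prop)
      exact (this.clm_apply continuous_const).inner continuous_const
    rw [integral_sub (par_integrable (fd_compact b) hDK hcB) (integrable_const _),
      integral_const, avg_trans b ν (g := fun a => ⟪B a u, v⟫) (fun m hm q => by rw [hper m hm]) q,
      mul_sub, ← hBb_inner, smul_eq_mul, measureReal_restrict_apply_univ, ← mul_assoc, hcD, one_mul]
  have hBbskew : ∀ u v, ⟪Bb u, v⟫ = -⟪Bb v, u⟫ := by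
    intro u v
    rw [hBb_inner, hBb_inner, ← mul_neg, ← integral_neg]
    congr 1
    exact integral_congr_ae (Eventually.of_forall fun a => hskew a u v)
  set θ : E → E := fun q => (1 / 2 : ℝ) • Bb q - c • η q with hθ
  have hθs : ContDiff ℝ (⊤ : ℕ∞) θ := by
    exact (Bb.contDiff.const_smul (1 / 2 : ℝ)).sub (hηs.const_smul c)
  have hθd : Differentiable ℝ θ := hθs.differentiable (by simp)
  have hθD : ∀ q, HasFDerivAt θ ((1 / 2 : ℝ) • Bb - c • fderiv ℝ η q) q := fun q =>
    (Bb.hasFDerivAt.const_smul (1 / 2 : ℝ)).sub ((hηd q).hasFDerivAt.const_smul c)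
  have hθper : ∀ m ∈ lat b, ∀ q, θ (q + m) = θ q + (1 / 2 : ℝ) • Bb m := by
    intro m hm q
    simp only [hθ, hηper m hm, map_add, smul_add]
    abel
  have hper' : ∀ m ∈ lat b, ∀ q, fderiv ℝ θ (q + m) = fderiv ℝ θ q := by
    intro m hm q
    rw [← fderiv_comp_add_right m (f := θ)]
    simp_rw [hθper m hm]
    rw [fderiv_add_const]
  refine ⟨θ, hθs, ?_, ?_⟩
  · intro q u v
    rw [(hθD q).fderiv]
    have h1 := hdη q u v
    have h2 := hBbskew u v
    simp only [ContinuousLinearMap.sub_apply, ContinuousLinearMap.smul_apply, inner_sub_left,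
      real_inner_smul_left]
    linarith
  · have hcont : Continuous (fderiv ℝ θ) := hθs.continuous_fderiv (by simp)
    obtain ⟨K, hK0⟩ := (fd_compact b).exists_bound_of_continuousOn hcont.continuousOn
    refine ⟨K, fun q => (hθd q).hasFDerivAt, hcont, fun m hm => ⟨_, hθper m hm⟩, hper', fun q => ?_⟩
    obtain ⟨m, hm, hmQ⟩ := fd_cover b q
    rw [← hper' m hm]
    exact hK0 _ hmQ

end theta
end MT

end ModuleV2

section ModuleW
open Filter Topology Set MeasureTheory
open scoped RealInnerProductSpace ENNReal
set_option linter.unusedSectionVars false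
set_option linter.unusedVariables false
namespace MT

section assembly
variable {E : Type} [NormedAddCommGroup E] [InnerProductSpace ℝ E] [FiniteDimensional ℝ E]
  [MeasurableSpace E] [BorelSpace E] [CompleteSpace E]
variable {Λ : AddSubgroup E}

lemma small_boxes {H : E × E → ℝ} (hH : Continuous H)
    (hper : ∀ m ∈ Λ, ∀ q p, H (q + m, p) = H (q, p)) {Q : Set E} (hQ : IsCompact Q)
    (hQΛ : ∀ x, ∃ m ∈ Λ, x + m ∈ Q) {a : ℝ} (hlow : ∀ q, ∃ p, H (q, p) < a) :
    ∃ c > 0, ∀ q0, ∃ p0, ∀ q p, ‖q - q0‖ ≤ c → ‖p - p0‖ ≤ c → H (q, p) ≤ a := by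
  have key : ∃ c > 0, ∀ q0 ∈ Q, ∃ p0, ∀ q p, ‖q - q0‖ ≤ c → ‖p - p0‖ ≤ c → H (q, p) ≤ a := by
    refine hQ.induction_on (p := fun S => ∃ c > 0, ∀ q0 ∈ S, ∃ p0, ∀ q p, ‖q - q0‖ ≤ c →
      ‖p - p0‖ ≤ c → H (q, p) ≤ a) ⟨1, one_pos, by simp⟩ ?_ ?_ ?_
    · rintro s t hst ⟨c, hc, h⟩
      exact ⟨c, hc, fun q0 hq0 => h q0 (hst hq0)⟩
    · rintro s t ⟨c, hc, h⟩ ⟨c', hc', h'⟩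
      refine ⟨min c c', lt_min hc hc', fun q0 hq0 => ?_⟩
      rcases hq0 with hq0 | hq0
      · obtain ⟨p0, hp0⟩ := h q0 hq0
        exact ⟨p0, fun q p h1 h2 => hp0 q p (h1.trans (min_le_left _ _)) (h2.trans (min_le_left _ _))⟩
      · obtain ⟨p0, hp0⟩ := h' q0 hq0
        exact ⟨p0, fun q p h1 h2 => hp0 q p (h1.trans (min_le_right _ _)) (h2.trans (min_le_right _ _))⟩
    · intro x hx
      obtain ⟨p0, hp0⟩ := hlow x
      have ho : {z : E × E | H z < a} ∈ 𝓝 (x, p0) := (isOpen_lt hH continuous_const).mem_nhds hp0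
      obtain ⟨ε, hε, hball⟩ := Metric.mem_nhds_iff.1 ho
      refine ⟨Metric.ball x (ε / 2), mem_nhdsWithin_of_mem_nhds (Metric.ball_mem_nhds _ (half_pos hε)),
        ε / 3, by positivity, fun q0 hq0 => ⟨p0, fun q p h1 h2 => ?_⟩⟩
      have hmem : (q, p) ∈ Metric.ball (x, p0) ε := by
        rw [Metric.mem_ball, dist_eq_norm] at hq0
        rw [Metric.mem_ball, Prod.dist_eq, dist_eq_norm, dist_eq_norm]
        refine max_lt ?_ ?_
        · have := norm_sub_le_norm_sub_add_norm_sub q q0 x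
          show ‖q - x‖ < ε
          linarith
        · show ‖p - p0‖ < ε
          linarith
      exact (hball hmem).le
  obtain ⟨c, hc, h⟩ := key
  refine ⟨c, hc, fun q0 => ?_⟩
  obtain ⟨m, hm, hmQ⟩ := hQΛ q0
  obtain ⟨p0, hp0⟩ := h _ hmQ
  refine ⟨p0, fun q p h1 h2 => ?_⟩
  rw [← hper m hm]
  exact hp0 _ _ (by simpa using h1) h2

/-- Periodic orbits for the twisted flow, conclusion of the main theorem. -/
def Orb (H : E × E → ℝ) (B : E → E →L[ℝ] E) (k : ℝ) : Prop :=
  ∃ T : ℝ, 0 < T ∧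
    ∃ q p : ℝ → E,
      ContDiff ℝ (⊤ : ℕ∞) q ∧ ContDiff ℝ (⊤ : ℕ∞) p ∧
      Function.Periodic q T ∧ Function.Periodic p T ∧
      (∃ t₁ t₂ : ℝ, (q t₁, p t₁) ≠ (q t₂, p t₂)) ∧
      (∀ t : ℝ, deriv q t = gradient (fun p' => H (q t, p')) (p t)) ∧
      (∀ t : ℝ, deriv p t =
        -gradient (fun q' => H (q', p t)) (q t)
          - B (q t) (gradient (fun p' => H (q t, p')) (p t))) ∧
      (∀ t : ℝ, H (q t, p t) = k)

lemma ode_smooth {F : Type*} [NormedAddCommGroup F] [NormedSpace ℝ F] {Y : F → F}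
    (hY : ContDiff ℝ (⊤ : ℕ∞) Y) {z : ℝ → F} (hz : ∀ t, HasDerivAt z (Y (z t)) t) :
    ContDiff ℝ (⊤ : ℕ∞) z := by
  refine contDiff_infty.2 fun n => ?_
  induction n with
  | zero =>
    rw [Nat.cast_zero, contDiff_zero]
    exact continuous_iff_continuousAt.2 fun t => (hz t).continuousAt
  | succ n ih =>
    push_cast
    rw [contDiff_succ_iff_deriv]
    refine ⟨fun t => (hz t).differentiableAt, by simp, ?_⟩
    have : deriv z = Y ∘ z := funext fun t => (hz t).deriv
    rw [this]
    exact (contDiff_infty.1 hY n).comp ih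

lemma orb_of_hasOrbit {H : E × E → ℝ} {B : E → E →L[ℝ] E} {θ : E → E}
    (hH : ContDiff ℝ (⊤ : ℕ∞) H) (P : PreTame Λ H (gq H) (gp H))
    (hB : ContDiff ℝ (⊤ : ℕ∞) B) (hθ : ContDiff ℝ (⊤ : ℕ∞) θ)
    (hθB : ∀ q u v : E, ⟪fderiv ℝ θ q u, v⟫ - ⟪fderiv ℝ θ q v, u⟫ = ⟪B q u, v⟫)
    {k : E × E → ℝ} {kq kp : E × E → E} {R l e : ℝ}
    (hk : ∀ z, HasFDerivAt k (pairL (kq z) (kp z)) z)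
    (hkl : ∀ z, R ≤ ‖z.2‖ → l < k z) (hkH : ∀ z, ‖z.2‖ < R → k z = H z)
    (hel : e ≤ l) (hlow : ∀ q, ∃ p, H (q, p) < e)
    (ho : HasOrbit k kq kp θ (fderiv ℝ θ) e) : Orb H B e := by
  obtain ⟨S, hS, X, Pm, hXper, hPper, hX, hP, hen⟩ := ho
  set p : ℝ → E := fun t => Pm t - θ (X t) with hp
  have hHd : Differentiable ℝ H := hH.differentiable (by simp)
  have hθd : Differentiable ℝ θ := hθ.differentiable (by simp)
  have hR : ∀ t, ‖p t‖ < R := by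
    intro t
    by_contra hcon
    push Not at hcon
    have h1 := hkl (X t, p t) hcon
    have h2 := hen t
    change k (X t, p t) = e at h2
    linarith
  have hgr : ∀ z : E × E, ‖z.2‖ < R → kq z = gq H z ∧ kp z = gp H z := by
    intro z hz
    have hop : IsOpen {z : E × E | ‖z.2‖ < R} := isOpen_lt (by fun_prop) continuous_const
    have hev : k =ᶠ[𝓝 z] H := by
      filter_upwards [hop.mem_nhds hz] with y hy using hkH y hy
    have h1 := (hasD_pair hHd z).congr_of_eventuallyEq hev
    exact pairL_inj ((hk z).unique h1)
  have hXd : ∀ t, HasDerivAt X (gp H (X t, p t)) t := by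
    intro t
    refine (hX t).congr_deriv ?_
    exact (hgr (X t, p t) (hR t)).2
  have hpd : ∀ t, HasDerivAt p (-gq H (X t, p t) - B (X t) (gp H (X t, p t))) t := by
    intro t
    have h1 := (hP t).sub ((hθd (X t)).hasFDerivAt.comp_hasDerivAt t (hXd t))
    refine h1.congr_deriv ?_
    rw [show (kq (X t, Pm t - θ (X t))) = gq H (X t, p t) from (hgr (X t, p t) (hR t)).1,
      show (kp (X t, Pm t - θ (X t))) = gp H (X t, p t) from (hgr (X t, p t) (hR t)).2]
    set w := gp H (X t, p t)
    have h2 : B (X t) w = fderiv ℝ θ (X t) w - ContinuousLinearMap.adjoint (fderiv ℝ θ (X t)) w := by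
      refine ext_inner_right ℝ fun v => ?_
      rw [← hθB, inner_sub_left, ContinuousLinearMap.adjoint_inner_left, real_inner_comm w]
    rw [h2]
    abel
  have hen' : ∀ t, H (X t, p t) = e := fun t => (hkH (X t, p t) (hR t)).symm.trans (hen t)
  have hz : ContDiff ℝ (⊤ : ℕ∞) (fun t => (X t, p t)) := by
    refine ode_smooth (Y := fun z : E × E => (gp H z, -gq H z - B z.1 (gp H z))) ?_ fun t =>
      (hXd t).prodMk (hpd t)
    exact (gp_smooth hH).prodMk ((gq_smooth hH).neg.sub
      ((hB.comp contDiff_fst).clm_apply (gp_smooth hH)))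
  refine ⟨S, hS, X, p, contDiff_fst.comp hz, contDiff_snd.comp hz, hXper, ?_, ?_, ?_, ?_, hen'⟩
  · intro t
    show Pm (t + S) - θ (X (t + S)) = Pm t - θ (X t)
    rw [hPper t, hXper t]
  · by_contra hcon
    push Not at hcon
    have hc : X = fun _ => X 0 := funext fun t => (Prod.ext_iff.1 (hcon t 0)).1
    have h0 : gp H (X 0, p 0) = 0 := by
      have h1 := hXd 0
      rw [hc] at h1
      exact h1.unique (hasDerivAt_const _ _)
    obtain ⟨p', hp'⟩ := hlow (X 0)
    have hne : p 0 ≠ p' := by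
      rintro rfl
      have := hen' 0
      linarith
    have h2 := P.tan (X 0) (p 0) p' hne
    rw [h0, inner_zero_left, hen' 0] at h2
    linarith
  · exact fun t => (hXd t).deriv
  · exact fun t => (hpd t).deriv

lemma sub_grad_primitive {B : E → E →L[ℝ] E} {θ : E → E} (hθ : ContDiff ℝ (⊤ : ℕ∞) θ)
    (hθB : ∀ q u v : E, ⟪fderiv ℝ θ q u, v⟫ - ⟪fderiv ℝ θ q v, u⟫ = ⟪B q u, v⟫)
    {w : E → ℝ} (hw : ContDiff ℝ (⊤ : ℕ∞) w) (q u v : E) :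
    ⟪fderiv ℝ (fun q => θ q - gradient w q) q u, v⟫ -
      ⟪fderiv ℝ (fun q => θ q - gradient w q) q v, u⟫ = ⟪B q u, v⟫ := by
  have hg := grad_smooth hw
  have hgd : Differentiable ℝ (gradient w) := hg.differentiable (by simp)
  have hw2 : Differentiable ℝ (fderiv ℝ w) :=
    (hw.fderiv_right (m := (⊤ : ℕ∞)) (by simp)).differentiable (by simp)
  have key : ∀ u v : E, ⟪fderiv ℝ (gradient w) q u, v⟫ = fderiv ℝ (fderiv ℝ w) q u v := by
    intro u v
    have h1 : HasFDerivAt (fun x => fderiv ℝ w x v)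
        ((ContinuousLinearMap.apply ℝ ℝ v).comp (fderiv ℝ (fderiv ℝ w) q)) q :=
      (ContinuousLinearMap.apply ℝ ℝ v).hasFDerivAt.comp q (hw2 q).hasFDerivAt
    have h2 := (innerSL ℝ v).hasFDerivAt.comp q (hgd q).hasFDerivAt
    have h3 : (innerSL ℝ v ∘ gradient w) = fun x => fderiv ℝ w x v := by
      funext x
      show ⟪v, gradient w x⟫ = _
      rw [real_inner_comm, inner_grad]
    rw [h3] at h2
    have h4 := congrArg (fun L => L u) (h2.unique h1)
    rw [real_inner_comm]
    simpa using h4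
  have hsym := second_derivative_symmetric
    (fun y => (hw.differentiable (by simp) y).hasFDerivAt) (hw2 q).hasFDerivAt u v
  have hd : fderiv ℝ (fun q => θ q - gradient w q) q = fderiv ℝ θ q - fderiv ℝ (gradient w) q :=
    ((hθ.differentiable (by simp) q).hasFDerivAt.sub (hgd q).hasFDerivAt).fderiv
  rw [hd]
  have e1 : ∀ a c : E, ⟪(fderiv ℝ θ q - fderiv ℝ (gradient w) q) a, c⟫ =
      ⟪fderiv ℝ θ q a, c⟫ - ⟪fderiv ℝ (gradient w) q a, c⟫ := fun a c => by
    rw [← inner_sub_left]; rfl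
  rw [e1, e1, key, key, hsym, ← hθB q u v]
  ring

lemma core {ι : Type} [Fintype ι] (bs : Module.Basis ι ℝ E) {H : E × E → ℝ} {B : E → E →L[ℝ] E}
    (hH : ContDiff ℝ (⊤ : ℕ∞) H)
    (hper : ∀ m ∈ lat bs, ∀ q p, H (q + m, p) = H (q, p))
    (hconv : ∀ (q p v : E), v ≠ 0 → 0 < iteratedFDeriv ℝ 2 (fun p' => H (q, p')) p ![v, v])
    (hsuper : ∀ A : ℝ, 0 < A → ∃ C : ℝ, ∀ q p, A * ‖p‖ - C ≤ H (q, p))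
    (hB : ContDiff ℝ (⊤ : ℕ∞) B) (hBper : ∀ m ∈ lat bs, ∀ q, B (q + m) = B q)
    (hskew : ∀ q u v : E, ⟪B q u, v⟫ = -⟪B q v, u⟫)
    (hcl : ∀ q u v w : E,
      ⟪(fderiv ℝ B q u) v, w⟫ + ⟪(fderiv ℝ B q v) w, u⟫ + ⟪(fderiv ℝ B q w) u, v⟫ = 0)
    {a b b' : ℝ} (hab : a < b) (hbb : b < b') (hlow : ∀ q, ∃ p, H (q, p) < a)
    (hhigh : ¬ ∃ θ : E → E, ContDiff ℝ (⊤ : ℕ∞) θ ∧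
      (∀ q u v : E, ⟪fderiv ℝ θ q u, v⟫ - ⟪fderiv ℝ θ q v, u⟫ = ⟪B q u, v⟫) ∧
      ∀ q, H (q, -θ q) ≤ b') :
    ∀ᵐ k ∂(volume : Measure ℝ), k ∈ Ioo a b → Orb H B k := by
  have P := preTame_of_smooth (Λ := lat bs) hH hper hconv hsuper
  obtain ⟨θ, hθ, hθB, K, G⟩ := exists_theta bs hB hBper hskew hcl
  obtain ⟨R, C, k, kq, kp, Tm, hHl, hkl, hkH⟩ := tame_ext P (fd_compact bs) (fd_cover bs) b'
  obtain ⟨c, hc, hbox⟩ := small_boxes hH.continuous hper (fd_compact bs) (fd_cover bs) hlow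
  have hsm : ∀ q0, ∃ p0, ∀ q p, ‖q - q0‖ ≤ c → ‖p - p0‖ ≤ c → k (q, p) ≤ a := by
    intro q0
    obtain ⟨p0, hp0⟩ := hbox q0
    refine ⟨p0, fun q p h1 h2 => ?_⟩
    have h3 := hp0 q p h1 h2
    have h4 : ‖p‖ < R := by
      by_contra hcon
      push Not at hcon
      have := hHl (q, p) hcon
      linarith
    rw [hkH (q, p) h4]
    exact h3
  rcases mane_dichotomy Tm G hbb with ⟨x, r, hr, hre⟩ | ⟨w, hw, hwb⟩
  · obtain ⟨Ts, V, hTs, hV, hneg⟩ := loops_of_reach Tm G hre hr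
    filter_upwards [ae_orbit Tm G (fd_compact bs) (fd_cover bs) hc hab hsm hTs hV hneg] with e he hme
    refine orb_of_hasOrbit hH P hB hθ hθB Tm.hasD hkl hkH (hme.2.trans hbb).le (fun q => ?_) (he hme)
    obtain ⟨p, hp⟩ := hlow q
    exact ⟨p, hp.trans hme.1⟩
  · exfalso
    refine hhigh ⟨fun q => θ q - gradient w q, hθ.sub (grad_smooth hw),
      sub_grad_primitive hθ hθB hw, fun q => ?_⟩
    have h1 := hwb q
    have h4 : ‖gradient w q - θ q‖ < R := by
      by_contra hcon
      push Not at hcon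
      have := hkl (q, gradient w q - θ q) hcon
      linarith
    rw [hkH (q, _) h4] at h1
    rwa [neg_sub]

end assembly
end MT

end ModuleW

/-- Theorem 1.3 of the paper instantiated on the flat torus `𝕋ⁿ`, in lifted
coordinates on `ℝⁿ = EuclideanSpace ℝ (Fin n)`.

`H` is a Tonelli Hamiltonian on `𝕋ⁿ` (smooth, `ℤⁿ`-periodic in `q`, fibrewise
positive-definite second derivative, uniformly superlinear in `p`) and `B` is a
magnetic field on `𝕋ⁿ` (smooth, `ℤⁿ`-periodic, pointwise skew-symmetric,
closed).  Then for Lebesgue-almost every `k` with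
`e₀(H) < k < c(H,B)` (where `e₀(H) = sup_q inf_p H(q,p)` and `c(H,B)` is the
Mañé critical value, an extended real number) there is a nonconstant smooth
periodic solution of the twisted Hamilton equations with energy `k`. -/
theorem contractible_periodic_orbit_on_torus_below_mane_value
    (n : ℕ)
    (H : EuclideanSpace ℝ (Fin n) × EuclideanSpace ℝ (Fin n) → ℝ)
    (B : EuclideanSpace ℝ (Fin n) →
      EuclideanSpace ℝ (Fin n) →L[ℝ] EuclideanSpace ℝ (Fin n))
    (hHsmooth : ContDiff ℝ (⊤ : ℕ∞) H)
    (hHper : ∀ (m : Fin n → ℤ) (q p : EuclideanSpace ℝ (Fin n)),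
      H (q + (EuclideanSpace.equiv (Fin n) ℝ).symm (fun i => (m i : ℝ)), p) = H (q, p))
    (hHconv : ∀ (q p v : EuclideanSpace ℝ (Fin n)), v ≠ 0 →
      0 < iteratedFDeriv ℝ 2 (fun p' => H (q, p')) p ![v, v])
    (hHsuper : ∀ A : ℝ, 0 < A → ∃ C : ℝ, ∀ q p, A * ‖p‖ - C ≤ H (q, p))
    (hBsmooth : ContDiff ℝ (⊤ : ℕ∞) B)
    (hBper : ∀ (m : Fin n → ℤ) (q : EuclideanSpace ℝ (Fin n)),
      B (q + (EuclideanSpace.equiv (Fin n) ℝ).symm (fun i => (m i : ℝ))) = B q)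
    (hBskew : ∀ q u v : EuclideanSpace ℝ (Fin n), ⟪B q u, v⟫ = -⟪B q v, u⟫)
    (hBclosed : ∀ q u v w : EuclideanSpace ℝ (Fin n),
      ⟪(fderiv ℝ B q u) v, w⟫ + ⟪(fderiv ℝ B q v) w, u⟫ + ⟪(fderiv ℝ B q w) u, v⟫ = 0) :
    ∀ᵐ k ∂(volume : Measure ℝ),
      ((⨆ q : EuclideanSpace ℝ (Fin n), ⨅ p : EuclideanSpace ℝ (Fin n), H (q, p)) < k ∧
        (k : EReal) <
          sInf {c : EReal |
            ∃ θ : EuclideanSpace ℝ (Fin n) → EuclideanSpace ℝ (Fin n),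
              ContDiff ℝ (⊤ : ℕ∞) θ ∧
              (∀ q u v : EuclideanSpace ℝ (Fin n),
                ⟪fderiv ℝ θ q u, v⟫ - ⟪fderiv ℝ θ q v, u⟫ = ⟪B q u, v⟫) ∧
              c = ⨆ q : EuclideanSpace ℝ (Fin n), ((H (q, -θ q) : ℝ) : EReal)}) →
      ∃ T : ℝ, 0 < T ∧
        ∃ q p : ℝ → EuclideanSpace ℝ (Fin n),
          ContDiff ℝ (⊤ : ℕ∞) q ∧ ContDiff ℝ (⊤ : ℕ∞) p ∧
          Function.Periodic q T ∧ Function.Periodic p T ∧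
          (∃ t₁ t₂ : ℝ, (q t₁, p t₁) ≠ (q t₂, p t₂)) ∧
          (∀ t : ℝ, deriv q t = gradient (fun p' => H (q t, p')) (p t)) ∧
          (∀ t : ℝ, deriv p t =
            -gradient (fun q' => H (q', p t)) (q t)
              - B (q t) (gradient (fun p' => H (q t, p')) (p t))) ∧
          (∀ t : ℝ, H (q t, p t) = k) := by
  classical
  set bs : Module.Basis (Fin n) ℝ (EuclideanSpace ℝ (Fin n)) :=
    (EuclideanSpace.basisFun (Fin n) ℝ).toBasis with hbs
  have hlat : ∀ m ∈ MT.lat bs, ∃ z : Fin n → ℤ,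
      m = (EuclideanSpace.equiv (Fin n) ℝ).symm (fun i => (z i : ℝ)) := by
    intro m hm
    have h1 : ∀ i, bs.repr m i ∈ Set.range (algebraMap ℤ ℝ) :=
      (Module.Basis.mem_span_iff_repr_mem ℤ bs m).1 hm
    choose z hz using h1
    refine ⟨z, ?_⟩
    ext i
    have h2 := hz i
    simp only [hbs, OrthonormalBasis.coe_toBasis_repr_apply, EuclideanSpace.basisFun_repr] at h2
    simpa using h2.symm
  have hper : ∀ m ∈ MT.lat bs, ∀ q p, H (q + m, p) = H (q, p) := by
    intro m hm q p
    obtain ⟨z, rfl⟩ := hlat m hm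
    exact hHper z q p
  have hBper' : ∀ m ∈ MT.lat bs, ∀ q, B (q + m) = B q := by
    intro m hm q
    obtain ⟨z, rfl⟩ := hlat m hm
    exact hBper z q
  have hbelow : ∀ q, BddBelow (Set.range fun p => H (q, p)) := by
    intro q
    obtain ⟨C, hC⟩ := hHsuper 1 one_pos
    refine ⟨-C, ?_⟩
    rintro _ ⟨p, rfl⟩
    have := hC q p
    have := norm_nonneg p
    show -C ≤ H (q, p)
    linarith
  have habove : BddAbove (Set.range fun q => ⨅ p, H (q, p)) := by
    obtain ⟨c, hc0, hc⟩ := MT.bound_on (MT.fd_compact bs) (MT.fd_cover bs) hHsmooth.continuous hper 0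
    refine ⟨c, ?_⟩
    rintro _ ⟨q, rfl⟩
    refine (ciInf_le (hbelow q) 0).trans ?_
    have := hc q 0 (by simp)
    exact (le_abs_self _).trans this
  have hall : ∀ r : ℚ × ℚ × ℚ, ∀ᵐ k ∂(volume : Measure ℝ),
      ((r.1 : ℝ) < r.2.1 ∧ (r.2.1 : ℝ) < r.2.2 ∧ (∀ q, ∃ p, H (q, p) < (r.1 : ℝ)) ∧
        ¬ ∃ θ : EuclideanSpace ℝ (Fin n) → EuclideanSpace ℝ (Fin n), ContDiff ℝ (⊤ : ℕ∞) θ ∧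
          (∀ q u v, ⟪fderiv ℝ θ q u, v⟫ - ⟪fderiv ℝ θ q v, u⟫ = ⟪B q u, v⟫) ∧
          ∀ q, H (q, -θ q) ≤ (r.2.2 : ℝ)) →
      k ∈ Set.Ioo (r.1 : ℝ) r.2.1 → MT.Orb H B k := by
    intro r
    by_cases hr : ((r.1 : ℝ) < r.2.1 ∧ (r.2.1 : ℝ) < r.2.2 ∧ (∀ q, ∃ p, H (q, p) < (r.1 : ℝ)) ∧
        ¬ ∃ θ : EuclideanSpace ℝ (Fin n) → EuclideanSpace ℝ (Fin n), ContDiff ℝ (⊤ : ℕ∞) θ ∧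
          (∀ q u v, ⟪fderiv ℝ θ q u, v⟫ - ⟪fderiv ℝ θ q v, u⟫ = ⟪B q u, v⟫) ∧
          ∀ q, H (q, -θ q) ≤ (r.2.2 : ℝ))
    · filter_upwards [MT.core bs hHsmooth hper hHconv hHsuper hBsmooth hBper' hBskew hBclosed
        hr.1 hr.2.1 hr.2.2.1 hr.2.2.2] with k hk _ hkm using hk hkm
    · exact Filter.Eventually.of_forall fun k h => absurd h hr
  filter_upwards [ae_all_iff.2 hall] with k hk hkk
  obtain ⟨hk1, hk2⟩ := hkk
  obtain ⟨a, ha1, ha2⟩ := exists_rat_btwn hk1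
  obtain ⟨b, hb1, hb2⟩ := EReal.lt_iff_exists_rat_btwn.1 hk2
  obtain ⟨b', hb3, hb4⟩ := EReal.lt_iff_exists_rat_btwn.1 hb2
  have hkb : k < (b : ℝ) := EReal.coe_lt_coe_iff.1 hb1
  have hbb : (b : ℝ) < (b' : ℝ) := EReal.coe_lt_coe_iff.1 hb3
  refine hk (a, b, b') ⟨ha2.trans hkb, hbb, fun q => ?_, ?_⟩ ⟨ha2, hkb⟩
  · exact exists_lt_of_ciInf_lt ((le_ciSup habove q).trans_lt ha1)
  · rintro ⟨θ, hθ, hθB, hθb⟩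
    refine absurd hb4 (not_lt.2 ?_)
    refine le_trans (b := ⨆ q, ((H (q, -θ q) : ℝ) : EReal)) (sInf_le ⟨θ, hθ, hθB, rfl⟩) ?_
    exact iSup_le fun q => EReal.coe_le_coe_iff.2 (hθb q)
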